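/- arXiv:2002.10874 — 3 statements merged into one kernel-verified Lean document; each statement's English description precedes it below -/
import Mathlib

section
/- Let Δ be a nonhyperelliptic lattice polygon with interior polygon Δ⁽¹⁾ of genus g⁽¹⁾ and with r⁽¹⁾ boundary lattice points, and suppose Δ has genus g and r boundary lattice points. Let 𝒯 be a unimodular triangulation of Δ all of whose interior edges intersect Δ⁽¹⁾. Then the number R of radial edges of 𝒯 equals g + r - g⁽¹⁾. -/
open Set Finset

noncomputable section

/-- A lattice point viewed as a point of the real plane. -/
def toR (p : ℤ × ℤ) : ℝ × ℝ := ((p.1 : ℝ), (p.2 : ℝ))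

/-- The real convex hull of a finite set of lattice points. -/
def polyHull (V : Finset (ℤ × ℤ)) : Set (ℝ × ℝ) :=
  convexHull ℝ (toR '' (V : Set (ℤ × ℤ)))

/-- `V` spans a two-dimensional (lattice) polygon. -/
def IsLatticePolygon (V : Finset (ℤ × ℤ)) : Prop :=
  ∃ p q r : ℤ × ℤ, p ∈ V ∧ q ∈ V ∧ r ∈ V ∧
    AffineIndependent ℝ ![toR p, toR q, toR r]

/-- Interior lattice points of the polygon spanned by `V`. -/
def intPts (V : Finset (ℤ × ℤ)) : Set (ℤ × ℤ) :=
  {p | toR p ∈ interior (polyHull V)}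

/-- Boundary lattice points of the polygon spanned by `V`. -/
def bdPts (V : Finset (ℤ × ℤ)) : Set (ℤ × ℤ) :=
  {p | toR p ∈ frontier (polyHull V)}

/-- All lattice points of the polygon spanned by `V`. -/
def latPts (V : Finset (ℤ × ℤ)) : Set (ℤ × ℤ) :=
  {p | toR p ∈ polyHull V}

/-- The interior polygon: convex hull of the interior lattice points. -/
def intPoly (V : Finset (ℤ × ℤ)) : Set (ℝ × ℝ) :=
  convexHull ℝ (toR '' intPts V)

/-- `Δ` is nonhyperelliptic: its interior polygon is two-dimensional. -/
def Nonhyperelliptic (V : Finset (ℤ × ℤ)) : Prop :=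
  ∃ p q r : ℤ × ℤ, p ∈ intPts V ∧ q ∈ intPts V ∧ r ∈ intPts V ∧
    AffineIndependent ℝ ![toR p, toR q, toR r]

/-- A unimodular triangulation of the polygon spanned by `V`: a finite set of
lattice triangles of area `1/2` covering the polygon, with pairwise disjoint
interiors. -/
structure UT (V : Finset (ℤ × ℤ)) where
  tris : Finset ((ℤ × ℤ) × (ℤ × ℤ) × (ℤ × ℤ))
  unimodular : ∀ t ∈ tris,
    |(t.2.1.1 - t.1.1) * (t.2.2.2 - t.1.2) - (t.2.1.2 - t.1.2) * (t.2.2.1 - t.1.1)| = 1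
  cover : polyHull V = ⋃ t ∈ tris, convexHull ℝ {toR t.1, toR t.2.1, toR t.2.2}
  disjointInt : ∀ t ∈ tris, ∀ s ∈ tris, t ≠ s →
    interior (convexHull ℝ {toR t.1, toR t.2.1, toR t.2.2}) ∩
      interior (convexHull ℝ {toR s.1, toR s.2.1, toR s.2.2}) = ∅

/-- The edges of a triangulation, as unordered pairs of lattice points. -/
def edgeSet {V : Finset (ℤ × ℤ)} (T : UT V) : Finset (Finset (ℤ × ℤ)) :=
  T.tris.biUnion (fun t => {{t.1, t.2.1}, {t.1, t.2.2}, {t.2.1, t.2.2}})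

/-- The segment spanned by an edge. -/
def segOf (e : Finset (ℤ × ℤ)) : Set (ℝ × ℝ) :=
  convexHull ℝ (toR '' (e : Set (ℤ × ℤ)))

/-- Interior edges: edges of the triangulation not contained in the boundary. -/
def intEdges {V : Finset (ℤ × ℤ)} (T : UT V) : Set (Finset (ℤ × ℤ)) :=
  {e | e ∈ edgeSet T ∧ ¬ segOf e ⊆ frontier (polyHull V)}

/-- An edge of the triangulation is radial if it joins an interior lattice point
of `Δ` to a boundary lattice point of `Δ` and meets the interior polygon in a
single point. -/
def Radial (V : Finset (ℤ × ℤ)) (e : Finset (ℤ × ℤ)) : Prop :=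
  ∃ p q : ℤ × ℤ, e = {p, q} ∧ p ∈ intPts V ∧ q ∈ bdPts V ∧
    ∃ x : ℝ × ℝ, segOf e ∩ intPoly V = {x}

/-- Determinant of two integer vectors. -/
def dZ (u v : ℤ × ℤ) : ℤ := u.1 * v.2 - u.2 * v.1

/-- Determinant of two real vectors. -/
def dR (u v : ℝ × ℝ) : ℝ := u.1 * v.2 - u.2 * v.1

lemma dR_toR (a b c e : ℤ × ℤ) :
    dR (toR b - toR a) (toR e - toR c) = (dZ (b - a) (e - c) : ℝ) := by
  simp [dR, dZ, toR]

lemma toR_inj {a b : ℤ × ℤ} (h : toR a = toR b) : a = b := by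
  simp only [toR, Prod.mk.injEq, Int.cast_inj] at h
  exact Prod.ext h.1 h.2

lemma mem_hull3 {A B C x : ℝ × ℝ} : x ∈ convexHull ℝ {A, B, C} ↔
    ∃ s t : ℝ, 0 ≤ s ∧ 0 ≤ t ∧ s + t ≤ 1 ∧ x = A + s • (B - A) + t • (C - A) := by
  constructor
  · intro hx
    have hsub : convexHull ℝ {A, B, C} ⊆
        {x | ∃ s t : ℝ, 0 ≤ s ∧ 0 ≤ t ∧ s + t ≤ 1 ∧ x = A + s • (B - A) + t • (C - A)} := by
      apply convexHull_min
      · rintro y (rfl | rfl | rfl)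
        · exact ⟨0, 0, by simp⟩
        · exact ⟨1, 0, by simp⟩
        · exact ⟨0, 1, by simp⟩
      · rintro y ⟨s, t, hs, ht, hst, rfl⟩ z ⟨s', t', hs', ht', hst', rfl⟩ a b ha hb hab
        refine ⟨a * s + b * s', a * t + b * t', by positivity, by positivity, ?_, ?_⟩
        · nlinarith
        · ext
          · simp; linear_combination A.1 * hab
          · simp; linear_combination A.2 * hab
    exact hsub hx
  · rintro ⟨s, t, hs, ht, hst, rfl⟩
    have hc := convex_convexHull ℝ ({A, B, C} : Set (ℝ × ℝ))
    have hA : A ∈ convexHull ℝ ({A, B, C} : Set (ℝ × ℝ)) := subset_convexHull _ _ (by simp)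
    have hB : B ∈ convexHull ℝ ({A, B, C} : Set (ℝ × ℝ)) := subset_convexHull _ _ (by simp)
    have hC : C ∈ convexHull ℝ ({A, B, C} : Set (ℝ × ℝ)) := subset_convexHull _ _ (by simp)
    have := hc.sum_mem (t := Finset.univ) (w := ![1 - s - t, s, t]) (z := ![A, B, C])
      (by intro i _; fin_cases i <;> simp <;> linarith)
      (by simp [Fin.sum_univ_three]; ring)
      (by intro i _; fin_cases i <;> simp [hA, hB, hC])
    convert this using 1
    simp [Fin.sum_univ_three]
    module

/-- A triple of points of a convex set: the spanned triangle is inside. -/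
lemma convex_tri_mem {K : Set (ℝ × ℝ)} (hK : Convex ℝ K) {A B C : ℝ × ℝ} (hA : A ∈ K)
    (hB : B ∈ K) (hC : C ∈ K) {s t : ℝ} (hs : 0 ≤ s) (ht : 0 ≤ t) (hst : s + t ≤ 1) :
    A + s • (B - A) + t • (C - A) ∈ K := by
  have : convexHull ℝ {A, B, C} ⊆ K := convexHull_min (by
    rintro y (rfl | rfl | rfl) <;> assumption) hK
  exact this (mem_hull3.2 ⟨s, t, hs, ht, hst, rfl⟩)

lemma mem_tri_dR {A B C x : ℝ × ℝ} (h : dR (B - A) (C - A) = 1)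
    (hx : x ∈ convexHull ℝ {A, B, C}) :
    0 ≤ dR (B - A) (x - A) ∧ 0 ≤ dR (x - A) (C - A) ∧
      dR (B - A) (x - A) + dR (x - A) (C - A) ≤ 1 := by
  obtain ⟨s, t, hs, ht, hst, rfl⟩ := mem_hull3.1 hx
  have h1 : dR (B - A) (A + s • (B - A) + t • (C - A) - A) = t := by
    simp [dR] at h ⊢; linear_combination t * h
  have h2 : dR (A + s • (B - A) + t • (C - A) - A) (C - A) = s := by
    simp [dR] at h ⊢; linear_combination s * h
  rw [h1, h2]; exact ⟨ht, hs, by linarith⟩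

lemma tri_interior {A B C x : ℝ × ℝ} (h : dR (B - A) (C - A) = 1)
    (h1 : 0 < dR (B - A) (x - A)) (h2 : 0 < dR (x - A) (C - A))
    (h3 : dR (B - A) (x - A) + dR (x - A) (C - A) < 1) :
    x ∈ interior (convexHull ℝ {A, B, C}) := by
  rw [mem_interior]
  refine ⟨{y | 0 < dR (B - A) (y - A) ∧ 0 < dR (y - A) (C - A) ∧
    dR (B - A) (y - A) + dR (y - A) (C - A) < 1}, ?_, ?_, h1, h2, h3⟩
  · rintro y ⟨a, b, c⟩
    refine mem_hull3.2 ⟨_, _, b.le, a.le, by linarith, ?_⟩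
    ext
    · simp [dR] at h ⊢
      linear_combination (A.1 - y.1) * h
    · simp [dR] at h ⊢
      linear_combination (A.2 - y.2) * h
  · simp only [dR, Set.ofPred_and]
    refine IsOpen.inter ?_ (IsOpen.inter ?_ ?_)
    all_goals exact isOpen_lt (by fun_prop) (by fun_prop)

/-- Supporting line at a non-interior point. -/
lemma support {K : Set (ℝ × ℝ)} (hK : Convex ℝ K) (hne : (interior K).Nonempty) {x : ℝ × ℝ}
    (hx : x ∉ interior K) : ∃ α β : ℝ, (∀ y ∈ K, α * y.1 + β * y.2 ≤ α * x.1 + β * x.2) ∧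
      ∃ y ∈ K, α * y.1 + β * y.2 < α * x.1 + β * x.2 := by
  obtain ⟨f, hf⟩ := geometric_hahn_banach_open_point hK.interior isOpen_interior hx
  have hfe : ∀ y : ℝ × ℝ, f y = f (1, 0) * y.1 + f (0, 1) * y.2 := by
    intro y
    have : y = y.1 • ((1 : ℝ), (0 : ℝ)) + y.2 • ((0 : ℝ), (1 : ℝ)) := by ext <;> simp
    conv_lhs => rw [this]
    rw [map_add, map_smul, map_smul]; simp [mul_comm]
  refine ⟨f (1, 0), f (0, 1), ?_, ?_⟩
  · intro y hy
    rw [← hfe, ← hfe]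
    have hy' : y ∈ closure (interior K) := by
      rw [hK.closure_interior_eq_closure_of_nonempty_interior hne]; exact subset_closure hy
    have hcl : IsClosed {z | f z ≤ f x} := isClosed_le (by fun_prop) (by fun_prop)
    exact closure_minimal (fun z hz => (hf z hz).le) hcl hy'
  · obtain ⟨y, hy⟩ := hne
    refine ⟨y, interior_subset hy, ?_⟩
    rw [← hfe, ← hfe]; exact hf y hy

/-- A nonnegative nonconstant affine function is positive on the interior. -/
lemma pos_of_interior {K : Set (ℝ × ℝ)} {α β γ : ℝ} (hab : α ≠ 0 ∨ β ≠ 0)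
    (hK : ∀ y ∈ K, 0 ≤ α * y.1 + β * y.2 + γ) {x : ℝ × ℝ} (hx : x ∈ interior K) :
    0 < α * x.1 + β * x.2 + γ := by
  have hpos : 0 < α ^ 2 + β ^ 2 := by
    rcases hab with h | h <;> positivity
  have ht : Filter.Tendsto (fun ε : ℝ => x - ε • (α, β)) (nhdsWithin 0 (Set.Ioi 0)) (nhds x) := by
    have : Continuous (fun ε : ℝ => x - ε • (α, β)) := by fun_prop
    have := this.tendsto 0
    simp only [zero_smul, sub_zero] at this
    exact this.mono_left nhdsWithin_le_nhds
  have hev := ht.eventually (mem_interior_iff_mem_nhds.1 hx)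
  obtain ⟨ε, hε, hε0⟩ := (hev.and self_mem_nhdsWithin).exists
  have := hK _ hε
  simp at this
  have hε0' : 0 < ε := hε0
  nlinarith [mul_pos hε0' hpos]

lemma dR_pos_of_interior {K : Set (ℝ × ℝ)} {A B : ℝ × ℝ} (hAB : B ≠ A)
    (hK : ∀ y ∈ K, 0 ≤ dR (B - A) (y - A)) {x : ℝ × ℝ} (hx : x ∈ interior K) :
    0 < dR (B - A) (x - A) := by
  have := pos_of_interior (K := K) (α := -(B - A).2) (β := (B - A).1)
    (γ := (B - A).2 * A.1 - (B - A).1 * A.2) (by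
      by_contra hcon
      push Not at hcon
      apply hAB
      rw [← sub_eq_zero]
      exact Prod.ext hcon.2 (neg_eq_zero.1 hcon.1)) (by
      intro y hy
      have := hK y hy
      simp only [dR, Prod.fst_sub, Prod.snd_sub] at this ⊢
      linarith) hx
  simp only [dR, Prod.fst_sub, Prod.snd_sub] at this ⊢
  linarith

/-- `abc` is a counterclockwise triangle of the triangulation. -/
def Tri {V : Finset (ℤ × ℤ)} (T : UT V) (a b c : ℤ × ℤ) : Prop :=
  dZ (b - a) (c - a) = 1 ∧ ∃ t ∈ T.tris, ({t.1, t.2.1, t.2.2} : Finset (ℤ × ℤ)) = {a, b, c}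

section
variable {V : Finset (ℤ × ℤ)} {T : UT V}

lemma Tri.rot {a b c : ℤ × ℤ} (h : Tri T a b c) : Tri T b c a := by
  obtain ⟨h1, t, ht, he⟩ := h
  refine ⟨?_, t, ht, ?_⟩
  · simp only [dZ, Prod.fst_sub, Prod.snd_sub] at h1 ⊢; linarith
  · rw [he]; ext x; simp; tauto

lemma tri_of_mem {t : (ℤ × ℤ) × (ℤ × ℤ) × (ℤ × ℤ)} (ht : t ∈ T.tris) :
    Tri T t.1 t.2.1 t.2.2 ∨ Tri T t.1 t.2.2 t.2.1 := by
  have h := T.unimodular t ht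
  rcases (abs_eq (by norm_num)).1 h with h | h
  · left; exact ⟨by simpa [dZ] using h, t, ht, rfl⟩
  · right
    refine ⟨by simp [dZ]; linarith, t, ht, ?_⟩
    ext x; simp; tauto

lemma Tri.hull_eq {a b c : ℤ × ℤ} {t : (ℤ × ℤ) × (ℤ × ℤ) × (ℤ × ℤ)}
    (he : ({t.1, t.2.1, t.2.2} : Finset (ℤ × ℤ)) = {a, b, c}) :
    convexHull ℝ {toR t.1, toR t.2.1, toR t.2.2} = convexHull ℝ {toR a, toR b, toR c} := by
  have : (toR '' (({t.1, t.2.1, t.2.2} : Finset (ℤ × ℤ)) : Set (ℤ × ℤ))) =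
    toR '' (({a, b, c} : Finset (ℤ × ℤ)) : Set (ℤ × ℤ)) := by rw [he]
  simp only [Finset.coe_insert, Finset.coe_singleton, Set.image_insert_eq,
    Set.image_singleton] at this
  rw [this]

lemma Tri.subset {a b c : ℤ × ℤ} (h : Tri T a b c) :
    convexHull ℝ {toR a, toR b, toR c} ⊆ polyHull V := by
  obtain ⟨h1, t, ht, he⟩ := h
  rw [← Tri.hull_eq he, T.cover]
  exact Set.subset_biUnion_of_mem (u := fun t : (ℤ × ℤ) × (ℤ × ℤ) × (ℤ × ℤ) =>
    convexHull ℝ {toR t.1, toR t.2.1, toR t.2.2}) ht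

lemma Tri.mem {a b c : ℤ × ℤ} (h : Tri T a b c) : toR a ∈ polyHull V :=
  h.subset (subset_convexHull _ _ (by simp))

lemma Tri.dR {a b c : ℤ × ℤ} (h : Tri T a b c) :
    dR (toR b - toR a) (toR c - toR a) = 1 := by
  rw [dR_toR, h.1]; simp

lemma Tri.edge {a b c : ℤ × ℤ} (h : Tri T a b c) : ({a, b} : Finset (ℤ × ℤ)) ∈ edgeSet T := by
  obtain ⟨h1, t, ht, he⟩ := h
  obtain ⟨x, y, z⟩ := t
  simp only [edgeSet, Finset.mem_biUnion]
  refine ⟨_, ht, ?_⟩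
  have ha : a ∈ ({x, y, z} : Finset (ℤ × ℤ)) := by simp only at he; rw [he]; simp
  have hb : b ∈ ({x, y, z} : Finset (ℤ × ℤ)) := by simp only at he; rw [he]; simp
  have hab : a ≠ b := by rintro rfl; simp [dZ] at h1
  simp only [Finset.mem_insert, Finset.mem_singleton] at ha hb ⊢
  rcases ha with rfl | rfl | rfl <;> rcases hb with rfl | rfl | rfl <;>
    first
    | exact absurd rfl hab
    | simp [Finset.pair_comm]

lemma pair_cases {p q a b : ℤ × ℤ} (h : ({p, q} : Finset (ℤ × ℤ)) = {a, b}) :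
    (p = a ∧ q = b) ∨ (p = b ∧ q = a) := by
  have h' : ({p, q} : Set (ℤ × ℤ)) = {a, b} := by
    have := congrArg (fun s : Finset (ℤ × ℤ) => (s : Set (ℤ × ℤ))) h
    simpa using this
  exact Set.pair_eq_pair_iff.1 h'

lemma tri_of_edge {p q : ℤ × ℤ} (h : ({p, q} : Finset (ℤ × ℤ)) ∈ edgeSet T) :
    ∃ z, Tri T p q z ∨ Tri T p z q := by
  simp only [edgeSet, Finset.mem_biUnion, Finset.mem_insert, Finset.mem_singleton] at h
  obtain ⟨t, ht, h⟩ := h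
  have key := tri_of_mem (T := T) ht
  rcases h with h | h | h <;> rcases pair_cases h with ⟨rfl, rfl⟩ | ⟨rfl, rfl⟩
  · exact ⟨t.2.2, key⟩
  · exact ⟨t.2.2, key.symm.imp (fun k => k.rot.rot) (fun k => k.rot)⟩
  · exact ⟨t.2.1, key.symm⟩
  · exact ⟨t.2.1, key.imp (fun k => k.rot.rot) (fun k => k.rot)⟩
  · exact ⟨t.1, key.imp (fun k => k.rot) (fun k => k.rot.rot)⟩
  · exact ⟨t.1, key.symm.imp (fun k => k.rot) (fun k => k.rot.rot)⟩

/-- Points slightly along an integer direction in the open sector lie in the open triangle. -/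
lemma sector_interior {a b c v : ℤ × ℤ} (h : dZ (b - a) (c - a) = 1)
    (h1 : 0 < dZ (b - a) v) (h2 : 0 < dZ v (c - a)) {ε : ℝ} (hε : 0 < ε)
    (hε1 : ε * (dZ (b - a) v + dZ v (c - a)) < 1) :
    toR a + ε • toR v ∈ interior (convexHull ℝ {toR a, toR b, toR c}) := by
  have e1 : dR (toR b - toR a) (toR a + ε • toR v - toR a) = ε * dZ (b - a) v := by
    simp [dR, dZ, toR]; ring
  have e2 : dR (toR a + ε • toR v - toR a) (toR c - toR a) = ε * dZ v (c - a) := by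
    simp [dR, dZ, toR]; ring
  have h1' : (0 : ℝ) < dZ (b - a) v := by exact_mod_cast h1
  have h2' : (0 : ℝ) < dZ v (c - a) := by exact_mod_cast h2
  apply tri_interior
  · rw [dR_toR, h]; simp
  · rw [e1]; positivity
  · rw [e2]; positivity
  · rw [e1, e2]; linarith

lemma sector_unique {a b c b' c' v : ℤ × ℤ} (h : Tri T a b c) (h' : Tri T a b' c')
    (h1 : 0 < dZ (b - a) v) (h2 : 0 < dZ v (c - a))
    (h1' : 0 < dZ (b' - a) v) (h2' : 0 < dZ v (c' - a)) : b = b' ∧ c = c' := by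
  obtain ⟨hd, t, ht, he⟩ := h
  obtain ⟨hd', t', ht', he'⟩ := h'
  have htt : t = t' := by
    by_contra hne
    have hdis := T.disjointInt t ht t' ht' hne
    rw [Tri.hull_eq he, Tri.hull_eq he'] at hdis
    have p1 : (0 : ℝ) < dZ (b - a) v := by exact_mod_cast h1
    have p2 : (0 : ℝ) < dZ v (c - a) := by exact_mod_cast h2
    have p3 : (0 : ℝ) < dZ (b' - a) v := by exact_mod_cast h1'
    have p4 : (0 : ℝ) < dZ v (c' - a) := by exact_mod_cast h2'
    set M : ℝ := dZ (b - a) v + dZ v (c - a) + dZ (b' - a) v + dZ v (c' - a) with hM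
    have hM0 : 0 < M := by positivity
    have hε : 0 < (M + 1)⁻¹ := by positivity
    have hlt : ∀ x : ℝ, x ≤ M → (M + 1)⁻¹ * x < 1 := by
      intro x hx
      rw [inv_mul_lt_iff₀ (by linarith)]; linarith
    have i1 := sector_interior hd h1 h2 hε (hlt _ (by rw [hM]; linarith))
    have i2 := sector_interior hd' h1' h2' hε (hlt _ (by rw [hM]; linarith))
    have : toR a + (M + 1)⁻¹ • toR v ∈ (∅ : Set (ℝ × ℝ)) := by
      rw [← hdis]; exact ⟨i1, i2⟩
    exact this
  subst htt
  have hE : ({a, b, c} : Finset (ℤ × ℤ)) = {a, b', c'} := he.symm.trans he'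
  have hb : b ∈ ({a, b', c'} : Finset (ℤ × ℤ)) := by rw [← hE]; simp
  have hc : c ∈ ({a, b', c'} : Finset (ℤ × ℤ)) := by rw [← hE]; simp
  simp only [Finset.mem_insert, Finset.mem_singleton] at hb hc
  rcases hb with rfl | rfl | rfl
  · simp [dZ] at hd
  · rcases hc with rfl | rfl | rfl
    · simp [dZ] at hd
    · simp only [dZ] at hd; ring_nf at hd; simp at hd
    · exact ⟨rfl, rfl⟩
  · rcases hc with rfl | rfl | rfl
    · simp [dZ] at hd
    · simp only [dZ] at hd hd'; linarith
    · simp only [dZ] at hd; ring_nf at hd; simp at hd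

/-- Lattice points of a unimodular triangle are its vertices. -/
lemma lattice_in_tri {a b c x : ℤ × ℤ} (h : dZ (b - a) (c - a) = 1)
    (hx : toR x ∈ convexHull ℝ {toR a, toR b, toR c}) : x = a ∨ x = b ∨ x = c := by
  obtain ⟨h1, h2, h3⟩ := mem_tri_dR (by rw [dR_toR, h]; simp) hx
  rw [dR_toR] at h1 h2 h3
  rw [dR_toR] at h3
  have h1' : 0 ≤ dZ (b - a) (x - a) := by exact_mod_cast h1
  have h2' : 0 ≤ dZ (x - a) (c - a) := by exact_mod_cast h2
  have h3' : dZ (b - a) (x - a) + dZ (x - a) (c - a) ≤ 1 := by exact_mod_cast h3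
  have e1 : x.1 - a.1 = dZ (x - a) (c - a) * (b.1 - a.1) + dZ (b - a) (x - a) * (c.1 - a.1) := by
    simp [dZ] at h ⊢; linear_combination (a.1 - x.1) * h
  have e2 : x.2 - a.2 = dZ (x - a) (c - a) * (b.2 - a.2) + dZ (b - a) (x - a) * (c.2 - a.2) := by
    simp [dZ] at h ⊢; linear_combination (a.2 - x.2) * h
  have : (dZ (b - a) (x - a) = 0 ∧ dZ (x - a) (c - a) = 0) ∨
    (dZ (b - a) (x - a) = 0 ∧ dZ (x - a) (c - a) = 1) ∨
    (dZ (b - a) (x - a) = 1 ∧ dZ (x - a) (c - a) = 0) := by omega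
  rcases this with ⟨k1, k2⟩ | ⟨k1, k2⟩ | ⟨k1, k2⟩ <;> rw [k1, k2] at e1 e2
  · left; ext <;> linarith
  · right; left; ext <;> linarith
  · right; right; ext <;> linarith

lemma freq_ineq {A B : ℤ} (h : ∃ᶠ j : ℕ in Filter.atTop, 0 ≤ (j : ℤ) * A + B) :
    0 < A ∨ (A = 0 ∧ 0 ≤ B) := by
  by_contra hcon
  push Not at hcon
  apply h
  filter_upwards [Filter.eventually_ge_atTop (B.natAbs + 1)] with j hj
  have hj' : |B| + 1 ≤ (j : ℤ) := by rw [Int.abs_eq_natAbs]; exact_mod_cast hj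
  have := le_abs_self B
  rcases hcon.1.lt_or_eq with hA | hA
  · nlinarith
  · have := hcon.2 hA
    rw [hA]; simpa using this

/-- In a direction `d` perturbed infinitesimally by `n`, there is a triangle at `a`. -/
lemma exists_tri {a d n : ℤ × ℤ}
    (hmem : ∀ᶠ j : ℕ in Filter.atTop,
      toR a + ((j : ℝ)⁻¹) • toR d + ((j : ℝ)⁻¹ * (j : ℝ)⁻¹) • toR n ∈ polyHull V) :
    ∃ b c, Tri T a b c ∧ (0 < dZ (b - a) d ∨ (dZ (b - a) d = 0 ∧ 0 ≤ dZ (b - a) n)) ∧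
      (0 < dZ d (c - a) ∨ (dZ d (c - a) = 0 ∧ 0 ≤ dZ n (c - a))) := by
  set x : ℕ → ℝ × ℝ := fun j =>
    toR a + ((j : ℝ)⁻¹) • toR d + ((j : ℝ)⁻¹ * (j : ℝ)⁻¹) • toR n with hx
  obtain ⟨t, ht, hf⟩ : ∃ t ∈ T.tris, ∃ᶠ j in Filter.atTop,
      x j ∈ convexHull ℝ {toR t.1, toR t.2.1, toR t.2.2} := by
    by_contra hcon
    push Not at hcon
    have := (Filter.eventually_all_finset T.tris).2 hcon
    obtain ⟨j, h1, h2⟩ := (hmem.and this).exists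
    rw [T.cover] at h1
    simp only [Set.mem_iUnion] at h1
    obtain ⟨t, ht, h3⟩ := h1
    exact h2 t ht h3
  have hlim : Filter.Tendsto x Filter.atTop (nhds (toR a)) := by
    have hj : Filter.Tendsto (fun j : ℕ => (j : ℝ)⁻¹) Filter.atTop (nhds 0) :=
      tendsto_inv_atTop_nhds_zero_nat
    have h1 := ((hj.smul_const (toR d)).const_add (toR a)).add ((hj.mul hj).smul_const (toR n))
    simpa using h1
  have key : ∃ b c, Tri T a b c ∧ ∃ᶠ j in Filter.atTop,
      x j ∈ convexHull ℝ {toR a, toR b, toR c} := by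
    have aux : ∀ u v w, Tri T u v w → (∃ᶠ j in Filter.atTop,
        x j ∈ convexHull ℝ {toR u, toR v, toR w}) → ∃ b c, Tri T a b c ∧ ∃ᶠ j in Filter.atTop,
        x j ∈ convexHull ℝ {toR a, toR b, toR c} := by
      intro u v w hT hfr
      have hcl : IsClosed (convexHull ℝ {toR u, toR v, toR w}) :=
        Set.Finite.isClosed_convexHull ℝ (by simp)
      have ha := hcl.mem_of_frequently_of_tendsto hfr hlim
      have e1 : ({toR u, toR v, toR w} : Set (ℝ × ℝ)) = {toR v, toR w, toR u} := by
        ext x; simp; tauto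
      have e2 : ({toR u, toR v, toR w} : Set (ℝ × ℝ)) = {toR w, toR u, toR v} := by
        ext x; simp; tauto
      rcases lattice_in_tri hT.1 ha with rfl | rfl | rfl
      · exact ⟨_, _, hT, hfr⟩
      · rw [e1] at hfr; exact ⟨_, _, hT.rot, hfr⟩
      · rw [e2] at hfr; exact ⟨_, _, hT.rot.rot, hfr⟩
    rcases tri_of_mem (T := T) ht with h | h
    · exact aux _ _ _ h hf
    · refine aux _ _ _ h ?_
      have e1 : ({toR t.1, toR t.2.1, toR t.2.2} : Set (ℝ × ℝ)) =
        {toR t.1, toR t.2.2, toR t.2.1} := by ext x; simp; tauto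
      rwa [e1] at hf
  obtain ⟨b, c, hT, hfr⟩ := key
  refine ⟨b, c, hT, freq_ineq ?_, freq_ineq ?_⟩
  · refine (hfr.and_eventually (Filter.eventually_gt_atTop 0)).mono ?_
    rintro j ⟨hj, hj0⟩
    have h1 := (mem_tri_dR hT.dR hj).1
    have hjr : (0 : ℝ) < j := by exact_mod_cast hj0
    have e : dR (toR b - toR a) (x j - toR a) * (j * j) =
        ((j * dZ (b - a) d + dZ (b - a) n : ℤ) : ℝ) := by
      simp [dR, dZ, toR, hx]; field_simp; ring
    have : (0 : ℝ) ≤ ((j * dZ (b - a) d + dZ (b - a) n : ℤ) : ℝ) := by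
      rw [← e]; positivity
    exact_mod_cast this
  · refine (hfr.and_eventually (Filter.eventually_gt_atTop 0)).mono ?_
    rintro j ⟨hj, hj0⟩
    have h1 := (mem_tri_dR hT.dR hj).2.1
    have hjr : (0 : ℝ) < j := by exact_mod_cast hj0
    have e : dR (x j - toR a) (toR c - toR a) * (j * j) =
        ((j * dZ d (c - a) + dZ n (c - a) : ℤ) : ℝ) := by
      simp [dR, dZ, toR, hx]; field_simp; ring
    have : (0 : ℝ) ≤ ((j * dZ d (c - a) + dZ n (c - a) : ℤ) : ℝ) := by
      rw [← e]; positivity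
    exact_mod_cast this

end

lemma dR_nonneg_convex (A B : ℝ × ℝ) : Convex ℝ {y : ℝ × ℝ | 0 ≤ dR (B - A) (y - A)} := by
  intro y hy z hz a b ha hb hab
  simp only [Set.mem_ofPred_eq] at hy hz ⊢
  have : dR (B - A) (a • y + b • z - A) = a * dR (B - A) (y - A) + b * dR (B - A) (z - A) := by
    simp [dR]
    linear_combination ((B.1 - A.1) * A.2 - (B.2 - A.2) * A.1) * hab
  rw [this]; positivity

/-- Gift wrapping: the next lattice point, counterclockwise, on the boundary of a hull. -/
lemma wrap {S : Set (ℤ × ℤ)} (hS : S.Finite)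
    (hne : (interior (convexHull ℝ (toR '' S))).Nonempty) {p : ℤ × ℤ}
    (hp : toR p ∉ interior (convexHull ℝ (toR '' S))) :
    ∃ p' ∈ S, (∀ y ∈ convexHull ℝ (toR '' S), 0 ≤ dR (toR p' - toR p) (y - toR p)) ∧
      ∃ z ∈ S, 0 < dZ (p' - p) (z - p) := by
  obtain ⟨α, β, hle, y0, hy0, hlt⟩ := support (convex_convexHull ℝ _) hne hp
  set f : ℤ × ℤ → ℝ := fun s => α * (s.1 - p.1) + β * (s.2 - p.2) with hf
  set g : ℤ × ℤ → ℝ := fun s => -β * (s.1 - p.1) + α * (s.2 - p.2) with hg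
  have hab : 0 < α ^ 2 + β ^ 2 := by
    by_contra hcon
    have h1 : α = 0 := by nlinarith [sq_nonneg α, sq_nonneg β]
    have h2 : β = 0 := by nlinarith [sq_nonneg α, sq_nonneg β]
    rw [h1, h2] at hlt; simp at hlt
  have hfs : ∀ s ∈ S, f s ≤ 0 := by
    intro s hs
    have := hle _ (subset_convexHull ℝ _ (Set.mem_image_of_mem toR hs))
    simp only [toR] at this
    simp only [hf]; linarith
  obtain ⟨s0, hs0, hs0f⟩ : ∃ s ∈ S, f s < 0 := by
    by_contra hcon
    push Not at hcon
    have hsub : convexHull ℝ (toR '' S) ⊆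
        {y | α * (toR p).1 + β * (toR p).2 ≤ α * y.1 + β * y.2} := by
      apply convexHull_min
      · rintro _ ⟨s, hs, rfl⟩
        have := hcon s hs
        simp only [hf] at this
        simp only [toR, Set.mem_ofPred_eq]; linarith
      · intro y hy z hz a b ha hb hab
        simp only [Set.mem_ofPred_eq, Prod.fst_add, Prod.snd_add, Prod.smul_fst, Prod.smul_snd,
          smul_eq_mul] at hy hz ⊢
        have hb' : b = 1 - a := by linarith
        subst hb'
        nlinarith
    have := hsub hy0
    simp only [Set.mem_ofPred_eq] at this
    linarith
  have hdet : ∀ u v : ℤ × ℤ, (dZ (u - p) (v - p) : ℝ) * (α ^ 2 + β ^ 2) =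
      f u * g v - g u * f v := by
    intro u v
    simp [dZ, hf, hg]; ring
  have key : ∃ u ∈ S, u ≠ p ∧ ∀ v ∈ S, 0 ≤ f u * g v - g u * f v := by
    by_cases hc : ∃ u ∈ S, f u = 0 ∧ 0 < g u
    · obtain ⟨u, hu, h1, h2⟩ := hc
      refine ⟨u, hu, ?_, ?_⟩
      · rintro rfl; simp [hg] at h2
      · intro v hv
        rw [h1]; nlinarith [hfs v hv]
    · push Not at hc
      obtain ⟨u, hu, hmin⟩ := Finset.exists_min_image
        (hS.toFinset.filter (fun s => f s < 0)) (fun s => g s / f s)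
        ⟨s0, by simp [hs0, hs0f]⟩
      simp only [Finset.mem_filter, Set.Finite.mem_toFinset] at hu hmin
      refine ⟨u, hu.1, ?_, ?_⟩
      · rintro rfl
        have := hu.2
        simp [hf] at this
      · intro v hv
        rcases (hfs v hv).lt_or_eq with h | h
        · have := hmin v ⟨hv, h⟩
          have hu2 := hu.2
          have e1 : g u / f u * (f u * f v) = g u * f v := by
            have := hu2.ne; field_simp
          have e2 : g v / f v * (f u * f v) = f u * g v := by
            have := h.ne; field_simp
          have := mul_le_mul_of_nonneg_right this (mul_pos_of_neg_of_neg hu2 h).le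
          rw [e1, e2] at this; linarith
        · rw [h]; nlinarith [hc v hv h, hu.2]
  obtain ⟨u, hu, hup, hall⟩ := key
  have hallZ : ∀ v ∈ S, 0 ≤ dZ (u - p) (v - p) := by
    intro v hv
    have h1 := hall v hv
    rw [← hdet] at h1
    have := nonneg_of_mul_nonneg_left h1 hab
    exact_mod_cast this
  have hallK : ∀ y ∈ convexHull ℝ (toR '' S), 0 ≤ dR (toR u - toR p) (y - toR p) := by
    have : convexHull ℝ (toR '' S) ⊆ {y | 0 ≤ dR (toR u - toR p) (y - toR p)} := by
      apply convexHull_min _ (dR_nonneg_convex _ _)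
      rintro _ ⟨s, hs, rfl⟩
      simp only [Set.mem_ofPred_eq]
      rw [dR_toR]; exact_mod_cast hallZ s hs
    exact this
  refine ⟨u, hu, hallK, ?_⟩
  by_contra hcon
  push Not at hcon
  have hneg : convexHull ℝ (toR '' S) ⊆ {y | 0 ≤ dR (toR p - toR u) (y - toR u)} := by
    apply convexHull_min _ (dR_nonneg_convex _ _)
    rintro _ ⟨s, hs, rfl⟩
    simp only [Set.mem_ofPred_eq]
    rw [dR_toR]
    have := hcon s hs
    have e : dZ (p - u) (s - u) = - dZ (u - p) (s - p) := by simp [dZ]; ring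
    rw [e]; exact_mod_cast (by linarith)
  obtain ⟨y, hy⟩ := hne
  have h1 := dR_pos_of_interior (fun h => hup (toR_inj h)) hallK hy
  have h2 := hneg (interior_subset hy)
  simp only [Set.mem_ofPred_eq] at h2
  simp only [dR, Prod.fst_sub, Prod.snd_sub] at h1 h2
  linarith

lemma segOf_pair (p q : ℤ × ℤ) : segOf {p, q} = segment ℝ (toR p) (toR q) := by
  simp only [segOf, Finset.coe_insert, Finset.coe_singleton, Set.image_insert_eq,
    Set.image_singleton, convexHull_pair]

lemma mem_segOf {p q : ℤ × ℤ} {x : ℝ × ℝ} : x ∈ segOf {p, q} ↔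
    ∃ t : ℝ, 0 ≤ t ∧ t ≤ 1 ∧ x = toR p + t • (toR q - toR p) := by
  rw [segOf_pair, segment_eq_image']
  constructor
  · rintro ⟨t, ⟨h0, h1⟩, rfl⟩; exact ⟨t, h0, h1, rfl⟩
  · rintro ⟨t, h0, h1, rfl⟩; exact ⟨t, ⟨h0, h1⟩, rfl⟩

/-- A chord contained in the frontier is supporting. -/
lemma frontier_support {K : Set (ℝ × ℝ)} (hK : Convex ℝ K) (hne : (interior K).Nonempty)
    {p q : ℤ × ℤ} {z : ℝ × ℝ} (hp : toR p ∈ K) (hq : toR q ∈ K) (hz : z ∈ K)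
    (hd : dR (toR q - toR p) (z - toR p) = 1)
    (hfr : segOf {p, q} ⊆ frontier K) : ∀ y ∈ K, 0 ≤ dR (toR q - toR p) (y - toR p) := by
  have hm : toR p + (1 / 2 : ℝ) • (toR q - toR p) ∉ interior K := by
    intro hi
    exact (hfr (mem_segOf.2 ⟨1 / 2, by norm_num, by norm_num, rfl⟩)).2 hi
  obtain ⟨α, β, hle, y0, hy0, hlt⟩ := support hK hne hm
  have h1 := hle _ hp
  have h2 := hle _ hq
  have h3 := hle _ hz
  simp only [Prod.fst_add, Prod.snd_add, Prod.smul_fst, Prod.smul_snd, Prod.fst_sub,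
    Prod.snd_sub, smul_eq_mul] at h1 h2 h3 hle hlt
  have heq : α * (toR q).1 + β * (toR q).2 = α * (toR p).1 + β * (toR p).2 := by linarith
  have key : ∀ y : ℝ × ℝ, α * (y.1 - (toR p).1) + β * (y.2 - (toR p).2) =
      dR (toR q - toR p) (y - toR p) * (α * (z.1 - (toR p).1) + β * (z.2 - (toR p).2)) := by
    intro y
    simp only [dR, Prod.fst_sub, Prod.snd_sub] at hd ⊢
    linear_combination (-α * (y.1 - (toR p).1) - β * (y.2 - (toR p).2)) * hd +
      ((y.1 - (toR p).1) * (z.2 - (toR p).2) - (y.2 - (toR p).2) * (z.1 - (toR p).1)) * heq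
  set c := α * (z.1 - (toR p).1) + β * (z.2 - (toR p).2) with hc
  have hc0 : c ≤ 0 := by linarith
  have hc1 : c ≠ 0 := by
    intro h0
    have := key y0
    rw [h0, mul_zero] at this
    linarith
  have hc2 : c < 0 := lt_of_le_of_ne hc0 hc1
  intro y hy
  have h4 := hle y hy
  have h5 := key y
  have h6 : dR (toR q - toR p) (y - toR p) * c ≤ 0 := by rw [← h5]; linarith
  by_contra hneg
  push Not at hneg
  nlinarith [mul_pos_of_neg_of_neg hneg hc2]

/-- A direction in the cone spanned by two points of a convex set is admissible. -/
lemma cone_mem {K : Set (ℝ × ℝ)} (hK : Convex ℝ K) {P U W Q : ℝ × ℝ} (hP : P ∈ K) (hU : U ∈ K)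
    (hW : W ∈ K) (h : 0 < dR (U - P) (W - P)) (h1 : 0 ≤ dR (U - P) (Q - P))
    (h2 : 0 ≤ dR (Q - P) (W - P)) : ∃ ε : ℝ, 0 < ε ∧ ε ≤ 1 ∧ P + ε • (Q - P) ∈ K := by
  set D := dR (U - P) (W - P) with hD
  set a := dR (U - P) (Q - P) with ha
  set b := dR (Q - P) (W - P) with hb
  have hpos : 0 < a + b + D := by linarith
  refine ⟨D / (a + b + D), by positivity, by rw [div_le_one hpos]; linarith, ?_⟩
  have := convex_tri_mem hK hP hU hW (s := b / (a + b + D)) (t := a / (a + b + D))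
    (by positivity) (by positivity) (by rw [← add_div, div_le_one hpos]; linarith)
  convert this using 1
  have e1 : D * (Q.1 - P.1) = b * (U.1 - P.1) + a * (W.1 - P.1) := by
    simp [hD, ha, hb, dR]; ring
  have e2 : D * (Q.2 - P.2) = b * (U.2 - P.2) + a * (W.2 - P.2) := by
    simp [hD, ha, hb, dR]; ring
  ext
  · simp; field_simp; linarith
  · simp; field_simp; linarith

lemma finite_of_bounded {K : Set (ℝ × ℝ)} (hK : Bornology.IsBounded K) :
    {p : ℤ × ℤ | toR p ∈ K}.Finite := by
  obtain ⟨M, hM⟩ := hK.subset_closedBall 0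
  apply ((Set.finite_Icc (-⌈M⌉) ⌈M⌉).prod (Set.finite_Icc (-⌈M⌉) ⌈M⌉)).subset
  intro p hp
  have h := hM hp
  simp only [Metric.mem_closedBall, dist_zero_right, Prod.norm_def, toR, Real.norm_eq_abs,
    sup_le_iff, abs_le] at h
  have hc := Int.le_ceil M
  simp only [Set.mem_prod, Set.mem_Icc]
  obtain ⟨⟨h1, h2⟩, h3, h4⟩ := h
  refine ⟨⟨?_, ?_⟩, ?_, ?_⟩ <;>
  · have : (0:ℝ) ≤ 1 := zero_le_one
    rify
    linarith

lemma polyHull_convex (V : Finset (ℤ × ℤ)) : Convex ℝ (polyHull V) := convex_convexHull _ _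

lemma polyHull_compact (V : Finset (ℤ × ℤ)) : IsCompact (polyHull V) :=
  Set.Finite.isCompact_convexHull ℝ ((Finset.finite_toSet V).image toR)

lemma latPts_finite (V : Finset (ℤ × ℤ)) : (latPts V).Finite :=
  finite_of_bounded (polyHull_compact V).isBounded

lemma intPts_sub (V : Finset (ℤ × ℤ)) : intPts V ⊆ latPts V := fun p h =>
  (interior_subset (s := polyHull V) h : toR p ∈ polyHull V)

lemma intPts_finite (V : Finset (ℤ × ℤ)) : (intPts V).Finite :=
  (latPts_finite V).subset (intPts_sub V)

lemma bdPts_sub (V : Finset (ℤ × ℤ)) : bdPts V ⊆ latPts V := fun p h => by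
  have : toR p ∈ closure (polyHull V) := h.1
  rwa [(polyHull_compact V).isClosed.closure_eq] at this

lemma mem_bdPts {V : Finset (ℤ × ℤ)} {p : ℤ × ℤ} :
    p ∈ bdPts V ↔ toR p ∈ polyHull V ∧ p ∉ intPts V :=
  ⟨fun h => ⟨bdPts_sub V h, fun h' => h.2 h'⟩, fun h => ⟨subset_closure h.1, h.2⟩⟩

lemma latHull (V : Finset (ℤ × ℤ)) : convexHull ℝ (toR '' latPts V) = polyHull V := by
  apply Set.Subset.antisymm
  · apply convexHull_min _ (polyHull_convex V)
    rintro _ ⟨p, hp, rfl⟩; exact hp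
  · apply convexHull_mono
    apply Set.image_mono
    intro p hp
    exact subset_convexHull ℝ _ (Set.mem_image_of_mem toR hp)

lemma intPoly_sub (V : Finset (ℤ × ℤ)) : intPoly V ⊆ interior (polyHull V) := by
  apply convexHull_min _ (polyHull_convex V).interior
  rintro _ ⟨p, hp, rfl⟩; exact hp

lemma mem_intPoly {V : Finset (ℤ × ℤ)} {p : ℤ × ℤ} : toR p ∈ intPoly V ↔ p ∈ intPts V :=
  ⟨fun h => intPoly_sub V h, fun h => subset_convexHull ℝ _ (Set.mem_image_of_mem toR h)⟩

lemma intPoly_interior {V : Finset (ℤ × ℤ)} (h : Nonhyperelliptic V) :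
    (interior (intPoly V)).Nonempty := by
  obtain ⟨p, q, r, hp, hq, hr, hai⟩ := h
  rw [intPoly, interior_convexHull_nonempty_iff_affineSpan_eq_top, eq_top_iff]
  have h1 : affineSpan ℝ (Set.range ![toR p, toR q, toR r]) = ⊤ := by
    rw [hai.affineSpan_eq_top_iff_card_eq_finrank_add_one]
    simp
  rw [← h1]
  apply affineSpan_mono
  rintro _ ⟨i, rfl⟩
  fin_cases i
  · exact ⟨p, hp, rfl⟩
  · exact ⟨q, hq, rfl⟩
  · exact ⟨r, hr, rfl⟩

lemma dZ_right (u d z : ℤ × ℤ) (N : ℤ) : dZ u (N • d + z) = N * dZ u d + dZ u z := by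
  simp [dZ]; ring

lemma dZ_left (u d z : ℤ × ℤ) (N : ℤ) : dZ (N • d + z) u = N * dZ d u + dZ z u := by
  simp [dZ]; ring

lemma dZ_add_right (u d z : ℤ × ℤ) : dZ u (d + z) = dZ u d + dZ u z := by
  simp [dZ]; ring

lemma dZ_add_left (u d z : ℤ × ℤ) : dZ (d + z) u = dZ d u + dZ z u := by
  simp [dZ]; ring

lemma dZ_self (u : ℤ × ℤ) : dZ u u = 0 := by simp [dZ]; ring

lemma dZ_swap (u v : ℤ × ℤ) : dZ u v = - dZ v u := by simp only [dZ]; ring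

lemma dZ_smul_right (u d : ℤ × ℤ) (N : ℤ) : dZ u (N • d) = N * dZ u d := by
  simp [dZ]; ring

lemma dZ_smul_left (u d : ℤ × ℤ) (N : ℤ) : dZ (N • d) u = N * dZ d u := by
  simp [dZ]; ring

lemma plucker (a b c d : ℤ × ℤ) :
    dZ a b * dZ c d - dZ a c * dZ b d + dZ a d * dZ b c = 0 := by
  simp [dZ]; ring

section
variable {V : Finset (ℤ × ℤ)} {T : UT V}

lemma left_unique {p q w w' : ℤ × ℤ} (h : Tri T p q w) (h' : Tri T p q w') : w = w' := by
  have e := h.1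
  have e' := h'.1
  set N : ℤ := |dZ (w' - p) (w - p)| + 1
  have a1 := le_abs_self (dZ (w' - p) (w - p))
  have a2 := neg_abs_le (dZ (w' - p) (w - p))
  have a3 := dZ_swap (w - p) (w' - p)
  refine (sector_unique (v := N • (q - p) + ((w - p) + (w' - p))) h h' ?_ ?_ ?_ ?_).2 <;>
    simp only [dZ_smul_right, dZ_smul_left, mul_zero, mul_one, zero_add, add_zero,
      dZ_add_right, dZ_add_left, dZ_self, e, e'] <;> omega

lemma left_exists {p q : ℤ × ℤ} (hp : p ∈ intPts V)
    (he : ({p, q} : Finset (ℤ × ℤ)) ∈ edgeSet T) : ∃ w, Tri T p q w := by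
  obtain ⟨z, hz⟩ := tri_of_edge he
  rcases hz with hz | hz
  · exact ⟨z, hz⟩
  set d := q - p with hd
  have hzd : dZ (z - p) d = 1 := hz.1
  obtain ⟨b, c, hT, h1, h2⟩ := exists_tri (T := T) (a := p) (d := d) (n := -(z - p)) (by
    have hj : Filter.Tendsto (fun j : ℕ => (j : ℝ)⁻¹) Filter.atTop (nhds 0) :=
      tendsto_inv_atTop_nhds_zero_nat
    have hl := ((hj.smul_const (toR d)).const_add (toR p)).add
      ((hj.mul hj).smul_const (toR (-(z - p))))
    simp only [zero_smul, add_zero, mul_zero] at hl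
    exact hl.eventually (mem_interior_iff_mem_nhds.1 hp))
  have hbc := hT.1
  have n1 : ∀ u, dZ u (-(z - p)) = dZ (z - p) u := by intro u; simp [dZ]; ring
  have n2 : ∀ u, dZ (-(z - p)) u = dZ u (z - p) := by intro u; simp [dZ]; ring
  rw [n1] at h1
  rw [n2] at h2
  rcases h1 with h1 | ⟨h1, h1'⟩
  · exfalso
    rcases h2 with h2 | ⟨h2, h2'⟩
    · set N : ℤ := |dZ (b - p) (z - p)| + |dZ (z - p) (c - p)| + 1
      have a1 := neg_abs_le (dZ (b - p) (z - p))
      have a2 := neg_abs_le (dZ (z - p) (c - p))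
      have a3 := abs_nonneg (dZ (b - p) (z - p))
      have a4 := abs_nonneg (dZ (z - p) (c - p))
      have := sector_unique (v := N • d + (z - p)) hT hz
        (by rw [dZ_right]; nlinarith) (by rw [dZ_left]; nlinarith)
        (by rw [dZ_right, hzd, dZ_self]; omega)
        (by rw [← hd, dZ_left, hzd, dZ_self]; omega)
      rw [this.2, ← hd, dZ_self] at h2
      exact lt_irrefl _ h2
    · have := plucker (b - p) d (c - p) (z - p)
      rw [h2, hbc, dZ_swap d (z - p), hzd] at this
      nlinarith
  · have := plucker (b - p) d (c - p) (z - p)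
    rw [h1, hbc, dZ_swap d (z - p), hzd, dZ_swap (b - p) (z - p)] at this
    have h3 : 0 ≤ dZ d (c - p) := by rcases h2 with h2 | h2 <;> omega
    have h4 : dZ (z - p) (b - p) * dZ d (c - p) = 1 := by linarith
    have h5 : dZ d (c - p) = 1 := Int.eq_one_of_mul_eq_one_left h3 h4
    refine ⟨c, ?_⟩
    have hbq : b = q := by
      simp only [dZ, hd, Prod.fst_sub, Prod.snd_sub] at h1 h5 hbc
      ext
      · linear_combination (b.1 - p.1) * (-h5) + (q.1 - p.1) * hbc + (c.1 - p.1) * 0 - (c.1 - p.1) * h1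
      · linear_combination (b.2 - p.2) * (-h5) + (q.2 - p.2) * hbc - (c.2 - p.2) * h1
    rwa [← hbq]

/-- The radial edges as ordered pairs. -/
def radPairs (T : UT V) : Set ((ℤ × ℤ) × (ℤ × ℤ)) :=
  {x | ({x.1, x.2} : Finset (ℤ × ℤ)) ∈ edgeSet T ∧ x.1 ∈ intPts V ∧ x.2 ∈ bdPts V ∧
    ∀ y ∈ segOf {x.1, x.2} ∩ intPoly V, y = toR x.1}

/-- Radial pairs followed by a boundary edge. -/
def radA (T : UT V) : Set ((ℤ × ℤ) × (ℤ × ℤ)) :=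
  {x | x ∈ radPairs T ∧ ∃ w, Tri T x.1 x.2 w ∧ segOf {x.2, w} ⊆ frontier (polyHull V)}

/-- Radial pairs followed by an interior edge. -/
def radB (T : UT V) : Set ((ℤ × ℤ) × (ℤ × ℤ)) :=
  {x | x ∈ radPairs T ∧ ∃ w, Tri T x.1 x.2 w ∧ ¬ segOf {x.2, w} ⊆ frontier (polyHull V)}

lemma rad_union : radPairs T = radA T ∪ radB T := by
  ext x
  constructor
  · intro hx
    obtain ⟨w, hw⟩ := left_exists hx.2.1 hx.1
    by_cases h : segOf {x.2, w} ⊆ frontier (polyHull V)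
    · exact Or.inl ⟨hx, w, hw, h⟩
    · exact Or.inr ⟨hx, w, hw, h⟩
  · rintro (h | h) <;> exact h.1

lemma rad_disj : Disjoint (radA T) (radB T) := by
  rw [Set.disjoint_left]
  rintro x ⟨-, w, hw, h⟩ ⟨-, w', hw', h'⟩
  rw [left_unique hw hw'] at h
  exact h' h

lemma radPairs_finite : (radPairs T).Finite := by
  apply ((intPts_finite V).prod ((latPts_finite V).subset (bdPts_sub V))).subset
  rintro x ⟨-, h1, h2, -⟩
  exact ⟨h1, h2⟩

lemma radA_inj (hne : (interior (polyHull V)).Nonempty) : Set.InjOn Prod.snd (radA T) := by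
  rintro ⟨p, q⟩ ⟨-, w, hw, hf⟩ ⟨p', q'⟩ ⟨-, w', hw', hf'⟩ (heq : q = q')
  subst heq
  simp only at hw hw' hf hf'
  have t := hw.rot
  have t' := hw'.rot
  have s := frontier_support (polyHull_convex V) hne t.mem t.rot.mem hw.mem t.dR hf
  have s' := frontier_support (polyHull_convex V) hne t'.mem t'.rot.mem hw'.mem t'.dR hf'
  have k1 := s _ t'.rot.mem
  have k2 := s' _ t.rot.mem
  have k3 := s _ hw'.mem
  have k4 := s' _ hw.mem
  rw [dR_toR] at k1 k2 k3 k4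
  have k1 : 0 ≤ dZ (w - q) (w' - q) := by exact_mod_cast k1
  have k2 : 0 ≤ dZ (w' - q) (w - q) := by exact_mod_cast k2
  have k3 : 0 ≤ dZ (w - q) (p' - q) := by exact_mod_cast k3
  have k4 : 0 ≤ dZ (w' - q) (p - q) := by exact_mod_cast k4
  have k5 : dZ (w - q) (w' - q) = 0 := by
    have := dZ_swap (w - q) (w' - q); omega
  have k6 : dZ (w' - q) (w - q) = 0 := by
    have := dZ_swap (w - q) (w' - q); omega
  have e := t.1
  have e' := t'.1
  have k7 : 0 < dZ (w - q) (p' - q) := by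
    have := plucker (w - q) (p - q) (w' - q) (p' - q)
    rw [e, e', k5, dZ_swap (p - q) (w' - q)] at this
    rcases k3.lt_or_eq with h | h
    · exact h
    · rw [← h] at this; simp at this
  set N : ℤ := |dZ (p' - q) (p - q)| + 1
  have a1 := le_abs_self (dZ (p' - q) (p - q))
  have a2 := neg_abs_le (dZ (p' - q) (p - q))
  have a3 := dZ_swap (p - q) (p' - q)
  have a4 := abs_nonneg (dZ (p' - q) (p - q))
  have := (sector_unique (v := N • (w - q) + ((p - q) + (p' - q))) t t' ?_ ?_ ?_ ?_).2
  · rw [this]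
  all_goals simp only [dZ_smul_right, dZ_smul_left, mul_zero, mul_one, zero_add, add_zero,
      dZ_add_right, dZ_add_left, dZ_self, e, e', k6]
  · omega
  · omega
  · omega
  · nlinarith

lemma radA_surj (hne : (interior (polyHull V)).Nonempty) (hI : (intPts V).Nonempty)
    (hmeet : ∀ e ∈ intEdges T, (segOf e ∩ intPoly V).Nonempty) {q : ℤ × ℤ} (hq : q ∈ bdPts V) :
    ∃ p, (p, q) ∈ radA T := by
  have hqV := (mem_bdPts.1 hq).1
  obtain ⟨q', hq', hs, z, hz, hzpos⟩ := wrap (latPts_finite V) (by rwa [latHull]) (p := q)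
    (by rw [latHull]; exact hq.2)
  rw [latHull] at hs
  obtain ⟨b, c, hT, h1, -⟩ := exists_tri (T := T) (a := q) (d := q' - q) (n := z - q) (by
    filter_upwards [Filter.eventually_ge_atTop 2] with j hj
    have hj' : (2 : ℝ) ≤ j := by exact_mod_cast hj
    have e : ∀ a : ℤ × ℤ, toR (a - q) = toR a - toR q := by intro a; simp [toR]
    rw [e, e]
    have hi : (j : ℝ)⁻¹ ≤ 1 / 2 := by
      rw [one_div]; exact inv_anti₀ (by norm_num) hj'
    have hi0 : 0 ≤ (j : ℝ)⁻¹ := by positivity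
    exact convex_tri_mem (polyHull_convex V) hqV hq' hz hi0 (by positivity) (by nlinarith))
  have hb0 : 0 ≤ dZ (q' - q) (b - q) := by
    have := hs _ hT.rot.mem
    rw [dR_toR] at this; exact_mod_cast this
  rw [dZ_swap (b - q) (q' - q)] at h1
  obtain ⟨h1, h2⟩ : dZ (q' - q) (b - q) = 0 ∧ 0 ≤ dZ (b - q) (z - q) := by
    rcases h1 with h | h
    · omega
    · exact ⟨by omega, h.2⟩
  have hbq : b ≠ q := by rintro rfl; have := hT.1; simp [dZ] at this
  have hbq' : toR b ≠ toR q := fun h => hbq (toR_inj h)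
  have hsb : ∀ y ∈ polyHull V, 0 ≤ dR (toR b - toR q) (y - toR q) := by
    intro y hy
    have k1 := hs y hy
    have k2 : (0 : ℝ) < dR (toR q' - toR q) (toR z - toR q) := by
      rw [dR_toR]; exact_mod_cast hzpos
    have k3 : (0 : ℝ) ≤ dR (toR b - toR q) (toR z - toR q) := by
      rw [dR_toR]; exact_mod_cast h2
    have k4 : dR (toR q' - toR q) (toR b - toR q) = 0 := by
      rw [dR_toR]; exact_mod_cast h1
    have k5 : dR (toR b - toR q) (y - toR q) * dR (toR q' - toR q) (toR z - toR q) =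
        dR (toR b - toR q) (toR z - toR q) * dR (toR q' - toR q) (y - toR q) := by
      simp only [dR] at k4 ⊢
      linear_combination ((toR z - toR q).1 * (y - toR q).2 - (toR z - toR q).2 * (y - toR q).1) * k4
    have k6 := mul_nonneg k3 k1
    rw [← k5] at k6
    exact nonneg_of_mul_nonneg_left k6 k2
  have hfr : segOf {q, b} ⊆ frontier (polyHull V) := by
    intro x hx
    have hxV : x ∈ polyHull V := by
      rw [segOf_pair] at hx
      exact (polyHull_convex V).segment_subset hqV hT.rot.mem hx
    refine ⟨subset_closure hxV, fun hi => ?_⟩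
    have := dR_pos_of_interior hbq' hsb hi
    obtain ⟨t, -, -, rfl⟩ := mem_segOf.1 hx
    simp [dR] at this
    linarith
  -- interior points have height at least one
  have hheight : ∀ y ∈ intPoly V, 1 ≤ dR (toR b - toR q) (y - toR q) := by
    have : intPoly V ⊆ {y | 0 ≤ dR (toR b - toR q) (y - toR c)} := by
      have hcv : Convex ℝ {y : ℝ × ℝ | 0 ≤ dR (toR b - toR q) (y - toR c)} := by
        have := dR_nonneg_convex (toR c) (toR b - toR q + toR c)
        simpa using this
      apply convexHull_min _ hcv
      rintro _ ⟨s, hs, rfl⟩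
      have h3 := dR_pos_of_interior hbq' hsb hs
      rw [dR_toR] at h3
      have h3 : 0 < dZ (b - q) (s - q) := by exact_mod_cast h3
      have h4 := hT.1
      simp only [Set.mem_ofPred_eq]
      rw [dR_toR]
      have : 0 ≤ dZ (b - q) (s - c) := by
        simp only [dZ, Prod.fst_sub, Prod.snd_sub] at h3 h4 ⊢; linarith
      exact_mod_cast this
    intro y hy
    have h5 := this hy
    have h6 := hT.dR
    simp only [Set.mem_ofPred_eq] at h5
    simp only [dR, Prod.fst_sub, Prod.snd_sub] at h5 h6 ⊢
    linarith
  have hcd := hT.dR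
  have hmeet1 : ∀ y ∈ segOf {c, q} ∩ intPoly V, y = toR c := by
    rintro y ⟨hy, hyI⟩
    obtain ⟨t, h0, h1, rfl⟩ := mem_segOf.1 hy
    have h2 := hheight _ hyI
    have e : dR (toR b - toR q) (toR c + t • (toR q - toR c) - toR q) = 1 - t := by
      simp [dR] at hcd ⊢; linear_combination (1 - t) * hcd
    have : t = 0 := by linarith
    simp [this]
  have hmeet2 : ∀ y ∈ segOf {b, c} ∩ intPoly V, y = toR c := by
    rintro y ⟨hy, hyI⟩
    obtain ⟨t, h0, h1, rfl⟩ := mem_segOf.1 hy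
    have h2 := hheight _ hyI
    have e : dR (toR b - toR q) (toR b + t • (toR c - toR b) - toR q) = t := by
      simp [dR] at hcd ⊢; linear_combination t * hcd
    have : t = 1 := by linarith
    simp [this]
  have hcI : c ∈ intPts V := by
    by_contra hc
    have f1 : segOf {c, q} ⊆ frontier (polyHull V) := by
      by_contra hf
      obtain ⟨y, hy⟩ := hmeet {c, q} ⟨hT.rot.rot.edge, hf⟩
      have := hmeet1 y hy
      rw [this] at hy
      exact hc (mem_intPoly.1 hy.2)
    have f2 : segOf {b, c} ⊆ frontier (polyHull V) := by
      by_contra hf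
      obtain ⟨y, hy⟩ := hmeet {b, c} ⟨hT.rot.edge, hf⟩
      have := hmeet2 y hy
      rw [this] at hy
      exact hc (mem_intPoly.1 hy.2)
    have s1 := frontier_support (polyHull_convex V) hne hT.rot.rot.mem hT.mem hT.rot.mem
      hT.rot.rot.dR f1
    have s2 := frontier_support (polyHull_convex V) hne hT.rot.mem hT.rot.rot.mem hT.mem
      hT.rot.dR f2
    obtain ⟨s, hs⟩ := hI
    have hqc : toR q ≠ toR c := fun h => by
      have := toR_inj h; subst this; have := hT.1; simp [dZ] at this
    have hcb : toR c ≠ toR b := fun h => by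
      have := toR_inj h; subst this; have := hT.rot.1; simp [dZ] at this
    have g1 := dR_pos_of_interior hqc s1 hs
    have g2 := dR_pos_of_interior hcb s2 hs
    have g3 := dR_pos_of_interior hbq' hsb hs
    rw [dR_toR] at g1 g2 g3
    have g1 : 0 < dZ (q - c) (s - c) := by exact_mod_cast g1
    have g2 : 0 < dZ (c - b) (s - b) := by exact_mod_cast g2
    have g3 : 0 < dZ (b - q) (s - q) := by exact_mod_cast g3
    have g4 := hT.1
    have : dZ (q - c) (s - c) + dZ (c - b) (s - b) + dZ (b - q) (s - q) = 1 := by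
      rw [← g4]; simp only [dZ, Prod.fst_sub, Prod.snd_sub]; ring
    omega
  exact ⟨c, ⟨hT.rot.rot.edge, hcI, hq, hmeet1⟩, b, hT.rot.rot, hfr⟩

lemma radB_sector (hmeet : ∀ e ∈ intEdges T, (segOf e ∩ intPoly V).Nonempty)
    {p q w p' z : ℤ × ℤ} (hx : (p, q) ∈ radPairs T) (hw : Tri T p q w)
    (hf : ¬ segOf {q, w} ⊆ frontier (polyHull V)) (hp' : p' ∈ intPts V)
    (hs : ∀ y ∈ intPoly V, 0 ≤ dR (toR p' - toR p) (y - toR p)) (hz : z ∈ intPts V)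
    (hzpos : 0 < dZ (p' - p) (z - p)) :
    0 < dZ (q - p) (p' - p) ∧ 0 ≤ dZ (p' - p) (w - p) := by
  obtain ⟨-, hpI, hqB, hsing⟩ := hx
  simp only at hpI hqB hsing
  obtain ⟨x, hxs, hxI⟩ := hmeet {q, w} ⟨hw.rot.edge, hf⟩
  obtain ⟨t, ht0, ht1, hxe⟩ := mem_segOf.1 hxs
  have htne : t ≠ 0 := by
    rintro rfl
    simp at hxe
    rw [hxe] at hxI
    exact (mem_bdPts.1 hqB).2 (mem_intPoly.1 hxI)
  have htpos : 0 < t := lt_of_le_of_ne ht0 (Ne.symm htne)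
  have hqw := hw.dR
  have hqx : dR (toR q - toR p) (x - toR p) = t := by
    rw [hxe]; simp [dR] at hqw ⊢; linear_combination t * hqw
  have hdx := hs x hxI
  have hK : Convex ℝ (intPoly V) := convex_convexHull _ _
  have hqp : toR q ≠ toR p := fun h => by
    have := toR_inj h; subst this; exact (mem_bdPts.1 hqB).2 hpI
  -- no cone of points of the interior polygon contains the direction of `q`
  have nocone : ∀ U ∈ intPoly V, ∀ W ∈ intPoly V, 0 < dR (U - toR p) (W - toR p) →
      0 ≤ dR (U - toR p) (toR q - toR p) → 0 ≤ dR (toR q - toR p) (W - toR p) → False := by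
    intro U hU W hW h1 h2 h3
    obtain ⟨ε, hε, hε1, hmem⟩ := cone_mem hK (mem_intPoly.2 hpI) hU hW h1 h2 h3
    have := hsing _ ⟨mem_segOf.2 ⟨ε, hε.le, hε1, rfl⟩, hmem⟩
    simp [hε.ne', sub_eq_zero, hqp] at this
  have hsw : ∀ u v : ℝ × ℝ, dR u v = - dR v u := by intro u v; simp only [dR]; ring
  have hzpos' : 0 < dR (toR p' - toR p) (toR z - toR p) := by
    rw [dR_toR]; exact_mod_cast hzpos
  have hpos : 0 < dR (toR q - toR p) (toR p' - toR p) := by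
    by_contra hcon
    push Not at hcon
    have hdq : 0 ≤ dR (toR p' - toR p) (toR q - toR p) := by rw [hsw]; linarith
    rcases hdx.lt_or_eq with h | h
    · exact nocone _ (mem_intPoly.2 hp') _ hxI h hdq (by linarith)
    · rcases lt_or_ge 0 (dR (toR q - toR p) (toR z - toR p)) with h' | h'
      · exact nocone _ (mem_intPoly.2 hp') _ (mem_intPoly.2 hz) hzpos' hdq h'.le
      · refine nocone _ (mem_intPoly.2 hz) _ hxI ?_ (by rw [hsw]; linarith) (by linarith)
        have pl : dR (toR p' - toR p) (toR q - toR p) * dR (toR z - toR p) (x - toR p) =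
            dR (toR p' - toR p) (toR z - toR p) * t := by
          rw [← hqx]
          simp only [dR] at h ⊢
          linear_combination (-((toR q - toR p).1 * (toR z - toR p).2 -
            (toR q - toR p).2 * (toR z - toR p).1)) * (-h)
        have : 0 < dR (toR p' - toR p) (toR q - toR p) * dR (toR z - toR p) (x - toR p) := by
          rw [pl]; positivity
        exact pos_of_mul_pos_right this hdq
  have hw0 : 0 ≤ dR (toR p' - toR p) (toR w - toR p) := by
    have e : dR (toR p' - toR p) (x - toR p) = (1 - t) * dR (toR p' - toR p) (toR q - toR p) +
        t * dR (toR p' - toR p) (toR w - toR p) := by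
      rw [hxe]; simp [dR]; ring
    rw [e, hsw _ (toR q - toR p)] at hdx
    have : 0 ≤ t * dR (toR p' - toR p) (toR w - toR p) := by nlinarith
    exact nonneg_of_mul_nonneg_right this htpos
  rw [dR_toR] at hpos hw0
  exact ⟨by exact_mod_cast hpos, by exact_mod_cast hw0⟩

lemma radB_inj (hne : (interior (intPoly V)).Nonempty)
    (hmeet : ∀ e ∈ intEdges T, (segOf e ∩ intPoly V).Nonempty) :
    Set.InjOn Prod.fst (radB T ∩ {x | toR x.1 ∉ interior (intPoly V)}) := by
  rintro ⟨p, q⟩ ⟨⟨hx, w, hw, hf⟩, hpn⟩ ⟨p', q'⟩ ⟨⟨hx', w', hw', hf'⟩, -⟩ (heq : p = p')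
  subst heq
  simp only at hw hw' hf hf'
  obtain ⟨p', hp', hs, z, hz, hzpos⟩ := wrap (intPts_finite V) hne hpn
  obtain ⟨k1, k2⟩ := radB_sector hmeet hx hw hf hp' hs hz hzpos
  obtain ⟨k1', k2'⟩ := radB_sector hmeet hx' hw' hf' hp' hs hz hzpos
  have e := hw.1
  have e' := hw'.1
  set d := p' - p
  -- the second generator is positive against any right hand direction when parallel to `d`
  have par : ∀ a b c : ℤ × ℤ, dZ a b = 1 → 0 < dZ a d → dZ d b = 0 → 0 < dZ c d → 0 < dZ c b := by
    intro a b c h1 h2 h3 h4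
    have := plucker a b c d
    rw [h1, dZ_swap b d, h3, dZ_swap b c] at this
    by_contra hcon
    push Not at hcon
    nlinarith [mul_nonneg h2.le (neg_nonneg.2 hcon)]
  set N : ℤ := |dZ (q - p) (q' - p)| + |dZ (q' - p) (w - p)| + |dZ (q - p) (w' - p)| + 1
  have b1 := neg_abs_le (dZ (q - p) (q' - p))
  have b1' := le_abs_self (dZ (q - p) (q' - p))
  have b2 := neg_abs_le (dZ (q' - p) (w - p))
  have b3 := neg_abs_le (dZ (q - p) (w' - p))
  have c1 := abs_nonneg (dZ (q - p) (q' - p))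
  have c2 := abs_nonneg (dZ (q' - p) (w - p))
  have c3 := abs_nonneg (dZ (q - p) (w' - p))
  have hN : 1 ≤ N := by omega
  have a3 := dZ_swap (q' - p) (q - p)
  have := (sector_unique (v := N • d + ((q - p) + (q' - p))) hw hw' ?_ ?_ ?_ ?_).1
  · rw [this]
  all_goals simp only [dZ_smul_right, dZ_smul_left, mul_zero, mul_one, zero_add, add_zero,
      dZ_add_right, dZ_add_left, dZ_self, e, e']
  · nlinarith
  · rcases k2.lt_or_eq with h | h
    · nlinarith
    · have := par _ _ _ e k1 h.symm k1'
      rw [← h]; omega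
  · nlinarith
  · rcases k2'.lt_or_eq with h | h
    · nlinarith
    · have := par _ _ _ e' k1' h.symm k1
      rw [← h]; omega

lemma radB_fst (hne : (interior (intPoly V)).Nonempty) {x : (ℤ × ℤ) × (ℤ × ℤ)}
    (hx : x ∈ radPairs T) : toR x.1 ∉ interior (intPoly V) := by
  intro hi
  obtain ⟨p, q⟩ := x
  obtain ⟨-, hpI, hqB, hsing⟩ := hx
  simp only at hpI hqB hsing hi
  have hqp : toR q ≠ toR p := fun h => by
    have := toR_inj h; subst this; exact (mem_bdPts.1 hqB).2 hpI
  have ht : Filter.Tendsto (fun ε : ℝ => toR p + ε • (toR q - toR p))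
      (nhdsWithin 0 (Set.Ioi 0)) (nhds (toR p)) := by
    have : Continuous (fun ε : ℝ => toR p + ε • (toR q - toR p)) := by fun_prop
    have := this.tendsto 0
    simp only [zero_smul, add_zero] at this
    exact this.mono_left nhdsWithin_le_nhds
  have hev := ht.eventually (mem_interior_iff_mem_nhds.1 hi)
  have hlt : ∀ᶠ ε : ℝ in nhdsWithin 0 (Set.Ioi 0), ε < 1 :=
    nhdsWithin_le_nhds (Iio_mem_nhds (by norm_num))
  obtain ⟨ε, ⟨hε, hε1⟩, hε0⟩ := ((hev.and hlt).and self_mem_nhdsWithin).exists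
  have hε0' : 0 < ε := hε0
  have := hsing _ ⟨mem_segOf.2 ⟨ε, hε0'.le, hε1.le, rfl⟩, hε⟩
  simp [hε0'.ne', sub_eq_zero, hqp] at this

lemma radB_surj (hne : (interior (intPoly V)).Nonempty) {p : ℤ × ℤ} (hp : p ∈ intPts V)
    (hpn : toR p ∉ interior (intPoly V)) : ∃ q, (p, q) ∈ radB T := by
  obtain ⟨p', hp', hs, z, hz, hzpos⟩ := wrap (intPts_finite V) hne hpn
  set d := p' - p with hd
  obtain ⟨q, w, hT, h1, h2⟩ := exists_tri (T := T) (a := p) (d := d) (n := -(z - p)) (by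
    have hj : Filter.Tendsto (fun j : ℕ => (j : ℝ)⁻¹) Filter.atTop (nhds 0) :=
      tendsto_inv_atTop_nhds_zero_nat
    have hl := ((hj.smul_const (toR d)).const_add (toR p)).add
      ((hj.mul hj).smul_const (toR (-(z - p))))
    simp only [zero_smul, add_zero, mul_zero] at hl
    exact hl.eventually (mem_interior_iff_mem_nhds.1 hp))
  have e := hT.1
  have n1 : ∀ u, dZ u (-(z - p)) = dZ (z - p) u := by intro u; simp [dZ]; ring
  rw [n1] at h1
  have k2 : 0 ≤ dZ d (w - p) := by rcases h2 with h | h <;> omega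
  have k1 : 0 < dZ (q - p) d := by
    rcases h1 with h | ⟨h, h'⟩
    · exact h
    · exfalso
      have := plucker (q - p) (w - p) (z - p) d
      rw [e, h, dZ_swap (w - p) d, dZ_swap (q - p) (z - p), dZ_swap (z - p) d] at this
      nlinarith [mul_nonneg h' k2]
  have k1' : 0 < dR (toR q - toR p) (toR p' - toR p) := by
    rw [dR_toR]; exact_mod_cast k1
  have hqn : ∀ y ∈ segOf {p, q} ∩ intPoly V, y = toR p := by
    rintro y ⟨hy, hyI⟩
    obtain ⟨t, ht0, ht1, rfl⟩ := mem_segOf.1 hy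
    have := hs _ hyI
    have e : dR (toR p' - toR p) (toR p + t • (toR q - toR p) - toR p) =
        - t * dR (toR q - toR p) (toR p' - toR p) := by simp [dR]; ring
    rw [e] at this
    have : t = 0 := by nlinarith
    simp [this]
  have hqI : q ∉ intPts V := by
    intro hqI
    have := hs _ (mem_intPoly.2 hqI)
    have e : dR (toR p' - toR p) (toR q - toR p) =
        - dR (toR q - toR p) (toR p' - toR p) := by simp only [dR]; ring
    rw [e] at this; linarith
  refine ⟨q, ⟨hT.edge, hp, mem_bdPts.2 ⟨hT.rot.mem, hqI⟩, hqn⟩, w, hT, ?_⟩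
  intro hfr
  -- the segment `qw` crosses `pp'`
  set k : ℝ := (dZ d (w - p) : ℝ) with hk
  set m : ℝ := (dZ (q - p) d : ℝ) with hm
  have hk0 : 0 ≤ k := by rw [hk]; exact_mod_cast k2
  have hm1 : 1 ≤ m := by rw [hm]; exact_mod_cast k1
  have hkm : 0 < k + m := by linarith
  have hx1 : toR p + (1 / (k + m)) • (toR p' - toR p) ∈ intPoly V := by
    have := convex_tri_mem (convex_convexHull ℝ (toR '' intPts V)) (mem_intPoly.2 hp)
      (mem_intPoly.2 hp') (mem_intPoly.2 hp') (s := 1 / (k + m)) (t := 0) (by positivity)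
      le_rfl (by rw [add_zero, div_le_one hkm]; linarith)
    simpa [intPoly] using this
  have hx2 : toR p + (1 / (k + m)) • (toR p' - toR p) = toR q + (m / (k + m)) • (toR w - toR q) := by
    have hqw := hT.dR
    have hk' : k = dR (toR p' - toR p) (toR w - toR p) := by rw [dR_toR]
    have hm' : m = dR (toR q - toR p) (toR p' - toR p) := by rw [dR_toR]
    have e1 : (toR p').1 - (toR p).1 = k * ((toR q).1 - (toR p).1) + m * ((toR w).1 - (toR p).1) := by
      rw [hk', hm']; simp [dR] at hqw ⊢
      linear_combination (-((toR p').1 - (toR p).1)) * hqw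
    have e2 : (toR p').2 - (toR p).2 = k * ((toR q).2 - (toR p).2) + m * ((toR w).2 - (toR p).2) := by
      rw [hk', hm']; simp [dR] at hqw ⊢
      linear_combination (-((toR p').2 - (toR p).2)) * hqw
    ext
    · simp; field_simp; linarith
    · simp; field_simp; linarith
  have hx3 : toR p + (1 / (k + m)) • (toR p' - toR p) ∈ segOf {q, w} :=
    mem_segOf.2 ⟨m / (k + m), by positivity, by rw [div_le_one hkm]; linarith, hx2⟩
  exact (hfr hx3).2 (intPoly_sub V hx1)

end

/-- If every interior edge of a unimodular triangulation of a
nonhyperelliptic lattice polygon meets the interior polygon, then the number of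
radial edges is `g + r - g⁽¹⁾`. -/
theorem numRadialEdges_eq (V : Finset (ℤ × ℤ)) (hV : IsLatticePolygon V)
    (hnh : Nonhyperelliptic V) (T : UT V)
    (g r g1 : ℕ) (hg : (intPts V).ncard = g) (hr : (bdPts V).ncard = r)
    (hg1 : {p : ℤ × ℤ | toR p ∈ interior (intPoly V)}.ncard = g1)
    (hmeet : ∀ e ∈ intEdges T, (segOf e ∩ intPoly V).Nonempty) :
    ({e | e ∈ edgeSet T ∧ Radial V e}.ncard : ℤ) = g + r - g1 := by
  have hneI := intPoly_interior hnh
  have hI : (intPts V).Nonempty := by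
    obtain ⟨p, -, -, hp, -⟩ := hnh; exact ⟨p, hp⟩
  have hneV : (interior (polyHull V)).Nonempty := by
    obtain ⟨p, hp⟩ := hI; exact ⟨_, hp⟩
  -- radial edges are radial pairs
  have hR : {e | e ∈ edgeSet T ∧ Radial V e} =
      (fun x : (ℤ × ℤ) × (ℤ × ℤ) => ({x.1, x.2} : Finset (ℤ × ℤ))) '' radPairs T := by
    ext e
    constructor
    · rintro ⟨he, p, q, rfl, hp, hq, x, hx⟩
      refine ⟨(p, q), ⟨he, hp, hq, ?_⟩, rfl⟩
      intro y hy
      have hp' : toR p ∈ segOf {p, q} ∩ intPoly V :=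
        ⟨mem_segOf.2 ⟨0, le_rfl, zero_le_one, by simp⟩, mem_intPoly.2 hp⟩
      simp only at hy
      rw [hx] at hy hp'
      rw [Set.mem_singleton_iff] at hy hp'
      rw [hy, hp']
    · rintro ⟨⟨p, q⟩, ⟨he, hp, hq, hs⟩, rfl⟩
      refine ⟨he, p, q, rfl, hp, hq, toR p, ?_⟩
      apply Set.Subset.antisymm
      · intro y hy; exact hs y hy
      · rintro _ rfl
        exact ⟨mem_segOf.2 ⟨0, le_rfl, zero_le_one, by simp⟩, mem_intPoly.2 hp⟩
  have hinj : Set.InjOn (fun x : (ℤ × ℤ) × (ℤ × ℤ) => ({x.1, x.2} : Finset (ℤ × ℤ)))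
      (radPairs T) := by
    rintro ⟨p, q⟩ ⟨-, hp, hq, -⟩ ⟨p', q'⟩ ⟨-, hp', hq', -⟩ h
    rcases pair_cases h with ⟨h1, h2⟩ | ⟨h1, h2⟩
    · exact Prod.ext h1 h2
    · exfalso
      simp only at h1 hp hq'
      rw [h1] at hp
      exact (mem_bdPts.1 hq').2 hp
  have hcard : (radPairs T).ncard = (radA T).ncard + (radB T).ncard := by
    have hfin := radPairs_finite (T := T)
    rw [rad_union] at hfin ⊢
    exact Set.ncard_union_eq rad_disj (hfin.subset Set.subset_union_left)
      (hfin.subset Set.subset_union_right)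
  have hA : (radA T).ncard = r := by
    rw [← hr, ← (radA_inj hneV).ncard_image]
    congr 1
    ext q
    constructor
    · rintro ⟨x, hx, rfl⟩; exact hx.1.2.2.1
    · intro hq
      obtain ⟨p, hp⟩ := radA_surj hneV hI hmeet hq
      exact ⟨_, hp, rfl⟩
  have hB : (radB T).ncard = (intPts V \ {p | toR p ∈ interior (intPoly V)}).ncard := by
    have hBe : radB T ∩ {x | toR x.1 ∉ interior (intPoly V)} = radB T :=
      Set.inter_eq_left.2 fun x hx => radB_fst hneI hx.1
    have hi := radB_inj (T := T) hneI hmeet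
    rw [hBe] at hi
    rw [← hi.ncard_image]
    congr 1
    ext p
    constructor
    · rintro ⟨x, hx, rfl⟩; exact ⟨hx.1.2.1, radB_fst hneI hx.1⟩
    · rintro ⟨hp, hpn⟩
      obtain ⟨q, hq⟩ := radB_surj (T := T) hneI hp hpn
      exact ⟨_, hq, rfl⟩
  have hsub : {p : ℤ × ℤ | toR p ∈ interior (intPoly V)} ⊆ intPts V := fun p hp =>
    mem_intPoly.1 (interior_subset hp)
  have hgg := Set.ncard_sdiff_add_ncard_of_subset hsub (intPts_finite V)
  rw [hR, hinj.ncard_image, hcard, hA, hB]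
  rw [hg1, hg] at hgg
  push_cast
  omega
end
end

section
/- Let Δ be a lattice polygon, 𝒯 a regular unimodular triangulation of Δ with genus g ≥ 2, A = Δ ∩ ℤ², and E the set of interior edges of 𝒯. Let λ : ℝ^A → ℝ^E be the linear map sending a height function in the secondary cone Σ(𝒯) to the bounded edge lengths of the dual tropical curve. Then the kernel of λ is 3-dimensional, spanned by the all-ones vector and the two vectors recording the x- and y-coordinates of the lattice points; consequently rank(λ) = |A| - 3 = |E| - 2g. -/
open Set Finset

noncomputable section

/-- The triangle with vertices `a`, `b`, `c` is a cell of the triangulation. -/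
def memTri {V : Finset (ℤ × ℤ)} (T : UT V) (a b c : ℤ × ℤ) : Prop :=
  ∃ t ∈ T.tris, ({t.1, t.2.1, t.2.2} : Finset (ℤ × ℤ)) = {a, b, c}

/-- The `4 × 4` determinant of equation (1): rows of ones, `x`-coordinates,
`y`-coordinates, and heights. -/
def heightDet (P1 P2 P3 P4 : ℤ × ℤ) (w1 w2 w3 w4 : ℝ) : ℝ :=
  Matrix.det !![(1 : ℝ), 1, 1, 1;
                (P1.1 : ℝ), (P2.1 : ℝ), (P3.1 : ℝ), (P4.1 : ℝ);
                (P1.2 : ℝ), (P2.2 : ℝ), (P3.2 : ℝ), (P4.2 : ℝ);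
                w1, w2, w3, w4]

open Filter Topology

namespace KR

abbrev Tri := (ℤ × ℤ) × (ℤ × ℤ) × (ℤ × ℤ)

/-- vertices of a triangle -/
def vt (t : Tri) : Fin 3 → ℤ × ℤ := ![t.1, t.2.1, t.2.2]

/-- signed doubled area -/
def sg (t : Tri) : ℤ :=
  (t.2.1.1 - t.1.1) * (t.2.2.2 - t.1.2) - (t.2.1.2 - t.1.2) * (t.2.2.1 - t.1.1)

def al (t : Tri) (i : Fin 3) : ℤ :=
  sg t * ((vt t (i+1)).1 * (vt t (i+2)).2 - (vt t (i+1)).2 * (vt t (i+2)).1)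
def be (t : Tri) (i : Fin 3) : ℤ := sg t * ((vt t (i+1)).2 - (vt t (i+2)).2)
def ga (t : Tri) (i : Fin 3) : ℤ := sg t * ((vt t (i+2)).1 - (vt t (i+1)).1)

/-- barycentric coordinates -/
def B (t : Tri) (i : Fin 3) (x : ℝ × ℝ) : ℝ := al t i + be t i * x.1 + ga t i * x.2
/-- their linear parts -/
def Bl (t : Tri) (i : Fin 3) (d : ℝ × ℝ) : ℝ := be t i * d.1 + ga t i * d.2
/-- integral version -/
def Bz (t : Tri) (i : Fin 3) (u : ℤ × ℤ) : ℤ := al t i + be t i * u.1 + ga t i * u.2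

/-- the triangle as a point set -/
def hull (t : Tri) : Set (ℝ × ℝ) := convexHull ℝ {toR t.1, toR t.2.1, toR t.2.2}

lemma B_toR (t : Tri) (i : Fin 3) (u : ℤ × ℤ) : B t i (toR u) = (Bz t i u : ℝ) := by
  simp [B, Bz, toR]

lemma B_add (t : Tri) (i : Fin 3) (x d : ℝ × ℝ) (ε : ℝ) :
    B t i (x + ε • d) = B t i x + ε * Bl t i d := by
  simp [B, Bl]; ring

lemma Bl_sub (t : Tri) (i : Fin 3) (x y : ℝ × ℝ) : Bl t i (y - x) = B t i y - B t i x := by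
  simp [B, Bl]; ring

lemma Bl_smul (t : Tri) (i : Fin 3) (x : ℝ × ℝ) (c : ℝ) : Bl t i (c • x) = c * Bl t i x := by
  simp [Bl]; ring

lemma B_comb (t : Tri) (i : Fin 3) (x y : ℝ × ℝ) (a b : ℝ) (h : a + b = 1) :
    B t i (a • x + b • y) = a * B t i x + b * B t i y := by
  have : a = 1 - b := by linarith
  subst this
  simp [B]; ring

lemma B0 (t : Tri) (x : ℝ × ℝ) : B t 0 x = sg t * ((t.2.1.1 * t.2.2.2 - t.2.1.2 * t.2.2.1)
    + (t.2.1.2 - t.2.2.2) * x.1 + (t.2.2.1 - t.2.1.1) * x.2) := by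
  have e1 : vt t (0+1) = t.2.1 := rfl
  have e2 : vt t (0+2) = t.2.2 := rfl
  simp only [B, al, be, ga, e1, e2]; push_cast; ring
lemma B1 (t : Tri) (x : ℝ × ℝ) : B t 1 x = sg t * ((t.2.2.1 * t.1.2 - t.2.2.2 * t.1.1)
    + (t.2.2.2 - t.1.2) * x.1 + (t.1.1 - t.2.2.1) * x.2) := by
  have e1 : vt t (1+1) = t.2.2 := rfl
  have e2 : vt t (1+2) = t.1 := rfl
  simp only [B, al, be, ga, e1, e2]; push_cast; ring
lemma B2 (t : Tri) (x : ℝ × ℝ) : B t 2 x = sg t * ((t.1.1 * t.2.1.2 - t.1.2 * t.2.1.1)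
    + (t.1.2 - t.2.1.2) * x.1 + (t.2.1.1 - t.1.1) * x.2) := by
  have e1 : vt t (2+1) = t.1 := rfl
  have e2 : vt t (2+2) = t.2.1 := rfl
  simp only [B, al, be, ga, e1, e2]; push_cast; ring

lemma sgsq {t : Tri} (h : |sg t| = 1) : (sg t : ℝ) * ((t.2.1.1 - t.1.1) * (t.2.2.2 - t.1.2)
     - (t.2.1.2 - t.1.2) * (t.2.2.1 - t.1.1)) = 1 := by
  have : sg t * sg t = 1 := by rw [← abs_mul_abs_self, h]; rfl
  nth_rewrite 2 [sg] at this
  exact_mod_cast this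

/-- interpolation of affine functions -/
lemma interp (t : Tri) (h : |sg t| = 1) (x : ℝ × ℝ) (a b c : ℝ) :
    a + b * x.1 + c * x.2 = ∑ i, B t i x * (a + b * (vt t i).1 + c * (vt t i).2) := by
  have h2 := sgsq h
  have e0 : vt t 0 = t.1 := rfl
  have e1 : vt t 1 = t.2.1 := rfl
  have e2 : vt t 2 = t.2.2 := rfl
  rw [Fin.sum_univ_three, B0, B1, B2, e0, e1, e2]
  linear_combination (-(a + b * x.1 + c * x.2)) * h2

lemma sum_B (t : Tri) (h : |sg t| = 1) (x : ℝ × ℝ) : B t 0 x + B t 1 x + B t 2 x = 1 := by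
  have := interp t h x 1 0 0
  rw [Fin.sum_univ_three] at this
  simpa using this.symm

lemma B_vt (t : Tri) (h : |sg t| = 1) (i j : Fin 3) :
    Bz t i (vt t j) = if i = j then 1 else 0 := by
  have h2 := sgsq h
  have e0 : vt t 0 = t.1 := rfl
  have e1 : vt t 1 = t.2.1 := rfl
  have e2 : vt t 2 = t.2.2 := rfl
  suffices hs : B t i (toR (vt t j)) = if i = j then 1 else 0 by
    rw [B_toR] at hs
    split_ifs at hs ⊢ <;> exact_mod_cast hs
  have c0 := B0 t
  have c1 := B1 t
  have c2 := B2 t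
  have f : ∀ i : Fin 3, i = 0 ∨ i = 1 ∨ i = 2 := by decide
  rcases f i with rfl | rfl | rfl <;> rcases f j with rfl | rfl | rfl <;>
    simp only [c0, c1, c2, e0, e1, e2, toR] <;> split_ifs with hh <;>
    first | exact absurd hh (by decide) | exact absurd rfl hh | linear_combination h2 | ring

lemma interp_pt (t : Tri) (h : |sg t| = 1) (x : ℝ × ℝ) :
    x = ∑ i, B t i x • toR (vt t i) := by
  have h1 := interp t h x 0 1 0
  have h2 := interp t h x 0 0 1
  rw [Fin.sum_univ_three] at *
  ext
  · simpa [toR] using h1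
  · simpa [toR] using h2

lemma interp_B (t s : Tri) (h : |sg t| = 1) (k : Fin 3) (x : ℝ × ℝ) :
    B s k x = ∑ i, B t i x * (Bz s k (vt t i) : ℝ) := by
  have := interp t h x (al s k) (be s k) (ga s k)
  rw [B, this]; simp [Bz]

lemma mem_hull (t : Tri) (h : |sg t| = 1) (x : ℝ × ℝ) : x ∈ hull t ↔ ∀ i, 0 ≤ B t i x := by
  constructor
  · intro hx i
    have hc : Convex ℝ {y | 0 ≤ B t i y} := by
      intro y hy z hz a b ha hb hab
      simp only [mem_ofPred_eq] at *
      rw [B_comb _ _ _ _ _ _ hab]; positivity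
    refine convexHull_min ?_ hc hx
    intro y hy
    have key : ∀ j, 0 ≤ B t i (toR (vt t j)) := by
      intro j; rw [B_toR, B_vt t h]; split_ifs <;> simp
    simp only [mem_insert_iff, mem_singleton_iff] at hy
    rcases hy with rfl | rfl | rfl
    · exact key 0
    · exact key 1
    · exact key 2
  · intro hx
    rw [interp_pt t h x, hull]
    refine (convex_convexHull ℝ _).sum_mem (fun i _ => hx i) ?_ ?_
    · rw [Fin.sum_univ_three]; exact sum_B t h x
    · intro i _
      apply subset_convexHull
      fin_cases i <;> simp [vt]

def str (t : Tri) : Set (ℝ × ℝ) := {x | ∀ i, 0 < B t i x}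

lemma B_cont (t : Tri) (i : Fin 3) : Continuous (B t i) := by
  unfold B; fun_prop

lemma str_open (t : Tri) : IsOpen (str t) := by
  have : str t = ⋂ i, {x | 0 < B t i x} := by ext; simp [str]
  rw [this]
  exact isOpen_iInter_of_finite fun i => isOpen_lt continuous_const (B_cont t i)

lemma hull_closed (t : Tri) (h : |sg t| = 1) : IsClosed (hull t) := by
  have : hull t = ⋂ i, {x | 0 ≤ B t i x} := by ext; simp [mem_hull t h]
  rw [this]
  exact isClosed_iInter fun i => isClosed_le continuous_const (B_cont t i)

lemma str_sub (t : Tri) (h : |sg t| = 1) : str t ⊆ interior (hull t) := by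
  apply interior_maximal _ (str_open t)
  intro x hx
  rw [mem_hull t h]
  exact fun i => (hx i).le

lemma ev_pos (t : Tri) (i : Fin 3) (x d : ℝ × ℝ)
    (h : 0 < B t i x ∨ (0 ≤ B t i x ∧ 0 < Bl t i d)) :
    ∀ᶠ ε in 𝓝[>] (0:ℝ), 0 < B t i (x + ε • d) := by
  rcases h with h | ⟨h, h'⟩
  · have : Tendsto (fun ε : ℝ => B t i (x + ε • d)) (𝓝[>] 0) (𝓝 (B t i x)) := by
      have : Continuous (fun ε : ℝ => B t i (x + ε • d)) := (B_cont t i).comp (by fun_prop)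
      have h2 := this.tendsto 0
      simp only [zero_smul, add_zero] at h2
      exact h2.mono_left nhdsWithin_le_nhds
    exact this.eventually (lt_mem_nhds h)
  · filter_upwards [self_mem_nhdsWithin] with ε hε
    rw [B_add]
    have : 0 < ε * Bl t i d := mul_pos hε h'
    linarith

lemma ev_str (t : Tri) (x d : ℝ × ℝ)
    (h : ∀ i, 0 < B t i x ∨ (0 ≤ B t i x ∧ 0 < Bl t i d)) :
    ∀ᶠ ε in 𝓝[>] (0:ℝ), x + ε • d ∈ str t := by
  simp only [str, mem_ofPred_eq, eventually_all]
  exact fun i => ev_pos t i x d (h i)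

section
variable {V : Finset (ℤ × ℤ)} (T : UT V)

lemma uni {t : Tri} (ht : t ∈ T.tris) : |sg t| = 1 := T.unimodular t ht

lemma hull_sub {t : Tri} (ht : t ∈ T.tris) : hull t ⊆ polyHull V := by
  rw [T.cover]
  exact subset_biUnion_of_mem (u := fun t : Tri => convexHull ℝ {toR t.1, toR t.2.1, toR t.2.2}) ht

lemma cov {x : ℝ × ℝ} (hx : x ∈ polyHull V) : ∃ t ∈ T.tris, x ∈ hull t := by
  rw [T.cover] at hx
  simpa [hull] using hx

lemma str_str {t s : Tri} (ht : t ∈ T.tris) (hs : s ∈ T.tris) {x : ℝ × ℝ}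
    (h1 : x ∈ str t) (h2 : x ∈ str s) : t = s := by
  by_contra hne
  have := T.disjointInt t ht s hs hne
  have h3 : x ∈ (∅ : Set (ℝ × ℝ)) := by
    rw [← this]
    exact ⟨str_sub t (uni T ht) h1, str_sub s (uni T hs) h2⟩
  exact h3

/-- a point of one triangle interior to another forces equality -/
lemma overlap {t s : Tri} (ht : t ∈ T.tris) (hs : s ∈ T.tris) {x : ℝ × ℝ}
    (h1 : x ∈ hull t) (h2 : x ∈ str s) : t = s := by
  set c : ℝ × ℝ := ∑ i, (1/3 : ℝ) • toR (vt t i) with hc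
  have hB : ∀ i, B t i c = 1/3 := by
    have h3 : ∀ j, B t j c = 1/3 * (B t j (toR (vt t 0)) + B t j (toR (vt t 1)) + B t j (toR (vt t 2))) := by
      intro j; rw [hc, Fin.sum_univ_three]; simp [B]; ring
    intro i
    rw [h3]; simp only [B_toR, B_vt t (uni T ht)]
    have f : ∀ i : Fin 3, (if i = 0 then (1:ℤ) else 0) + (if i = 1 then (1:ℤ) else 0)
        + (if i = 2 then (1:ℤ) else 0) = 1 := by decide
    have f' : (((if i = 0 then (1:ℤ) else 0 : ℤ) : ℝ) + ((if i = 1 then (1:ℤ) else 0 : ℤ) : ℝ)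
        + ((if i = 2 then (1:ℤ) else 0 : ℤ) : ℝ)) = 1 := by exact_mod_cast f i
    rw [f', mul_one]
  rw [mem_hull t (uni T ht)] at h1
  have e1 := ev_str s x (c - x) (fun i => Or.inl (h2 i))
  have e2 := ev_str t x (c - x) (fun i => by
    rcases (h1 i).lt_or_eq with h | h
    · exact Or.inl h
    · right; refine ⟨h1 i, ?_⟩
      rw [Bl_sub, ← h, hB]; norm_num)
  obtain ⟨ε, h3, h4⟩ := (e1.and e2).exists
  exact str_str T ht hs h4 h3

lemma vt_inj {t : Tri} (h : |sg t| = 1) : Function.Injective (vt t) := by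
  intro i j hij
  have h1 := B_vt t h i j
  rw [← hij, B_vt t h] at h1
  by_contra hne
  simp [hne] at h1

lemma vt_mem_hull {t : Tri} (h : |sg t| = 1) (i : Fin 3) : toR (vt t i) ∈ hull t := by
  rw [mem_hull t h]
  intro j; rw [B_toR, B_vt t h]; split_ifs <;> simp

lemma toR_inj : Function.Injective toR := by
  intro a b h
  simp only [toR, Prod.mk.injEq, Int.cast_inj] at h
  exact Prod.ext h.1 h.2

/-- lattice points of a unimodular triangle are vertices -/
lemma lat_vt {t : Tri} (h : |sg t| = 1) {u : ℤ × ℤ} (hu : toR u ∈ hull t) : ∃ i, u = vt t i := by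
  have h1 := (mem_hull t h _).1 hu
  have h2 := sum_B t h (toR u)
  have h3 := interp_pt t h (toR u)
  simp only [B_toR] at h1 h2 h3
  have h1' : ∀ i, 0 ≤ Bz t i u := fun i => by exact_mod_cast h1 i
  have h2' : Bz t 0 u + Bz t 1 u + Bz t 2 u = 1 := by exact_mod_cast h2
  have a0 := h1' 0
  have a1 := h1' 1
  have a2 := h1' 2
  rw [Fin.sum_univ_three] at h3
  have : (Bz t 0 u = 1 ∧ Bz t 1 u = 0 ∧ Bz t 2 u = 0) ∨ (Bz t 0 u = 0 ∧ Bz t 1 u = 1 ∧ Bz t 2 u = 0)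
    ∨ (Bz t 0 u = 0 ∧ Bz t 1 u = 0 ∧ Bz t 2 u = 1) := by omega
  rcases this with ⟨b0, b1, b2⟩ | ⟨b0, b1, b2⟩ | ⟨b0, b1, b2⟩ <;> simp [b0, b1, b2] at h3
  · exact ⟨0, toR_inj h3⟩
  · exact ⟨1, toR_inj h3⟩
  · exact ⟨2, toR_inj h3⟩

lemma poly_convex : Convex ℝ (polyHull V) := convex_convexHull ℝ _

lemma seg_mem {x y : ℝ × ℝ} (hx : x ∈ polyHull V) (hy : y ∈ polyHull V) {ε : ℝ} (h0 : 0 ≤ ε)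
    (h1 : ε ≤ 1) : x + ε • (y - x) ∈ polyHull V :=
  poly_convex.add_smul_sub_mem hx hy ⟨h0, h1⟩

/-- local lemma: a triangle in direction y seen from x -/
lemma local_tri {x y : ℝ × ℝ} (hx : x ∈ polyHull V) (hy : y ∈ polyHull V) :
    ∃ t ∈ T.tris, x ∈ hull t ∧ ∃ ε : ℝ, 0 < ε ∧ x + ε • (y - x) ∈ hull t := by
  have ev : ∀ᶠ ε in 𝓝[>] (0:ℝ), ∃ t ∈ T.tris, x + ε • (y - x) ∈ hull t := by
    have : Ioo (0:ℝ) 1 ∈ 𝓝[>] (0:ℝ) := Ioo_mem_nhdsGT one_pos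
    filter_upwards [this] with ε hε
    exact cov T (seg_mem hx hy hε.1.le hε.2.le)
  have fr : ∃ t ∈ T.tris, ∃ᶠ ε in 𝓝[>] (0:ℝ), x + ε • (y - x) ∈ hull t := by
    by_contra hcon
    push Not at hcon
    have h2 : ∀ᶠ ε in 𝓝[>] (0:ℝ), ∀ t ∈ T.tris, ¬ x + ε • (y - x) ∈ hull t := by
      rw [Filter.eventually_all_finset]
      intro t ht
      simpa [Filter.not_frequently] using hcon t ht
    obtain ⟨ε, ⟨t, ht, h3⟩, h4⟩ := (ev.and h2).exists
    exact h4 t ht h3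
  obtain ⟨t, ht, hf⟩ := fr
  refine ⟨t, ht, ?_, ?_⟩
  · refine (hull_closed t (uni T ht)).mem_of_frequently_of_tendsto hf ?_
    have : Continuous (fun ε : ℝ => x + ε • (y - x)) := by fun_prop
    have h2 := this.tendsto 0
    simp only [zero_smul, add_zero] at h2
    exact h2.mono_left nhdsWithin_le_nhds
  · obtain ⟨ε, h1, h2⟩ := (hf.and_eventually self_mem_nhdsWithin).exists
    exact ⟨ε, h2, h1⟩

end
end KR

namespace KR
section
variable {V : Finset (ℤ × ℤ)} (T : UT V)

lemma sum3 {M : Type*} [AddCommMonoid M] (k : Fin 3) (f : Fin 3 → M) :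
    ∑ i, f i = f k + f (k+1) + f (k+2) := by
  have h3 : ∀ i : Fin 3, i = 0 ∨ i = 1 ∨ i = 2 := by decide
  rw [Fin.sum_univ_three]
  rcases h3 k with rfl | rfl | rfl
  · rfl
  · rw [show (1:Fin 3)+1 = 2 from rfl, show (1:Fin 3)+2 = 0 from rfl]; abel
  · rw [show (2:Fin 3)+1 = 0 from rfl, show (2:Fin 3)+2 = 1 from rfl]; abel

lemma fin3 (k i : Fin 3) : i = k ∨ i = k + 1 ∨ i = k + 2 := by revert k i; decide
lemma n1 (k : Fin 3) : k + 1 ≠ k := by revert k; decide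
lemma n2 (k : Fin 3) : k + 2 ≠ k := by revert k; decide
lemma n12 (k : Fin 3) : k + 1 ≠ k + 2 := by revert k; decide

/-- edge opposite to vertex k -/
def oe (t : Tri) (k : Fin 3) : Finset (ℤ × ℤ) := {vt t (k+1), vt t (k+2)}

lemma mem_oe {t : Tri} {k : Fin 3} {u : ℤ × ℤ} :
    u ∈ oe t k ↔ u = vt t (k+1) ∨ u = vt t (k+2) := by simp [oe]

lemma vt_mem_oe {t : Tri} (h : |sg t| = 1) {k i : Fin 3} : vt t i ∈ oe t k ↔ i ≠ k := by
  rw [mem_oe, (vt_inj h).eq_iff, (vt_inj h).eq_iff]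
  revert i k; decide

lemma oe_inj {t : Tri} (h : |sg t| = 1) {k l : Fin 3} (hk : oe t k = oe t l) : k = l := by
  by_contra hne
  have : vt t k ∈ oe t l := (vt_mem_oe h).2 hne
  rw [← hk, vt_mem_oe h] at this
  exact this rfl

lemma edge_iff {e : Finset (ℤ × ℤ)} : e ∈ edgeSet T ↔ ∃ t ∈ T.tris, ∃ k, e = oe t k := by
  have e0 : ∀ t : Tri, oe t 0 = {t.2.1, t.2.2} := fun t => rfl
  have e1 : ∀ t : Tri, oe t 1 = {t.1, t.2.2} := fun t => by
    rw [Finset.pair_comm]; rfl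
  have e2 : ∀ t : Tri, oe t 2 = {t.1, t.2.1} := fun t => rfl
  simp only [edgeSet, Finset.mem_biUnion, Finset.mem_insert, Finset.mem_singleton]
  constructor
  · rintro ⟨t, ht, h | h | h⟩
    · exact ⟨t, ht, 2, by rw [e2, h]⟩
    · exact ⟨t, ht, 1, by rw [e1, h]⟩
    · exact ⟨t, ht, 0, by rw [e0, h]⟩
  · rintro ⟨t, ht, k, rfl⟩
    refine ⟨t, ht, ?_⟩
    rcases fin3 0 k with rfl | rfl | rfl
    · right; right; exact e0 t
    · right; left; exact e1 t
    · left; exact e2 t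

lemma Bz_oe {t : Tri} (h : |sg t| = 1) {k : Fin 3} {u : ℤ × ℤ} (hu : u ∈ oe t k) :
    Bz t k u = 0 := by
  rw [mem_oe] at hu
  rcases hu with rfl | rfl <;> rw [B_vt t h]
  · rw [if_neg (n1 k).symm]
  · rw [if_neg (n2 k).symm]

lemma adj_prop {t s : Tri} (ht : |sg t| = 1) (hs : |sg s| = 1) {k l : Fin 3}
    (h : oe t k = oe s l) (y : ℝ × ℝ) : B t k y = Bz t k (vt s l) * B s l y := by
  rw [interp_B s t hs k y, sum3 l, Bz_oe ht (u := vt s (l+1)) (by rw [h, mem_oe]; simp),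
    Bz_oe ht (u := vt s (l+2)) (by rw [h, mem_oe]; simp)]
  simp; ring

/-- midpoint of an edge -/
def mid (e : Finset (ℤ × ℤ)) : ℝ × ℝ := ∑ u ∈ e, (1/2 : ℝ) • toR u

lemma mid_oe {t : Tri} (h : |sg t| = 1) (k : Fin 3) :
    mid (oe t k) = (1/2 : ℝ) • toR (vt t (k+1)) + (1/2 : ℝ) • toR (vt t (k+2)) := by
  rw [mid, oe, Finset.sum_pair]
  exact fun hh => n12 k (vt_inj h hh)

lemma B_mid {t : Tri} (h : |sg t| = 1) (k i : Fin 3) :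
    B t i (mid (oe t k)) = if i = k then 0 else 1/2 := by
  rw [mid_oe h, B_comb _ _ _ _ _ _ (by norm_num), B_toR, B_toR, B_vt t h, B_vt t h]
  rcases fin3 k i with rfl | rfl | rfl
  · rw [if_neg (n1 i).symm, if_neg (n2 i).symm]; simp
  · rw [if_pos rfl, if_neg (n12 k), if_neg (n1 k)]; simp
  · rw [if_pos rfl, if_neg (n12 k).symm, if_neg (n2 k)]; simp

lemma mid_hull {t : Tri} (h : |sg t| = 1) (k : Fin 3) : mid (oe t k) ∈ hull t := by
  rw [mem_hull t h]; intro i; rw [B_mid h]; split_ifs <;> norm_num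

lemma ev_mid {t : Tri} (h : |sg t| = 1) (k : Fin 3) (d : ℝ × ℝ) (hd : 0 < Bl t k d) :
    ∀ᶠ ε in 𝓝[>] (0:ℝ), mid (oe t k) + ε • d ∈ str t := by
  refine ev_str t _ d (fun i => ?_)
  rw [B_mid h]
  split_ifs with hi
  · subst hi; exact Or.inr ⟨le_rfl, hd⟩
  · left; norm_num

lemma adj {t s : Tri} (ht : t ∈ T.tris) (hs : s ∈ T.tris) {k l : Fin 3}
    (h : oe t k = oe s l) (hne : t ≠ s) : Bz t k (vt s l) = -1 := by
  have ut := uni T ht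
  have us := uni T hs
  have h1 := adj_prop ut us h (toR (vt t k))
  rw [B_toR, B_toR, B_vt t ut, if_pos rfl] at h1
  have h2 : Bz t k (vt s l) * Bz s l (vt t k) = 1 := by exact_mod_cast h1.symm
  rcases Int.eq_one_or_neg_one_of_mul_eq_one' h2 with ⟨h3, h4⟩ | ⟨h3, h4⟩
  · exfalso
    apply hne
    have e1 := ev_mid ut k (toR (vt t k) - mid (oe t k)) (by
      rw [Bl_sub, B_toR, B_vt t ut, B_mid ut]; simp)
    have e2 := ev_mid us l (toR (vt t k) - mid (oe s l)) (by
      rw [Bl_sub, B_toR, h4, B_mid us]; simp)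
    rw [← h] at e2
    obtain ⟨ε, h5, h6⟩ := (e1.and e2).exists
    exact str_str T ht hs h5 h6
  · exact h3

lemma adj_B {t s : Tri} (ht : t ∈ T.tris) (hs : s ∈ T.tris) {k l : Fin 3}
    (h : oe t k = oe s l) (hne : t ≠ s) (y : ℝ × ℝ) : B t k y = - B s l y := by
  rw [adj_prop (uni T ht) (uni T hs) h, adj T ht hs h hne]; simp

/-- at most two triangles at each edge -/
lemma three {t s r : Tri} (ht : t ∈ T.tris) (hs : s ∈ T.tris) (hr : r ∈ T.tris) {k l m : Fin 3}
    (h1 : oe t k = oe s l) (h2 : oe t k = oe r m) : t = s ∨ t = r ∨ s = r := by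
  by_contra hcon
  push Not at hcon
  have a1 := adj_B T ht hs h1 hcon.1 (toR (vt t k))
  have a2 := adj_B T ht hr h2 hcon.2.1 (toR (vt t k))
  have a3 := adj_B T hs hr (h1.symm.trans h2) hcon.2.2 (toR (vt t k))
  rw [B_toR t, B_vt t (uni T ht), if_pos rfl] at a1 a2
  push_cast at a1 a2
  linarith

/-- two triangles at an edge: it is interior -/
lemma two_int {t s : Tri} (ht : t ∈ T.tris) (hs : s ∈ T.tris) {k l : Fin 3}
    (h : oe t k = oe s l) (hne : t ≠ s) : mid (oe t k) ∈ interior (polyHull V) := by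
  have hB := adj_B T ht hs h hne
  rw [mem_interior]
  refine ⟨{y | ∀ i, i ≠ k → 0 < B t i y} ∩ {y | ∀ i, i ≠ l → 0 < B s i y}, ?_, ?_, ?_, ?_⟩
  · rintro y ⟨h1, h2⟩
    rcases le_total 0 (B t k y) with h3 | h3
    · apply hull_sub T ht
      rw [mem_hull t (uni T ht)]
      intro i
      by_cases hi : i = k
      · rw [hi]; exact h3
      · exact (h1 i hi).le
    · apply hull_sub T hs
      rw [mem_hull s (uni T hs)]
      intro i
      by_cases hi : i = l
      · rw [hi]; have := hB y; linarith
      · exact (h2 i hi).le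
  · have : ∀ (t : Tri) (k : Fin 3), IsOpen {y | ∀ i, i ≠ k → 0 < B t i y} := by
      intro t k
      have : {y | ∀ i, i ≠ k → 0 < B t i y} = ⋂ i, ⋂ (_ : i ≠ k), {y | 0 < B t i y} := by
        ext; simp
      rw [this]
      exact isOpen_iInter_of_finite fun i => isOpen_iInter_of_finite fun _ =>
        isOpen_lt continuous_const (B_cont t i)
    exact (this t k).inter (this s l)
  · intro i hi
    rw [B_mid (uni T ht), if_neg hi]; norm_num
  · intro i hi
    rw [h, B_mid (uni T hs), if_neg hi]; norm_num

lemma ext_B {t : Tri} (h : |sg t| = 1) {x y : ℝ × ℝ} (hxy : ∀ i, B t i x = B t i y) : x = y := by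
  rw [interp_pt t h x, interp_pt t h y]
  simp [hxy]

lemma face_half {t s : Tri} (ht : t ∈ T.tris) (hs : s ∈ T.tris) (hne : t ≠ s) {z : ℝ × ℝ}
    (zs : z ∈ hull s) {k l : Fin 3}
    (hk : B t k z = 0) (hk1 : 0 < B t (k+1) z) (hk2 : 0 < B t (k+2) z)
    (hl : B s l z = 0) (hl1 : 0 < B s (l+1) z) (hl2 : 0 < B s (l+2) z) :
    Bz t k (vt s (l+1)) = 0 ∧ Bz t k (vt s (l+2)) = 0 := by
  have key : ∀ i, Bz t k (vt s i) ≤ 0 := by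
    intro i
    by_contra hcon
    push Not at hcon
    have e1 := ev_str t z (toR (vt s i) - z) (fun j => by
      rcases fin3 k j with rfl | rfl | rfl
      · right; refine ⟨hk.ge, ?_⟩
        rw [Bl_sub, hk, B_toR]; simpa using hcon
      · exact Or.inl hk1
      · exact Or.inl hk2)
    have e2 : Ioo (0:ℝ) 1 ∈ 𝓝[>] (0:ℝ) := Ioo_mem_nhdsGT one_pos
    obtain ⟨ε, h1, h2⟩ := (e1.and e2).exists
    have : z + ε • (toR (vt s i) - z) ∈ hull s :=
      (convex_convexHull ℝ _).add_smul_sub_mem zs (vt_mem_hull (uni T hs) i) ⟨h2.1.le, h2.2.le⟩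
    exact hne (overlap T hs ht this h1).symm
  have h1 := interp_B s t (uni T hs) k z
  rw [sum3 l, hk, hl] at h1
  have a1 : (Bz t k (vt s (l+1)) : ℝ) ≤ 0 := by exact_mod_cast key _
  have a2 : (Bz t k (vt s (l+2)) : ℝ) ≤ 0 := by exact_mod_cast key _
  have b1 := mul_nonpos_of_nonneg_of_nonpos hl1.le a1
  have b2 := mul_nonpos_of_nonneg_of_nonpos hl2.le a2
  have c1 : B s (l+1) z * (Bz t k (vt s (l+1)) : ℝ) = 0 := by linarith
  have c2 : B s (l+2) z * (Bz t k (vt s (l+2)) : ℝ) = 0 := by linarith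
  have d1 := (mul_eq_zero.1 c1).resolve_left hl1.ne'
  have d2 := (mul_eq_zero.1 c2).resolve_left hl2.ne'
  exact ⟨by exact_mod_cast d1, by exact_mod_cast d2⟩

lemma face_pos {t s : Tri} (ht : t ∈ T.tris) (hs : s ∈ T.tris) (hne : t ≠ s) {z : ℝ × ℝ}
    (zt : z ∈ hull t) (zs : z ∈ hull s) (hz : ∀ u, z ≠ toR u) :
    ∃ k, B t k z = 0 ∧ 0 < B t (k+1) z ∧ 0 < B t (k+2) z := by
  have ut := uni T ht
  have h1 : ∃ k, B t k z = 0 := by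
    by_contra hcon
    push Not at hcon
    refine hne (overlap T hs ht zs (fun i => ?_)).symm
    exact lt_of_le_of_ne ((mem_hull t ut z).1 zt i) (hcon i).symm
  obtain ⟨k, hk⟩ := h1
  have hsum : B t k z + B t (k+1) z + B t (k+2) z = 1 := by
    rw [← sum3 k (fun i => B t i z), Fin.sum_univ_three]; exact sum_B t ut z
  have hp := interp_pt t ut z
  rw [sum3 k, hk] at hp
  refine ⟨k, hk, lt_of_le_of_ne ((mem_hull t ut z).1 zt _) ?_,
    lt_of_le_of_ne ((mem_hull t ut z).1 zt _) ?_⟩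
  · intro h0
    have : B t (k+2) z = 1 := by linarith
    rw [← h0, this] at hp
    exact hz (vt t (k+2)) (by simpa using hp)
  · intro h0
    have : B t (k+1) z = 1 := by linarith
    rw [← h0, this] at hp
    exact hz (vt t (k+1)) (by simpa using hp)

lemma sumBz {t : Tri} (h : |sg t| = 1) (k : Fin 3) (u : ℤ × ℤ) :
    Bz t k u + Bz t (k+1) u + Bz t (k+2) u = 1 := by
  have : B t k (toR u) + B t (k+1) (toR u) + B t (k+2) (toR u) = 1 := by
    rw [← sum3 k (fun i => B t i (toR u)), Fin.sum_univ_three]; exact sum_B t h _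
  simp only [B_toR] at this
  exact_mod_cast this

lemma ext_Bz {t : Tri} (h : |sg t| = 1) (k : Fin 3) {u w : ℤ × ℤ} (h0 : Bz t k u = Bz t k w)
    (h1 : Bz t (k+1) u = Bz t (k+1) w) : u = w := by
  have a := sumBz h k u
  have b := sumBz h k w
  apply toR_inj
  apply ext_B h
  intro i
  rw [B_toR, B_toR]
  congr 1
  rcases fin3 k i with rfl | rfl | rfl
  · exact h0
  · exact h1
  · omega

/-- two different triangles meeting in a non-lattice point share an edge -/
lemma face {t s : Tri} (ht : t ∈ T.tris) (hs : s ∈ T.tris) (hne : t ≠ s) {z : ℝ × ℝ}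
    (zt : z ∈ hull t) (zs : z ∈ hull s) (hz : ∀ u, z ≠ toR u) :
    ∃ k l, oe t k = oe s l := by
  have ut := uni T ht
  have us := uni T hs
  obtain ⟨k, hk, hk1, hk2⟩ := face_pos T ht hs hne zt zs hz
  obtain ⟨l, hl, hl1, hl2⟩ := face_pos T hs ht hne.symm zs zt hz
  obtain ⟨a1, a2⟩ := face_half T ht hs hne zs hk hk1 hk2 hl hl1 hl2
  obtain ⟨b1, b2⟩ := face_half T hs ht hne.symm zt hl hl1 hl2 hk hk1 hk2
  refine ⟨k, l, ?_⟩
  have p1 := interp_B s t us (k+1) (toR (vt t (k+1)))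
  have p2 := interp_B s t us (k+1) (toR (vt t (k+2)))
  have p3 := interp_B s t us (k+1) z
  have q1 := sumBz us l (vt t (k+1))
  have q2 := sumBz us l (vt t (k+2))
  have q3 : B s l z + B s (l+1) z + B s (l+2) z = 1 := by
    rw [← sum3 l (fun i => B s i z), Fin.sum_univ_three]; exact sum_B s us z
  have q4 : B t k z + B t (k+1) z + B t (k+2) z = 1 := by
    rw [← sum3 k (fun i => B t i z), Fin.sum_univ_three]; exact sum_B t ut z
  rw [sum3 l] at p1 p2 p3
  simp only [B_toR] at p1 p2
  rw [b1, B_vt t ut, if_pos rfl] at p1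
  rw [b2, B_vt t ut, if_neg (n12 k)] at p2
  rw [hl] at p3 q3
  rw [hk] at q4
  rw [b1] at q1
  rw [b2] at q2
  set α := Bz t (k+1) (vt s (l+1)) with hα
  set β := Bz t (k+1) (vt s (l+2)) with hβ
  set α' := Bz s (l+1) (vt t (k+1))
  set β' := Bz s (l+1) (vt t (k+2))
  set γ := Bz s (l+2) (vt t (k+1))
  set δ := Bz s (l+2) (vt t (k+2))
  have p1' : 1 = α' * α + γ * β := by
    have : (1:ℝ) = α' * α + γ * β := by push_cast at p1; linarith
    exact_mod_cast this
  have p2' : 0 = β' * α + δ * β := by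
    have : (0:ℝ) = β' * α + δ * β := by push_cast at p2; linarith
    exact_mod_cast this
  have hγ : γ = 1 - α' := by omega
  have hδ : δ = 1 - β' := by omega
  have hprod : (α - β) * (α' - β') = 1 := by
    rw [hγ] at p1'; rw [hδ] at p2'; linear_combination p2' - p1'
  have u1 : B t (k+1) z < 1 := by linarith
  have v1 : B s (l+2) z = 1 - B s (l+1) z := by linarith
  have hv1 : B s (l+1) z < 1 := by linarith
  rw [v1] at p3
  rcases Int.eq_one_or_neg_one_of_mul_eq_one' hprod with ⟨h3, _⟩ | ⟨h3, _⟩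
  · have hα1 : α = β + 1 := by omega
    rw [hα1] at p3
    push_cast at p3
    have : β = 0 := by
      have x1 : (β:ℝ) < 1 := by nlinarith
      have x2 : (-1:ℝ) < β := by nlinarith
      have x1' : β < 1 := by exact_mod_cast x1
      have x2' : -1 < β := by exact_mod_cast x2
      omega
    have y1 : vt s (l+1) = vt t (k+1) := ext_Bz ut k
      (by rw [a1, B_vt t ut, if_neg (n1 k).symm]) (by rw [B_vt t ut, if_pos rfl]; omega)
    have y2 : vt s (l+2) = vt t (k+2) := ext_Bz ut k
      (by rw [a2, B_vt t ut, if_neg (n2 k).symm]) (by rw [B_vt t ut, if_neg (n12 k)]; omega)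
    rw [oe, oe, y1, y2]
  · have hα1 : α = β - 1 := by omega
    rw [hα1] at p3
    push_cast at p3
    have : β = 1 := by
      have x1 : (β:ℝ) < 2 := by nlinarith
      have x2 : (0:ℝ) < β := by nlinarith
      have x1' : β < 2 := by exact_mod_cast x1
      have x2' : 0 < β := by exact_mod_cast x2
      omega
    have y1 : vt s (l+2) = vt t (k+1) := ext_Bz ut k
      (by rw [a2, B_vt t ut, if_neg (n1 k).symm]) (by rw [B_vt t ut, if_pos rfl]; omega)
    have y2 : vt s (l+1) = vt t (k+2) := ext_Bz ut k
      (by rw [a1, B_vt t ut, if_neg (n2 k).symm]) (by rw [B_vt t ut, if_neg (n12 k)]; omega)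
    rw [oe, oe, y1, y2, Finset.pair_comm]

end
end KR

namespace KR
section
variable {V : Finset (ℤ × ℤ)} (T : UT V)

lemma irr2 {a b : ℤ} (h : (a:ℝ) + b * √2 = 0) : a = 0 ∧ b = 0 := by
  have hb : b = 0 := by
    by_contra hb
    have : Irrational ((a:ℝ) + b * √2) := (irrational_sqrt_two.intCast_mul hb).intCast_add a
    rw [h] at this
    exact this.ne_zero rfl
  subst hb
  simp at h
  exact ⟨h, rfl⟩

/-- irrational direction -/
def hh : ℝ × ℝ := (1, √2)
def ell (x : ℝ × ℝ) : ℝ := √2 * x.1 - x.2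
def sr (s : Bool) : ℝ := if s then 1 else -1

lemma ell_inj {u w : ℤ × ℤ} (h : ell (toR u) = ell (toR w)) : u = w := by
  have := irr2 (a := w.2 - u.2) (b := u.1 - w.1) (by
    simp only [ell, toR] at h; push_cast; linarith)
  ext <;> omega

lemma Bl_ne {t : Tri} (h : |sg t| = 1) (i : Fin 3) : Bl t i hh ≠ 0 := by
  intro h0
  have := irr2 (a := be t i) (b := ga t i) (by simpa [Bl, hh] using h0)
  have h1 := B_vt t h i i
  have h2 := B_vt t h i (i+1)
  rw [if_pos rfl] at h1
  rw [if_neg (n1 i).symm] at h2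
  simp [Bz, this] at h1 h2
  omega

lemma sum_Bl {t : Tri} (h : |sg t| = 1) (k : Fin 3) (d : ℝ × ℝ) :
    Bl t k d + Bl t (k+1) d + Bl t (k+2) d = 0 := by
  have h1 := sum_B t h d
  have h2 := sum_B t h 0
  have e : ∀ i, Bl t i d = B t i d - B t i 0 := fun i => by rw [← Bl_sub, sub_zero]
  rw [← sum3 k (fun i => Bl t i d), Fin.sum_univ_three, e, e, e]
  linarith

lemma interp_lin {t : Tri} (h : |sg t| = 1) (d : ℝ × ℝ) (b c : ℝ) :
    b * d.1 + c * d.2 = ∑ i, Bl t i d * (b * (vt t i).1 + c * (vt t i).2) := by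
  have h1 := interp t h d 0 b c
  have h2 := interp t h 0 0 b c
  have e : ∀ i, Bl t i d = B t i d - B t i 0 := fun i => by rw [← Bl_sub, sub_zero]
  simp only [e, sub_mul, Finset.sum_sub_distrib]
  simp only [zero_add] at h1 h2
  rw [← h1, ← h2]; simp

/-- pointing condition -/
def pt (t : Tri) (i : Fin 3) (s : Bool) : Prop := ∀ j, j ≠ i → 0 < sr s * Bl t j hh

def dirOK (V : Finset (ℤ × ℤ)) (v : ℤ × ℤ) (s : Bool) : Prop :=
  ∃ ε : ℝ, 0 < ε ∧ toR v + ε • (sr s • hh) ∈ polyHull V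

lemma pt_iff (t : Tri) (i : Fin 3) (s : Bool) :
    pt t i s ↔ 0 < sr s * Bl t (i+1) hh ∧ 0 < sr s * Bl t (i+2) hh := by
  constructor
  · intro h; exact ⟨h _ (n1 i), h _ (n2 i)⟩
  · rintro ⟨h1, h2⟩ j hj
    rcases fin3 i j with rfl | rfl | rfl
    · exact absurd rfl hj
    · exact h1
    · exact h2

lemma pt_exists {t : Tri} (h : |sg t| = 1) : ∃ i s, pt t i s := by
  have h0 := sum_Bl h 0 hh
  have a0 := Bl_ne h 0
  have a1 := Bl_ne h 1
  have a2 := Bl_ne h 2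
  simp only [zero_add] at h0
  have key : ∀ i s, 0 < sr s * Bl t (i+1) hh → 0 < sr s * Bl t (i+2) hh → ∃ i s, pt t i s :=
    fun i s h1 h2 => ⟨i, s, (pt_iff t i s).2 ⟨h1, h2⟩⟩
  have k0t := key 0 true
  have k0f := key 0 false
  have k1t := key 1 true
  have k1f := key 1 false
  have k2t := key 2 true
  have k2f := key 2 false
  simp only [sr, zero_add, show (1:Fin 3)+1 = 2 from rfl, show (1:Fin 3)+2 = 0 from rfl,
    show (2:Fin 3)+1 = 0 from rfl, show (2:Fin 3)+2 = 1 from rfl, if_true, one_mul, neg_mul, Left.neg_pos_iff,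
    Bool.false_eq_true, if_false] at k0t k0f k1t k1f k2t k2f
  rcases lt_or_gt_of_ne a0 with b0 | b0 <;> rcases lt_or_gt_of_ne a1 with b1 | b1 <;>
    rcases lt_or_gt_of_ne a2 with b2 | b2 <;> first
    | exact k0t b1 b2 | exact k0f b1 b2 | exact k1t b2 b0 | exact k1f b2 b0
    | exact k2t b0 b1 | exact k2f b0 b1

lemma pt_unique {t : Tri} (h : |sg t| = 1) {i j : Fin 3} {s r : Bool}
    (h1 : pt t i s) (h2 : pt t j r) : i = j ∧ s = r := by
  have key : ∀ i s, pt t i s → sr s * Bl t i hh < 0 := by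
    intro i s hp
    have := sum_Bl h i hh
    obtain ⟨p1, p2⟩ := (pt_iff t i s).1 hp
    have : Bl t i hh = - Bl t (i+1) hh - Bl t (i+2) hh := by linarith
    rw [this]; linarith
  have ki := key i s h1
  have kj := key j r h2
  have hs : s = r := by
    have : ∃ m, m ≠ i ∧ m ≠ j := by clear h1 h2 ki kj; revert i j; decide
    obtain ⟨m, hm1, hm2⟩ := this
    have a := h1 m hm1
    have b := h2 m hm2
    cases s <;> cases r <;> simp [sr] at a b ⊢ <;> linarith
  refine ⟨?_, hs⟩
  subst hs
  by_contra hne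
  have := h2 i hne
  linarith

lemma pt_same {t s : Tri} (ht : t ∈ T.tris) (hs : s ∈ T.tris) {i j : Fin 3} {b : Bool}
    (h1 : pt t i b) (h2 : pt s j b) (hv : vt t i = vt s j) : t = s ∧ i = j := by
  have key : ∀ t ∈ T.tris, ∀ i, pt t i b →
      ∀ᶠ ε in 𝓝[>] (0:ℝ), toR (vt t i) + ε • (sr b • hh) ∈ str t := by
    intro t ht i hp
    refine ev_str t _ _ (fun j => ?_)
    rw [B_toR, B_vt t (uni T ht), Bl_smul]
    split_ifs with hj
    · left; simp
    · right; exact ⟨by simp, hp j hj⟩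
  have e1 := key t ht i h1
  have e2 := key s hs j h2
  rw [← hv] at e2
  obtain ⟨ε, h3, h4⟩ := (e1.and e2).exists
  have := str_str T ht hs h3 h4
  subst this
  exact ⟨rfl, vt_inj (uni T ht) hv⟩

lemma pt_of_dir {v : ℤ × ℤ} (hv : v ∈ latPts V) {s : Bool} (h : dirOK V v s) :
    ∃ t ∈ T.tris, ∃ i, vt t i = v ∧ pt t i s := by
  obtain ⟨ε, hε, hd⟩ := h
  obtain ⟨t, ht, h1, δ, hδ, h2⟩ := local_tri T hv hd
  have ut := uni T ht
  obtain ⟨i, rfl⟩ := lat_vt ut h1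
  refine ⟨t, ht, i, rfl, fun j hj => ?_⟩
  have h3 := (mem_hull t ut _).1 h2 j
  rw [B_add, B_toR, B_vt t ut, if_neg hj, add_sub_cancel_left, Bl_smul, Bl_smul] at h3
  have hne : sr s * Bl t j hh ≠ 0 := mul_ne_zero (by cases s <;> simp [sr]) (Bl_ne ut j)
  refine lt_of_le_of_ne ?_ hne.symm
  have h4 : 0 ≤ (δ * ε) * (sr s * Bl t j hh) := by simp at h3; linarith
  exact nonneg_of_mul_nonneg_right h4 (by positivity)

lemma dir_of_pt {t : Tri} (ht : t ∈ T.tris) {i : Fin 3} {s : Bool} (h : pt t i s) :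
    dirOK V (vt t i) s := by
  have e1 : ∀ᶠ ε in 𝓝[>] (0:ℝ), toR (vt t i) + ε • (sr s • hh) ∈ str t := by
    refine ev_str t _ _ (fun j => ?_)
    rw [B_toR, B_vt t (uni T ht), Bl_smul]
    split_ifs with hj
    · left; simp
    · right; exact ⟨by simp, h j hj⟩
  obtain ⟨ε, h1, h2⟩ := (e1.and self_mem_nhdsWithin).exists
  exact ⟨ε, h2, hull_sub T ht (interior_subset (str_sub t (uni T ht) h1))⟩

lemma vt_lat {t : Tri} (ht : t ∈ T.tris) (i : Fin 3) : vt t i ∈ latPts V :=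
  hull_sub T ht (vt_mem_hull (uni T ht) i)

open Classical in
lemma count1 [Fintype ↥(latPts V)] : T.tris.card =
    (((latPts V).toFinset ×ˢ (Finset.univ : Finset Bool)).filter (fun x => dirOK V x.1 x.2)).card := by
  set N := ((T.tris ×ˢ (Finset.univ : Finset (Fin 3 × Bool))).filter (fun x => pt x.1 x.2.1 x.2.2))
  have c1 : N.card = T.tris.card := by
    refine Finset.card_bij (fun x _ => x.1) ?_ ?_ ?_
    · intro x hx; simp [N] at hx; exact hx.1
    · rintro ⟨t, i, s⟩ hx ⟨t', i', s'⟩ hy hxy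
      simp [N] at hx hy hxy
      subst hxy
      have := pt_unique (uni T hx.1) hx.2 hy.2
      rw [this.1, this.2]
    · intro t ht
      obtain ⟨i, s, h⟩ := pt_exists (uni T ht)
      exact ⟨(t, i, s), by simp [N, ht, h], rfl⟩
  rw [← c1]
  refine Finset.card_bij (fun x _ => (vt x.1 x.2.1, x.2.2)) ?_ ?_ ?_
  · rintro ⟨t, i, s⟩ hx
    simp [N] at hx
    simp only [Finset.mem_filter, Finset.mem_product, Set.mem_toFinset, Finset.mem_univ, and_true]
    exact ⟨vt_lat T hx.1 i, dir_of_pt T hx.1 hx.2⟩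
  · rintro ⟨t, i, s⟩ hx ⟨t', i', s'⟩ hy hxy
    simp [N] at hx hy hxy
    obtain ⟨h1, rfl⟩ := hxy
    have := pt_same T hx.1 hy.1 hx.2 hy.2 h1
    rw [this.1, this.2]
  · rintro ⟨v, s⟩ hx
    simp only [Finset.mem_filter, Finset.mem_product, Set.mem_toFinset, Finset.mem_univ, and_true] at hx
    obtain ⟨t, ht, i, h1, h2⟩ := pt_of_dir T hx.1 hx.2
    exact ⟨(t, i, s), by simp [N, ht, h2], by simp [h1]⟩

lemma tris_ne (hV : IsLatticePolygon V) : ∃ t, t ∈ T.tris := by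
  obtain ⟨p, _, _, hp, _⟩ := hV
  obtain ⟨t, ht, _⟩ := cov T (x := toR p) (subset_convexHull ℝ _ ⟨p, hp, rfl⟩)
  exact ⟨t, ht⟩

lemma str_ne {t : Tri} (h : |sg t| = 1) : ∃ x, x ∈ str t := by
  have := ev_mid h 0 (toR (vt t 0) - mid (oe t 0)) (by
      rw [Bl_sub, B_toR, B_vt t h, B_mid h]; simp)
  obtain ⟨ε, h⟩ := this.exists
  exact ⟨_, h⟩

lemma int_ne (T : UT V) (hV : IsLatticePolygon V) : (interior (polyHull V)).Nonempty := by
  obtain ⟨t, ht⟩ := tris_ne T hV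
  obtain ⟨x, hx⟩ := str_ne (uni T ht)
  exact ⟨x, interior_mono (hull_sub T ht) (str_sub t (uni T ht) hx)⟩

lemma supp (hne : (interior (polyHull V)).Nonempty) {x : ℝ × ℝ} (hx : x ∉ interior (polyHull V)) :
    ∃ a b : ℝ, (a ≠ 0 ∨ b ≠ 0) ∧ ∀ y ∈ polyHull V, a * y.1 + b * y.2 ≤ a * x.1 + b * x.2 := by
  obtain ⟨f, hf, hs⟩ := geometric_hahn_banach_of_nonempty_interior_point (poly_convex (V := V)) hx hne
  have e : ∀ y : ℝ × ℝ, f y = f (1,0) * y.1 + f (0,1) * y.2 := by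
    intro y
    have : y = y.1 • ((1:ℝ),(0:ℝ)) + y.2 • ((0:ℝ),(1:ℝ)) := by ext <;> simp
    conv_lhs => rw [this, map_add, map_smul, map_smul]
    simp only [smul_eq_mul]; ring
  refine ⟨f (1,0), f (0,1), ?_, fun y hy => ?_⟩
  · by_contra hc
    push Not at hc
    apply hf
    apply ContinuousLinearMap.ext; intro y; rw [e y, hc.1, hc.2]; simp
  · rw [← e, ← e]; exact hs y hy

lemma ell_le {m : ℝ} (h : ∀ u ∈ latPts V, ell (toR u) ≤ m) {x : ℝ × ℝ} (hx : x ∈ polyHull V) :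
    ell x ≤ m := by
  have hc : Convex ℝ {y | ell y ≤ m} := by
    intro y hy z hz a b ha hb hab
    simp only [mem_ofPred_eq] at *
    have e : ell (a • y + b • z) = a * ell y + b * ell z := by simp [ell]; ring
    rw [e]
    calc a * ell y + b * ell z ≤ a * m + b * m := by gcongr
      _ = m := by rw [← add_mul, hab, one_mul]
  refine convexHull_min ?_ hc hx
  rintro _ ⟨u, hu, rfl⟩
  exact h u (subset_convexHull ℝ _ ⟨u, hu, rfl⟩)

lemma le_ell {m : ℝ} (h : ∀ u ∈ latPts V, m ≤ ell (toR u)) {x : ℝ × ℝ} (hx : x ∈ polyHull V) :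
    m ≤ ell x := by
  have hc : Convex ℝ {y | m ≤ ell y} := by
    intro y hy z hz a b ha hb hab
    simp only [mem_ofPred_eq] at *
    have e : ell (a • y + b • z) = a * ell y + b * ell z := by simp [ell]; ring
    rw [e]
    calc m = a * m + b * m := by rw [← add_mul, hab, one_mul]
      _ ≤ a * ell y + b * ell z := by gcongr
  refine convexHull_min ?_ hc hx
  rintro _ ⟨u, hu, rfl⟩
  exact h u (subset_convexHull ℝ _ ⟨u, hu, rfl⟩)

lemma ell_add (x d : ℝ × ℝ) (ε : ℝ) : ell (x + ε • d) = ell x + ε * ell d := by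
  simp [ell]; ring

lemma ell_sub (x y : ℝ × ℝ) : ell (y - x) = ell y - ell x := by simp [ell]; ring

lemma ell_hh : ell hh = 0 := by simp [ell, hh]

/-- if v is the middle vertex of something, there are higher and lower lattice points -/
lemma dir_mid (T : UT V) {v : ℤ × ℤ} (hv : v ∈ latPts V) {s : Bool} (h : dirOK V v s) :
    (∃ u ∈ latPts V, ell (toR v) < ell (toR u)) ∧ (∃ u ∈ latPts V, ell (toR u) < ell (toR v)) := by
  obtain ⟨t, ht, i, rfl, hp⟩ := pt_of_dir T hv h
  have ut := uni T ht
  have h1 := interp_lin ut hh (√2) (-1)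
  have h2 := sum_Bl ut i hh
  rw [sum3 i] at h1
  obtain ⟨p1, p2⟩ := (pt_iff t i s).1 hp
  have e : ∀ u : ℤ × ℤ, √2 * (u.1:ℝ) + -1 * u.2 = ell (toR u) := by intro u; simp [ell, toR]; ring
  simp only [e] at h1
  have e0 : √2 * hh.1 + -1 * hh.2 = 0 := by simp [hh]
  rw [e0] at h1
  have h3 : (sr s * Bl t (i+1) hh) * (ell (toR (vt t (i+1))) - ell (toR (vt t i)))
     + (sr s * Bl t (i+2) hh) * (ell (toR (vt t (i+2))) - ell (toR (vt t i))) = 0 := by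
    linear_combination (-sr s) * h1 - sr s * ell (toR (vt t i)) * h2
  have hne : ell (toR (vt t (i+1))) ≠ ell (toR (vt t i)) :=
    fun hc => n1 i (vt_inj ut (ell_inj hc))
  rcases lt_or_gt_of_ne hne with hl | hl
  · refine ⟨⟨_, vt_lat T ht (i+2), ?_⟩, ⟨_, vt_lat T ht (i+1), hl⟩⟩
    by_contra hc
    push Not at hc
    have := mul_neg_of_pos_of_neg p1 (sub_neg.2 hl)
    have := mul_nonpos_of_nonneg_of_nonpos p2.le (sub_nonpos.2 hc)
    linarith
  · refine ⟨⟨_, vt_lat T ht (i+1), hl⟩, ⟨_, vt_lat T ht (i+2), ?_⟩⟩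
    by_contra hc
    push Not at hc
    have := mul_pos p1 (sub_pos.2 hl)
    have := mul_nonneg p2.le (sub_nonneg.2 hc)
    linarith

lemma dir_of_line {v : ℤ × ℤ} {c : ℝ} (hc : c ≠ 0) (hy : toR v + c • hh ∈ polyHull V) :
    dirOK V v true ∨ dirOK V v false := by
  rcases lt_or_gt_of_ne hc with h | h
  · right; exact ⟨-c, by linarith, by simpa [sr] using hy⟩
  · left; exact ⟨c, h, by simpa [sr] using hy⟩

lemma dir_int {v : ℤ × ℤ} (hv : v ∈ intPts V) (s : Bool) : dirOK V v s := by
  have hc : Continuous (fun ε : ℝ => toR v + ε • (sr s • hh)) := by fun_prop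
  have h2 := hc.tendsto 0
  simp only [zero_smul, add_zero] at h2
  have h3 := (h2.mono_left (nhdsWithin_le_nhds (s := Ioi 0))).eventually
    (isOpen_interior.mem_nhds hv)
  obtain ⟨ε, h4, h5⟩ := (h3.and self_mem_nhdsWithin).exists
  exact ⟨ε, h5, interior_subset h4⟩

lemma dir_some (hne : (interior (polyHull V)).Nonempty) {v p q : ℤ × ℤ}
    (hp : p ∈ latPts V) (hq : q ∈ latPts V)
    (hpv : ell (toR p) < ell (toR v)) (hvq : ell (toR v) < ell (toR q)) :
    dirOK V v true ∨ dirOK V v false := by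
  obtain ⟨z, hz⟩ := hne
  have hδ : ∃ δ : ℝ, 0 < δ ∧ z + δ • hh ∈ polyHull V := by
    have hc : Continuous (fun ε : ℝ => z + ε • hh) := by fun_prop
    have h2 := hc.tendsto 0
    simp only [zero_smul, add_zero] at h2
    have h3 := (h2.mono_left (nhdsWithin_le_nhds (s := Ioi 0))).eventually
      (isOpen_interior.mem_nhds hz)
    obtain ⟨ε, h4, h5⟩ := (h3.and self_mem_nhdsWithin).exists
    exact ⟨ε, h5, interior_subset h4⟩
  obtain ⟨δ, hδ, hzδ⟩ := hδ
  have hz := interior_subset hz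
  have key : ∀ p ∈ latPts V, ∀ τ : ℝ, 0 < τ → τ ≤ 1 →
      ell (toR p) + τ * (ell z - ell (toR p)) = ell (toR v) → dirOK V v true ∨ dirOK V v false := by
    intro p hp τ h0 h1 he
    have m1 := seg_mem (x := toR p) hp hz h0.le h1
    have m2 := seg_mem (x := toR p) hp hzδ h0.le h1
    have r1 : toR p + τ • (z - toR p) = toR v + ((toR p).1 + τ * (z.1 - (toR p).1) - (toR v).1) • hh := by
      simp only [ell] at he
      ext
      · simp [hh]
      · simp [hh]; linear_combination -he
    have r2 : toR p + τ • (z + δ • hh - toR p) =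
        toR v + (((toR p).1 + τ * (z.1 - (toR p).1) - (toR v).1) + τ * δ) • hh := by
      rw [add_smul, ← add_assoc, ← r1]
      ext <;> simp <;> ring
    rw [r1] at m1
    rw [r2] at m2
    by_cases hc : (toR p).1 + τ * (z.1 - (toR p).1) - (toR v).1 = 0
    · rw [hc] at m2
      exact dir_of_line (by positivity) m2
    · exact dir_of_line hc m1
  rcases le_total (ell (toR v)) (ell z) with h | h
  · have hd : 0 < ell z - ell (toR p) := by linarith
    refine key p hp ((ell (toR v) - ell (toR p)) / (ell z - ell (toR p))) ?_ ?_ ?_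
    · apply div_pos <;> linarith
    · rw [div_le_one hd]; linarith
    · field_simp; ring
  · have hd : 0 < ell (toR q) - ell z := by linarith
    refine key q hq ((ell (toR q) - ell (toR v)) / (ell (toR q) - ell z)) ?_ ?_ ?_
    · apply div_pos <;> linarith
    · rw [div_le_one hd]; linarith
    · field_simp; ring

lemma dir_both (hne : (interior (polyHull V)).Nonempty) {v p q : ℤ × ℤ}
    (hp : p ∈ latPts V) (hq : q ∈ latPts V)
    (hpv : ell (toR p) < ell (toR v)) (hvq : ell (toR v) < ell (toR q))
    (h1 : dirOK V v true) (h2 : dirOK V v false) : v ∈ intPts V := by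
  by_contra hc
  obtain ⟨a, b, hab, hs⟩ := supp hne hc
  obtain ⟨ε, hε, h1⟩ := h1
  obtain ⟨δ, hδ, h2⟩ := h2
  have s1 := hs _ h1
  have s2 := hs _ h2
  have s3 := hs _ hp
  have s4 := hs _ hq
  simp [sr, hh] at s1 s2
  have k1 : ε * (a + b * √2) ≤ 0 := by linarith
  have k2 : 0 ≤ δ * (a + b * √2) := by linarith
  have k3 : a + b * √2 ≤ 0 := by by_contra h; push Not at h; have := mul_pos hε h; linarith
  have k4 : 0 ≤ a + b * √2 := by
    by_contra h; push Not at h; have := mul_neg_of_pos_of_neg hδ h; linarith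
  have k5 : a = - (b * √2) := by linarith
  subst k5
  simp only [ell] at hpv hvq
  have l1 : 0 ≤ b * ((√2 * (toR q).1 - (toR q).2) - (√2 * (toR v).1 - (toR v).2)) := by linarith
  have l2 : b * ((√2 * (toR v).1 - (toR v).2) - (√2 * (toR p).1 - (toR p).2)) ≤ 0 := by linarith
  have m1 : 0 ≤ b := by
    by_contra h; push Not at h; have := mul_neg_of_neg_of_pos h (sub_pos.2 hvq); linarith
  have m2 : b ≤ 0 := by
    by_contra h; push Not at h; have := mul_pos h (sub_pos.2 hpv); linarith
  have : b = 0 := le_antisymm m2 m1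
  subst this
  simp at hab

open Classical in
/-- Pick's theorem in disguise -/
lemma count2 [Fintype ↥(latPts V)] (hV : IsLatticePolygon V) :
    (T.tris.card : ℤ) + 2 = ((latPts V).toFinset.card : ℤ)
      + ((latPts V).toFinset.filter (fun v => v ∈ intPts V)).card := by
  have hintr := int_ne T hV
  obtain ⟨t0, ht0⟩ := tris_ne T hV
  have hA : (latPts V).toFinset.Nonempty := ⟨vt t0 0, by simpa using vt_lat T ht0 0⟩
  obtain ⟨M, hM, hMmax⟩ := Finset.exists_max_image _ (fun u => ell (toR u)) hA
  obtain ⟨m, hm, hmmin⟩ := Finset.exists_min_image _ (fun u => ell (toR u)) hA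
  simp only [Set.mem_toFinset] at hM hMmax hm hmmin
  have hMm : M ≠ m := by
    intro hc
    have h1 : ∀ i, vt t0 i = M := fun i => ell_inj (le_antisymm (hMmax _ (vt_lat T ht0 i))
      (by rw [hc]; exact hmmin _ (vt_lat T ht0 i)))
    exact absurd (vt_inj (uni T ht0) ((h1 0).trans (h1 1).symm)) (by decide)
  have key : ∀ v ∈ (latPts V).toFinset, (((Finset.univ : Finset Bool).filter (fun s => dirOK V v s)).card : ℤ)
      = 1 + (if v ∈ intPts V then 1 else 0) - (if v = M then 1 else 0) - (if v = m then 1 else 0) := by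
    intro v hv
    rw [Set.mem_toFinset] at hv
    have hcard : (((Finset.univ : Finset Bool).filter (fun s => dirOK V v s)).card : ℤ)
        = (if dirOK V v true then 1 else 0) + (if dirOK V v false then 1 else 0) := by
      rw [Finset.card_filter]; push_cast; rw [Fintype.sum_bool]
    rw [hcard]
    by_cases hvM : v = M
    · have hno : ∀ s, ¬ dirOK V v s := by
        intro s hs
        obtain ⟨⟨u, hu, hlt⟩, _⟩ := dir_mid T hv hs
        have := hMmax u hu
        rw [hvM] at hlt; linarith
      have hni : v ∉ intPts V := fun h => hno true (dir_int h true)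
      have hvm : v ≠ m := by rw [hvM]; exact hMm
      rw [if_neg (hno _), if_neg (hno _), if_neg hni, if_pos hvM, if_neg hvm]; norm_num
    · by_cases hvm : v = m
      · have hno : ∀ s, ¬ dirOK V v s := by
          intro s hs
          obtain ⟨_, ⟨u, hu, hlt⟩⟩ := dir_mid T hv hs
          have := hmmin u hu
          rw [hvm] at hlt; linarith
        have hni : v ∉ intPts V := fun h => hno true (dir_int h true)
        rw [if_neg (hno _), if_neg (hno _), if_neg hni, if_neg hvM, if_pos hvm]; norm_num
      · rw [if_neg hvM, if_neg hvm]
        by_cases hi : v ∈ intPts V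
        · rw [if_pos (dir_int hi _), if_pos (dir_int hi _), if_pos hi]; norm_num
        · have l1 : ell (toR v) < ell (toR M) :=
            lt_of_le_of_ne (hMmax v hv) (fun h => hvM (ell_inj h))
          have l2 : ell (toR m) < ell (toR v) :=
            lt_of_le_of_ne (hmmin v hv) (fun h => hvm (ell_inj h).symm)
          have h1 := dir_some hintr hm hM l2 l1
          have h2 := dir_both hintr hm hM l2 l1
          rw [if_neg hi]
          by_cases a : dirOK V v true
          · have b : ¬ dirOK V v false := fun b => hi (h2 a b)
            rw [if_pos a, if_neg b]; norm_num
          · have b := h1.resolve_left a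
            rw [if_neg a, if_pos b]; norm_num
  have c1 := count1 T
  rw [Finset.card_filter, Finset.sum_product] at c1
  have c2 : (T.tris.card : ℤ) = ∑ v ∈ (latPts V).toFinset,
      (((Finset.univ : Finset Bool).filter (fun s => dirOK V v s)).card : ℤ) := by
    rw [c1]; push_cast
    refine Finset.sum_congr rfl (fun v _ => ?_)
    rw [Finset.card_filter]; push_cast; rfl
  rw [c2, Finset.sum_congr rfl key, Finset.sum_sub_distrib, Finset.sum_sub_distrib,
    Finset.sum_add_distrib, Finset.sum_ite_eq', Finset.sum_ite_eq', if_pos (by simpa using hM),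
    if_pos (by simpa using hm), Finset.card_filter]
  simp
  ring

end
end KR

namespace KR
section
variable {V : Finset (ℤ × ℤ)} (T : UT V)

def dt (p q w : ℤ × ℤ) : ℤ := (q.1 - p.1) * (w.2 - p.2) - (q.2 - p.2) * (w.1 - p.1)

lemma dt_swap (p q w : ℤ × ℤ) : dt q p w = - dt p q w := by simp only [dt]; ring
lemma dt_rot (p q w : ℤ × ℤ) : dt p w q = - dt p q w := by simp only [dt]; ring

lemma dt_vt (t : Tri) (k : Fin 3) : dt (vt t (k+1)) (vt t (k+2)) (vt t k) = sg t := by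
  have e0 : vt t 0 = t.1 := rfl
  have e1 : vt t 1 = t.2.1 := rfl
  have e2 : vt t 2 = t.2.2 := rfl
  have h3 : k = 0 ∨ k = 1 ∨ k = 2 := by revert k; decide
  rcases h3 with rfl | rfl | rfl
  · rw [show (0:Fin 3)+1 = 1 from rfl, show (0:Fin 3)+2 = 2 from rfl, e0, e1, e2]
    simp only [dt, sg]; ring
  · rw [show (1:Fin 3)+1 = 2 from rfl, show (1:Fin 3)+2 = 0 from rfl, e0, e1, e2]
    simp only [dt, sg]; ring
  · rw [show (2:Fin 3)+1 = 0 from rfl, show (2:Fin 3)+2 = 1 from rfl, e0, e1, e2]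
    simp only [dt, sg]

lemma m21 (i : Fin 3) : i + 2 + 1 = i := by revert i; decide
lemma m22 (i : Fin 3) : i + 2 + 2 = i + 1 := by revert i; decide
lemma m11 (i : Fin 3) : i + 1 + 1 = i + 2 := by revert i; decide
lemma m12 (i : Fin 3) : i + 1 + 2 = i := by revert i; decide

lemma pair_cases {p q a b : ℤ × ℤ} (h : ({p, q} : Finset (ℤ × ℤ)) = {a, b}) (hab : a ≠ b) :
    (p = a ∧ q = b) ∨ (p = b ∧ q = a) := by
  have h1 : p ∈ ({a, b} : Finset (ℤ × ℤ)) := by rw [← h]; simp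
  have h2 : q ∈ ({a, b} : Finset (ℤ × ℤ)) := by rw [← h]; simp
  have h3 : a ∈ ({p, q} : Finset (ℤ × ℤ)) := by rw [h]; simp
  have h4 : b ∈ ({p, q} : Finset (ℤ × ℤ)) := by rw [h]; simp
  simp only [Finset.mem_insert, Finset.mem_singleton] at h1 h2 h3 h4
  grind

lemma edge_dt {p q : ℤ × ℤ} (h : {p, q} ∈ edgeSet T) :
    p ∈ latPts V ∧ q ∈ latPts V ∧ ∃ w ∈ latPts V, |dt p q w| = 1 := by
  obtain ⟨t, ht, k, hk⟩ := (edge_iff T).1 h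
  have ut := uni T ht
  rcases pair_cases hk (fun h => n12 k (vt_inj ut h)) with ⟨rfl, rfl⟩ | ⟨rfl, rfl⟩
  · exact ⟨vt_lat T ht _, vt_lat T ht _, _, vt_lat T ht k, by rw [dt_vt, ut]⟩
  · exact ⟨vt_lat T ht _, vt_lat T ht _, _, vt_lat T ht k, by rw [dt_swap, dt_vt, abs_neg, ut]⟩

/-- positively oriented boundary edges -/
def Sb (p q : ℤ × ℤ) : Prop := {p, q} ∈ edgeSet T ∧ ∀ w ∈ latPts V, 0 ≤ dt p q w

lemma Sb_w {p q : ℤ × ℤ} (h : Sb T p q) : ∃ w ∈ latPts V, dt p q w = 1 := by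
  obtain ⟨_, _, w, hw, h1⟩ := edge_dt T h.1
  exact ⟨w, hw, by rwa [abs_of_nonneg (h.2 w hw)] at h1⟩

lemma Sb_asymm {p q : ℤ × ℤ} (h : Sb T p q) : ¬ Sb T q p := by
  intro h'
  obtain ⟨w, hw, h1⟩ := Sb_w T h
  have := h'.2 w hw
  rw [dt_swap, h1] at this
  omega

lemma Sb_inj {p q r : ℤ × ℤ} (h : Sb T p q) (h' : Sb T p r) : q = r := by
  obtain ⟨w, hw, h1⟩ := Sb_w T h
  obtain ⟨w', hw', h1'⟩ := Sb_w T h'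
  have z : dt p q r = 0 := by
    have a := h.2 r (edge_dt T h'.1).2.1
    have b := h'.2 q (edge_dt T h.1).2.1
    rw [dt_rot] at b
    omega
  have c1 := h'.2 w hw
  have c2 := h.2 w' hw'
  simp only [dt] at *
  have x1 : r.1 - p.1 = ((r.1 - p.1) * (w.2 - p.2) - (r.2 - p.2) * (w.1 - p.1)) * (q.1 - p.1) := by
    linear_combination (-(r.1 - p.1)) * h1 + (w.1 - p.1) * z
  have x2 : r.2 - p.2 = ((r.1 - p.1) * (w.2 - p.2) - (r.2 - p.2) * (w.1 - p.1)) * (q.2 - p.2) := by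
    linear_combination (-(r.2 - p.2)) * h1 + (w.2 - p.2) * z
  set c := (r.1 - p.1) * (w.2 - p.2) - (r.2 - p.2) * (w.1 - p.1) with hc
  have hcc : c * ((q.1 - p.1) * (w'.2 - p.2) - (q.2 - p.2) * (w'.1 - p.1)) = 1 := by
    linear_combination h1' - (w'.2 - p.2) * x1 + (w'.1 - p.1) * x2
  have c1' : c = 1 := Int.eq_one_of_mul_eq_one_right c1 hcc
  rw [c1'] at x1 x2
  ext <;> omega

def dR (p q : ℤ × ℤ) (z : ℝ × ℝ) : ℝ :=
  ((q.1:ℝ) - p.1) * (z.2 - p.2) - ((q.2:ℝ) - p.2) * (z.1 - p.1)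

lemma dR_toR (p q w : ℤ × ℤ) : dR p q (toR w) = (dt p q w : ℝ) := by simp [dR, dt, toR]

lemma dR_comb (p q : ℤ × ℤ) (y z : ℝ × ℝ) (a b : ℝ) (hab : a + b = 1) :
    dR p q (a • y + b • z) = a * dR p q y + b * dR p q z := by
  have : a = 1 - b := by linarith
  subst this
  simp [dR]; ring

lemma dR_nonneg {p q : ℤ × ℤ} (h : ∀ w ∈ latPts V, 0 ≤ dt p q w) {z : ℝ × ℝ}
    (hz : z ∈ polyHull V) : 0 ≤ dR p q z := by
  have hc : Convex ℝ {y | 0 ≤ dR p q y} := by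
    intro y hy z hz a b ha hb hab
    simp only [mem_ofPred_eq] at *
    rw [dR_comb _ _ _ _ _ _ hab]
    positivity
  refine convexHull_min ?_ hc hz
  rintro _ ⟨u, hu, rfl⟩
  simp only [mem_ofPred_eq, dR_toR]
  exact_mod_cast h u (subset_convexHull ℝ _ ⟨u, hu, rfl⟩)

lemma dR_zero {p q : ℤ × ℤ} {z : ℝ × ℝ} (hz : z ∈ segOf {p, q}) : dR p q z = 0 := by
  have hc : Convex ℝ {y | dR p q y = 0} := by
    intro y hy z hz a b ha hb hab
    simp only [mem_ofPred_eq] at *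
    rw [dR_comb _ _ _ _ _ _ hab, hy, hz]; simp
  refine convexHull_min ?_ hc hz
  rintro _ ⟨u, hu, rfl⟩
  simp only [mem_ofPred_eq, dR_toR]
  simp at hu
  rcases hu with rfl | rfl <;> simp [dt] <;> ring

lemma seg_sub {p q : ℤ × ℤ} (hp : p ∈ latPts V) (hq : q ∈ latPts V) : segOf {p, q} ⊆ polyHull V := by
  refine convexHull_min ?_ poly_convex
  rintro _ ⟨u, hu, rfl⟩
  simp at hu
  rcases hu with rfl | rfl <;> assumption

lemma not_int {p q : ℤ × ℤ} (hpq : p ≠ q) (h : ∀ w ∈ latPts V, 0 ≤ dt p q w) {z : ℝ × ℝ}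
    (hz : dR p q z = 0) : z ∉ interior (polyHull V) := by
  intro hi
  have hc : Continuous (fun ε : ℝ => z + ε • (((q.2:ℝ) - p.2), -((q.1:ℝ) - p.1))) := by fun_prop
  have h2 := hc.tendsto 0
  simp only [zero_smul, add_zero] at h2
  have h3 := (h2.mono_left (nhdsWithin_le_nhds (s := Ioi 0))).eventually
    (isOpen_interior.mem_nhds hi)
  obtain ⟨ε, h4, h5⟩ := (h3.and self_mem_nhdsWithin).exists
  have h6 := dR_nonneg h (interior_subset h4)
  have h5 : 0 < ε := h5
  have e : dR p q (z + ε • (((q.2:ℝ) - p.2), -((q.1:ℝ) - p.1)))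
      = dR p q z - ε * (((q.1:ℝ) - p.1)^2 + ((q.2:ℝ) - p.2)^2) := by
    simp [dR]; ring
  rw [e, hz] at h6
  have h7 : ((q.1:ℝ) - p.1)^2 + ((q.2:ℝ) - p.2)^2 ≤ 0 := by
    by_contra hc; push Not at hc
    have := mul_pos h5 hc; linarith
  have a1 : ((q.1:ℝ) - p.1)^2 = 0 := by nlinarith [sq_nonneg ((q.1:ℝ) - p.1), sq_nonneg ((q.2:ℝ) - p.2)]
  have a2 : ((q.2:ℝ) - p.2)^2 = 0 := by nlinarith [sq_nonneg ((q.1:ℝ) - p.1), sq_nonneg ((q.2:ℝ) - p.2)]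
  rw [sq_eq_zero_iff, sub_eq_zero] at a1 a2
  apply hpq
  ext
  · exact_mod_cast a1.symm
  · exact_mod_cast a2.symm

lemma Sb_ne {p q : ℤ × ℤ} (h : Sb T p q) : p ≠ q := by
  rintro rfl
  obtain ⟨w, _, h1⟩ := Sb_w T h
  simp [dt] at h1

lemma Sb_frontier {p q : ℤ × ℤ} (h : Sb T p q) : segOf {p, q} ⊆ frontier (polyHull V) := by
  intro z hz
  have hl := edge_dt T h.1
  exact ⟨subset_closure (seg_sub hl.1 hl.2.1 hz), not_int (Sb_ne T h) h.2 (dR_zero hz)⟩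

lemma Sb_bd {p q : ℤ × ℤ} (h : Sb T p q) : p ∉ intPts V :=
  not_int (Sb_ne T h) h.2 (by rw [dR_toR]; simp [dt])

lemma mid_seg {p q : ℤ × ℤ} : (1/2:ℝ) • toR p + (1/2:ℝ) • toR q ∈ segOf {p, q} := by
  have : Convex ℝ (segOf {p, q}) := convex_convexHull ℝ _
  refine this (subset_convexHull ℝ _ ⟨p, by simp, rfl⟩) (subset_convexHull ℝ _ ⟨q, by simp, rfl⟩)
    (by norm_num) (by norm_num) (by norm_num)

lemma Sb_of_frontier (hV : IsLatticePolygon V) {p q : ℤ × ℤ} (he : {p, q} ∈ edgeSet T)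
    (h : segOf {p, q} ⊆ frontier (polyHull V)) : Sb T p q ∨ Sb T q p := by
  obtain ⟨hp, hq, w0, _, hw0⟩ := edge_dt T he
  obtain ⟨a, b, hab, hs⟩ := supp (int_ne T hV) (h mid_seg).2
  have e1 := hs _ hp
  have e2 := hs _ hq
  simp [toR] at e1 e2
  have hperp : a * ((q.1:ℝ) - p.1) + b * ((q.2:ℝ) - p.2) = 0 := by linarith
  have hle : ∀ w ∈ latPts V, a * ((w.1:ℝ) - p.1) + b * ((w.2:ℝ) - p.2) ≤ 0 := by
    intro w hw
    have := hs _ hw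
    simp [toR] at this
    linarith
  set N := ((q.1:ℝ) - p.1)^2 + ((q.2:ℝ) - p.2)^2
  set k := - a * ((q.2:ℝ) - p.2) + b * ((q.1:ℝ) - p.1) with hk
  have hN : 0 < N := by
    rcases (add_nonneg (sq_nonneg ((q.1:ℝ) - p.1)) (sq_nonneg ((q.2:ℝ) - p.2))).lt_or_eq with hh | hh
    · exact hh
    · exfalso
      have a1 : ((q.1:ℝ) - p.1)^2 = 0 := by nlinarith [sq_nonneg ((q.1:ℝ) - p.1), sq_nonneg ((q.2:ℝ) - p.2)]
      have a2 : ((q.2:ℝ) - p.2)^2 = 0 := by nlinarith [sq_nonneg ((q.1:ℝ) - p.1), sq_nonneg ((q.2:ℝ) - p.2)]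
      rw [sq_eq_zero_iff] at a1 a2
      have b1 : q.1 - p.1 = 0 := by exact_mod_cast a1
      have b2 : q.2 - p.2 = 0 := by exact_mod_cast a2
      rw [dt, b1, b2] at hw0; simp at hw0
  have id : ∀ w : ℤ × ℤ, N * (a * ((w.1:ℝ) - p.1) + b * ((w.2:ℝ) - p.2)) = k * (dt p q w : ℝ) := by
    intro w
    simp only [dt, N, k]; push_cast
    linear_combination (((q.1:ℝ) - p.1) * ((w.1:ℝ) - p.1) + ((q.2:ℝ) - p.2) * ((w.2:ℝ) - p.2)) * hperp
  have hkd : ∀ w ∈ latPts V, k * (dt p q w : ℝ) ≤ 0 := by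
    intro w hw
    rw [← id]
    exact mul_nonpos_of_nonneg_of_nonpos hN.le (hle w hw)
  have hk0 : k ≠ 0 := by
    intro h0
    have a1 : a * N = 0 := by simp only [N]; linear_combination ((q.1:ℝ) - p.1) * hperp - ((q.2:ℝ) - p.2) * h0 + ((q.2:ℝ) - p.2) * hk
    have a2 : b * N = 0 := by simp only [N]; linear_combination ((q.2:ℝ) - p.2) * hperp + ((q.1:ℝ) - p.1) * h0 - ((q.1:ℝ) - p.1) * hk
    rcases hab with h | h
    · exact mul_ne_zero h hN.ne' a1
    · exact mul_ne_zero h hN.ne' a2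
  rcases lt_or_gt_of_ne hk0 with hk | hk
  · left
    refine ⟨he, fun w hw => ?_⟩
    by_contra hc; push Not at hc
    have hc' : (dt p q w : ℝ) < 0 := by exact_mod_cast hc
    have := mul_pos_of_neg_of_neg hk hc'
    linarith [hkd w hw]
  · right
    refine ⟨by rwa [Finset.pair_comm], fun w hw => ?_⟩
    by_contra hc; push Not at hc
    rw [dt_swap] at hc
    have hc' : 0 < (dt p q w : ℝ) := by
      have : 0 < dt p q w := by omega
      exact_mod_cast this
    have := mul_pos hk hc'
    linarith [hkd w hw]

lemma key_le {f k f' k' : ℝ} (hf : 0 ≤ f) (hf' : 0 ≤ f') (h : 0 < f + |k|) (h' : 0 < f' + |k'|)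
    (hle : k / (f + |k|) ≤ k' / (f' + |k'|)) : 0 ≤ f * k' - k * f' := by
  rw [div_le_div_iff₀ h h'] at hle
  rcases le_or_gt 0 k with hk | hk <;> rcases le_or_gt 0 k' with hk' | hk'
  · rw [abs_of_nonneg hk, abs_of_nonneg hk'] at hle; linarith
  · have := mul_nonneg hk h'.le
    have := mul_neg_of_neg_of_pos hk' h
    linarith
  · have := mul_nonneg hf hk'
    have := mul_nonpos_of_nonpos_of_nonneg hk.le hf'
    linarith
  · rw [abs_of_neg hk, abs_of_neg hk'] at hle; linarith

lemma angle_min (T : UT V) [Fintype ↥(latPts V)] (hV : IsLatticePolygon V) {v : ℤ × ℤ}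
    (hi : v ∉ intPts V) : ∃ q ∈ latPts V, q ≠ v ∧ ∀ w ∈ latPts V, 0 ≤ dt v q w := by
  obtain ⟨a, b, hab, hs⟩ := supp (int_ne T hV) hi
  have hN : 0 < a^2 + b^2 := by rcases hab with h | h <;> positivity
  set f : ℤ × ℤ → ℝ := fun w => - a * ((w.1:ℝ) - v.1) - b * ((w.2:ℝ) - v.2)
  set k : ℤ × ℤ → ℝ := fun w => b * ((w.1:ℝ) - v.1) - a * ((w.2:ℝ) - v.2)
  have hf : ∀ w ∈ latPts V, 0 ≤ f w := by
    intro w hw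
    have := hs _ hw
    simp [toR] at this
    simp only [f]
    linarith
  have hpos : ∀ w ∈ latPts V, w ≠ v → 0 < f w + |k w| := by
    intro w hw hwv
    by_contra hc
    push Not at hc
    have h1 : f w = 0 := by linarith [hf w hw, abs_nonneg (k w)]
    have h2 : k w = 0 := by
      rw [← abs_eq_zero]; linarith [hf w hw, abs_nonneg (k w)]
    simp only [f, k] at h1 h2
    have a1 : (a^2 + b^2) * ((w.1:ℝ) - v.1) = 0 := by linear_combination -a * h1 + b * h2
    have a2 : (a^2 + b^2) * ((w.2:ℝ) - v.2) = 0 := by linear_combination -b * h1 - a * h2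
    have b1 := (mul_eq_zero.1 a1).resolve_left hN.ne'
    have b2 := (mul_eq_zero.1 a2).resolve_left hN.ne'
    rw [sub_eq_zero] at b1 b2
    exact hwv (Prod.ext (by exact_mod_cast b1) (by exact_mod_cast b2))
  obtain ⟨t, ht⟩ := tris_ne T hV
  have hne : ((latPts V).toFinset.erase v).Nonempty := by
    by_cases h : vt t 0 = v
    · refine ⟨vt t 1, ?_⟩
      simp only [Finset.mem_erase, Set.mem_toFinset]
      exact ⟨fun h' => absurd (vt_inj (uni T ht) (h.trans h'.symm)) (by decide), vt_lat T ht 1⟩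
    · refine ⟨vt t 0, ?_⟩
      simp only [Finset.mem_erase, Set.mem_toFinset]
      exact ⟨h, vt_lat T ht 0⟩
  obtain ⟨q, hq, hmin⟩ := Finset.exists_min_image _ (fun w => k w / (f w + |k w|)) hne
  simp only [Finset.mem_erase, Set.mem_toFinset] at hq hmin
  refine ⟨q, hq.2, hq.1, fun w hw => ?_⟩
  by_cases hwv : w = v
  · subst hwv; simp [dt]
  have h1 := key_le (hf q hq.2) (hf w hw) (hpos q hq.2 hq.1) (hpos w hw hwv) (hmin w ⟨hwv, hw⟩)
  have h2 : f q * k w - k q * f w = (a^2 + b^2) * (dt v q w : ℝ) := by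
    simp only [f, k, dt]; push_cast; ring
  rw [h2] at h1
  have h3 := nonneg_of_mul_nonneg_right h1 hN
  exact_mod_cast h3

lemma Sb_exists [Fintype ↥(latPts V)] (hV : IsLatticePolygon V) {v : ℤ × ℤ} (hv : v ∈ latPts V)
    (hi : v ∉ intPts V) : ∃ q, Sb T v q := by
  obtain ⟨q, hq, hqv, hmin⟩ := angle_min T hV hi
  obtain ⟨t, ht, hvt, ε, hε, hm⟩ := local_tri T (x := toR v) (y := toR q) hv hq
  have ut := uni T ht
  obtain ⟨i, rfl⟩ := lat_vt ut hvt
  rw [mem_hull t ut] at hm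
  have key : ∀ j, j ≠ i → 0 ≤ Bz t j q := by
    intro j hj
    have := hm j
    rw [B_add, Bl_sub, B_toR, B_toR, B_vt t ut, if_neg hj] at this
    simp at this
    have := nonneg_of_mul_nonneg_right this hε
    exact_mod_cast this
  have k1 := key (i+1) (n1 i)
  have k2 := key (i+2) (n2 i)
  have m1 := hmin _ (vt_lat T ht (i+1))
  have m2 := hmin _ (vt_lat T ht (i+2))
  -- express q through barycentric coordinates
  have E1 : q.1 - (vt t i).1 = Bz t (i+1) q * ((vt t (i+1)).1 - (vt t i).1)
      + Bz t (i+2) q * ((vt t (i+2)).1 - (vt t i).1) := by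
    have h1 := interp t ut (toR q) 0 1 0
    rw [sum3 i] at h1
    have h2 := sumBz ut i q
    simp only [B_toR] at h1
    simp [toR] at h1
    have h1' : q.1 = Bz t i q * (vt t i).1 + Bz t (i+1) q * (vt t (i+1)).1
      + Bz t (i+2) q * (vt t (i+2)).1 := by exact_mod_cast h1
    linear_combination h1' + (vt t i).1 * h2
  have E2 : q.2 - (vt t i).2 = Bz t (i+1) q * ((vt t (i+1)).2 - (vt t i).2)
      + Bz t (i+2) q * ((vt t (i+2)).2 - (vt t i).2) := by
    have h1 := interp t ut (toR q) 0 0 1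
    rw [sum3 i] at h1
    have h2 := sumBz ut i q
    simp only [B_toR] at h1
    simp [toR] at h1
    have h1' : q.2 = Bz t i q * (vt t i).2 + Bz t (i+1) q * (vt t (i+1)).2
      + Bz t (i+2) q * (vt t (i+2)).2 := by exact_mod_cast h1
    linear_combination h1' + (vt t i).2 * h2
  have hd : ∀ w, dt (vt t i) q w = Bz t (i+1) q * dt (vt t i) (vt t (i+1)) w
      + Bz t (i+2) q * dt (vt t i) (vt t (i+2)) w := by
    intro w
    simp only [dt]
    linear_combination (w.2 - (vt t i).2) * E1 - (w.1 - (vt t i).1) * E2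
  have d12 : dt (vt t i) (vt t (i+1)) (vt t (i+2)) = sg t := by
    rw [← dt_vt t i]; simp only [dt]; ring
  have d0 : ∀ p q : ℤ × ℤ, dt p q q = 0 := by intro p q; simp only [dt]; ring
  have hsg : sg t = 1 ∨ sg t = -1 := by
    rcases abs_eq (zero_le_one) |>.1 ut with h | h <;> simp [h]
  rw [hd, d0, dt_rot, d12] at m1
  rw [hd, d0, d12] at m2
  have fin : ∀ w' : ℤ × ℤ, ∀ c : ℤ, 0 ≤ c → (∀ w, dt (vt t i) q w = c * dt (vt t i) w' w) →
      {vt t i, w'} ∈ edgeSet T → Sb T (vt t i) w' := by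
    intro w' c hc hh he
    refine ⟨he, fun w hw => ?_⟩
    have := hmin w hw
    rw [hh] at this
    rcases hc.lt_or_eq with hc | hc
    · exact nonneg_of_mul_nonneg_right this hc
    · exfalso
      rw [← hc] at hh
      simp only [dt] at hh
      have a1 := hh ((vt t i).1 + 1, (vt t i).2)
      have a2 := hh ((vt t i).1, (vt t i).2 + 1)
      simp at a1 a2
      exact hqv (Prod.ext (by omega) (by omega))
  have e1 : {vt t i, vt t (i+1)} ∈ edgeSet T := (edge_iff T).2 ⟨t, ht, i+2, by
    rw [oe, m21, m22]⟩
  have e2 : {vt t i, vt t (i+2)} ∈ edgeSet T := (edge_iff T).2 ⟨t, ht, i+1, by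
    rw [oe, m11, m12, Finset.pair_comm]⟩
  rcases hsg with h | h
  · have z : Bz t (i+2) q = 0 := by rw [h] at m1; omega
    exact ⟨_, fin _ _ k1 (fun w => by rw [hd, z]; ring) e1⟩
  · have z : Bz t (i+1) q = 0 := by rw [h] at m2; omega
    exact ⟨_, fin _ _ k2 (fun w => by rw [hd, z]; ring) e2⟩

end
end KR

namespace KR
section
variable {V : Finset (ℤ × ℤ)} (T : UT V)

lemma memTri_oe {a b c : ℤ × ℤ} (h : memTri T a b c) :
    ∃ t ∈ T.tris, ∃ k, vt t k = a ∧ oe t k = {b, c} := by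
  obtain ⟨t, ht, he⟩ := h
  have ut := uni T ht
  have hset : ∀ k, ({vt t k, vt t (k+1), vt t (k+2)} : Finset (ℤ × ℤ)) = {a, b, c} := by
    intro k
    rw [← he]
    have e0 : vt t 0 = t.1 := rfl
    have e1 : vt t 1 = t.2.1 := rfl
    have e2 : vt t 2 = t.2.2 := rfl
    rw [← e0, ← e1, ← e2]
    have h3 : k = 0 ∨ k = 1 ∨ k = 2 := by revert k; decide
    rcases h3 with rfl | rfl | rfl
    · rfl
    · rw [show (1:Fin 3)+1 = 2 from rfl, show (1:Fin 3)+2 = 0 from rfl]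
      ext x; simp only [Finset.mem_insert, Finset.mem_singleton]; tauto
    · rw [show (2:Fin 3)+1 = 0 from rfl, show (2:Fin 3)+2 = 1 from rfl]
      ext x; simp only [Finset.mem_insert, Finset.mem_singleton]; tauto
  have hk : ∃ k, vt t k = a := by
    have : a ∈ ({vt t 0, vt t (0+1), vt t (0+2)} : Finset (ℤ × ℤ)) := by rw [hset]; simp
    simp only [Finset.mem_insert, Finset.mem_singleton] at this
    rcases this with h | h | h <;> exact ⟨_, h.symm⟩
  obtain ⟨k, hk⟩ := hk
  refine ⟨t, ht, k, hk, ?_⟩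
  have h01 : vt t k ≠ vt t (k+1) := fun h => n1 k (vt_inj ut h).symm
  have h02 : vt t k ≠ vt t (k+2) := fun h => n2 k (vt_inj ut h).symm
  have h12 : vt t (k+1) ≠ vt t (k+2) := fun h => n12 k (vt_inj ut h)
  have hc : ({a, b, c} : Finset (ℤ × ℤ)).card = 3 := by
    rw [← hset k, Finset.card_eq_three]
    exact ⟨_, _, _, h01, h02, h12, rfl⟩
  have hab : a ∉ ({b, c} : Finset (ℤ × ℤ)) := by
    intro hm
    rw [Finset.insert_eq_of_mem hm] at hc
    have := Finset.card_le_two (a := b) (b := c)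
    omega
  have ho : vt t k ∉ oe t k := by rw [vt_mem_oe ut]; simp
  have := congrArg (fun s => Finset.erase s a) (hset k)
  rw [← hk] at this hab
  rw [Finset.erase_insert hab] at this
  rw [← this]
  exact (Finset.erase_insert ho).symm

open Classical in
lemma card_bd [Fintype ↥(latPts V)] (hV : IsLatticePolygon V) :
    ((edgeSet T).filter (fun e => segOf e ⊆ frontier (polyHull V))).card
      = ((latPts V).toFinset.filter (fun v => v ∉ intPts V)).card := by
  set N := ((latPts V).toFinset ×ˢ (latPts V).toFinset).filter (fun x => Sb T x.1 x.2)
  have hN : ∀ p q, (p, q) ∈ N ↔ Sb T p q := by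
    intro p q
    simp only [N, Finset.mem_filter, Finset.mem_product, Set.mem_toFinset, and_iff_right_iff_imp]
    intro h
    exact ⟨(edge_dt T h.1).1, (edge_dt T h.1).2.1⟩
  trans N.card
  · symm
    refine Finset.card_bij (fun x _ => {x.1, x.2}) ?_ ?_ ?_
    · rintro ⟨p, q⟩ hx
      rw [hN] at hx
      simp only [Finset.mem_filter]
      exact ⟨hx.1, Sb_frontier T hx⟩
    · rintro ⟨p, q⟩ hx ⟨p', q'⟩ hy hxy
      rw [hN] at hx hy
      simp only at hxy
      rcases pair_cases hxy (Sb_ne T hy) with ⟨rfl, rfl⟩ | ⟨rfl, rfl⟩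
      · rfl
      · exact absurd hy (Sb_asymm T hx)
    · intro e he
      simp only [Finset.mem_filter] at he
      obtain ⟨t, ht, k, hk⟩ := (edge_iff T).1 he.1
      rw [oe] at hk
      subst hk
      rcases Sb_of_frontier T hV he.1 he.2 with h | h
      · exact ⟨(_, _), (hN _ _).2 h, rfl⟩
      · exact ⟨(_, _), (hN _ _).2 h, Finset.pair_comm _ _⟩
  · refine Finset.card_bij (fun x _ => x.1) ?_ ?_ ?_
    · rintro ⟨p, q⟩ hx
      rw [hN] at hx
      simp only [Finset.mem_filter, Set.mem_toFinset]
      exact ⟨(edge_dt T hx.1).1, Sb_bd T hx⟩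
    · rintro ⟨p, q⟩ hx ⟨p', q'⟩ hy hxy
      rw [hN] at hx hy
      simp only at hxy
      subst hxy
      rw [Sb_inj T hx hy]
    · intro v hv
      simp only [Finset.mem_filter, Set.mem_toFinset] at hv
      obtain ⟨q, hq⟩ := Sb_exists T hV hv.1 hv.2
      exact ⟨(v, q), (hN _ _).2 hq, rfl⟩

/-- every interior edge lies in two distinct triangles -/
def Two : Prop := ∀ e ∈ intEdges T, ∃ t ∈ T.tris, ∃ s ∈ T.tris, t ≠ s ∧ ∃ k l, oe t k = e ∧ oe s l = e

open Classical in
lemma inc_card (h2 : Two T) {e : Finset (ℤ × ℤ)} (he : e ∈ edgeSet T) :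
    ((T.tris ×ˢ (Finset.univ : Finset (Fin 3))).filter (fun x => oe x.1 x.2 = e)).card
      = if segOf e ⊆ frontier (polyHull V) then 1 else 2 := by
  split_ifs with hf
  · obtain ⟨t, ht, k, hk⟩ := (edge_iff T).1 he
    rw [Finset.card_eq_one]
    refine ⟨(t, k), ?_⟩
    ext ⟨s, l⟩
    simp only [Finset.mem_filter, Finset.mem_product, Finset.mem_univ, and_true, Finset.mem_singleton,
      Prod.mk.injEq]
    constructor
    · rintro ⟨hs, hl⟩
      have hts : t = s := by
        by_contra hne
        have := two_int T ht hs (hk.symm.trans hl.symm) hne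
        rw [mid_oe (uni T ht)] at this
        refine (hf ?_).2 this
        rw [hk, oe]; exact mid_seg
      subst hts
      exact ⟨rfl, oe_inj (uni T hs) (hl.trans hk)⟩
    · rintro ⟨rfl, rfl⟩
      exact ⟨ht, hk.symm⟩
  · obtain ⟨t, ht, s, hs, hne, k, l, hk, hl⟩ := h2 e ⟨he, hf⟩
    rw [Finset.card_eq_two]
    refine ⟨(t, k), (s, l), fun h => hne (congrArg Prod.fst h), ?_⟩
    ext ⟨r, m⟩
    simp only [Finset.mem_filter, Finset.mem_product, Finset.mem_univ, and_true, Finset.mem_singleton,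
      Finset.mem_insert, Prod.mk.injEq]
    constructor
    · rintro ⟨hr, hm⟩
      rcases three T ht hs hr (hk.trans hl.symm) (hk.trans hm.symm) with h | h | h
      · exact absurd h hne
      · subst h; left; exact ⟨rfl, oe_inj (uni T ht) (hm.trans hk.symm)⟩
      · subst h; right; exact ⟨rfl, oe_inj (uni T hs) (hm.trans hl.symm)⟩
    · rintro (⟨rfl, rfl⟩ | ⟨rfl, rfl⟩)
      · exact ⟨ht, hk⟩
      · exact ⟨hs, hl⟩

open Classical in
lemma edge_count [Fintype ↥(latPts V)] (hV : IsLatticePolygon V) (h2 : Two T) :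
    ((edgeSet T).filter (fun e => ¬ segOf e ⊆ frontier (polyHull V))).card + 3
      = (latPts V).toFinset.card + 2 * ((latPts V).toFinset.filter (fun v => v ∈ intPts V)).card := by
  have c := Finset.card_eq_sum_card_fiberwise (s := T.tris ×ˢ (Finset.univ : Finset (Fin 3)))
    (t := edgeSet T) (f := fun x => oe x.1 x.2) (by
      rintro ⟨t, k⟩ hx
      simp at hx
      exact (edge_iff T).2 ⟨t, hx, k, rfl⟩)
  rw [Finset.sum_congr rfl (fun e he => inc_card T h2 he), Finset.card_product] at c
  rw [Finset.sum_ite, Finset.sum_const, Finset.sum_const] at c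
  have c1 := card_bd T hV
  have c2 := count2 T hV
  have c3 := Finset.card_filter_add_card_filter_not (s := (latPts V).toFinset) (fun v => v ∈ intPts V)
  simp at c
  omega

end
end KR

namespace KR
section
variable {V : Finset (ℤ × ℤ)} (T : UT V)

lemma hD (P1 P2 P3 P4 : ℤ × ℤ) (w1 w2 w3 w4 : ℝ) : heightDet P1 P2 P3 P4 w1 w2 w3 w4 =
    w4 * (dt P1 P2 P3 : ℝ) - w3 * (dt P1 P2 P4 : ℝ) + w2 * (dt P1 P3 P4 : ℝ)
      - w1 * (dt P2 P3 P4 : ℝ) := by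
  rw [heightDet, Matrix.det_succ_row_zero]
  simp [Fin.sum_univ_succ, Matrix.det_fin_three, dt, Fin.succAbove, Matrix.submatrix]
  ring

lemma hD_aff (P1 P2 P3 P4 : ℤ × ℤ) (a b c : ℝ) : heightDet P1 P2 P3 P4
    (a + b * P1.1 + c * P1.2) (a + b * P2.1 + c * P2.2) (a + b * P3.1 + c * P3.2)
    (a + b * P4.1 + c * P4.2) = 0 := by
  rw [hD]; simp only [dt]; push_cast; ring

def dd (x y z : ℝ × ℝ) : ℝ := (y.1 - x.1) * (z.2 - x.2) - (y.2 - x.2) * (z.1 - x.1)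

lemma str_nl {t : Tri} (h : |sg t| = 1) {x : ℝ × ℝ} (hx : x ∈ str t) (u : ℤ × ℤ) : x ≠ toR u := by
  rintro rfl
  have h1 : toR u ∈ hull t := (mem_hull t h _).2 fun i => (hx i).le
  obtain ⟨i, rfl⟩ := lat_vt h h1
  have := hx (i+1)
  rw [B_toR, B_vt t h, if_neg (n1 i)] at this
  simp at this

lemma good_pt {t s : Tri} (ht : t ∈ T.tris) (hs : s ∈ T.tris) (hne : t ≠ s) :
    ∃ x ∈ str t, ∃ y ∈ str s, ∀ u, dd x y (toR u) ≠ 0 := by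
  obtain ⟨x, hx⟩ := str_ne (uni T ht)
  obtain ⟨y, hy⟩ := str_ne (uni T hs)
  have hxy : x ≠ y := by
    rintro rfl; exact hne (str_str T ht hs hx hy)
  set k : ℝ × ℝ := (-(y.2 - x.2), y.1 - x.1) with hk
  have hN : 0 < (y.1 - x.1)^2 + (y.2 - x.2)^2 := by
    have : y.1 - x.1 ≠ 0 ∨ y.2 - x.2 ≠ 0 := by
      by_contra hc; push Not at hc
      exact hxy (Prod.ext (by linarith [hc.1]) (by linarith [hc.2]))
    rcases this with h | h <;> positivity
  have bad : (⋃ u : ℤ × ℤ, {δ : ℝ | dd x (y + δ • k) (toR u) = 0}).Countable := by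
    refine Set.countable_iUnion fun u => Set.Subsingleton.countable ?_
    intro a ha b hb
    simp only [mem_ofPred_eq] at ha hb
    by_contra hab
    have hab' : a - b ≠ 0 := sub_ne_zero.2 hab
    have ex : ∀ δ, dd x (y + δ • k) (toR u) = dd x y (toR u)
        + δ * (-(y.2 - x.2) * ((toR u).2 - x.2) - (y.1 - x.1) * ((toR u).1 - x.1)) := by
      intro δ; simp [dd, hk]; ring
    rw [ex] at ha hb
    have h1 : (-(y.2 - x.2) * ((toR u).2 - x.2) - (y.1 - x.1) * ((toR u).1 - x.1)) = 0 := by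
      apply (mul_eq_zero.1 (_ : (a - b) * _ = 0)).resolve_left hab'
      linear_combination ha - hb
    rw [h1] at ha
    simp only [dd, mul_zero, add_zero] at ha
    have z1 : ((y.1 - x.1)^2 + (y.2 - x.2)^2) * ((toR u).1 - x.1) = 0 := by
      linear_combination -(y.1 - x.1) * h1 - (y.2 - x.2) * ha
    have z2 : ((y.1 - x.1)^2 + (y.2 - x.2)^2) * ((toR u).2 - x.2) = 0 := by
      linear_combination -(y.2 - x.2) * h1 + (y.1 - x.1) * ha
    have y1 := (mul_eq_zero.1 z1).resolve_left hN.ne'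
    have y2 := (mul_eq_zero.1 z2).resolve_left hN.ne'
    exact str_nl (uni T ht) hx u (Prod.ext (by linarith) (by linarith))
  have hc : Continuous (fun δ : ℝ => y + δ • k) := by fun_prop
  obtain ⟨δ, h1, h2⟩ := (bad.dense_compl ℝ).exists_mem_open ((str_open s).preimage hc)
    ⟨0, by simpa using hy⟩
  refine ⟨x, hx, y + δ • k, h2, fun u hu => h1 ?_⟩
  exact mem_iUnion.2 ⟨u, hu⟩

lemma connect (Z : Tri → Prop)
    (step : ∀ t ∈ T.tris, ∀ s ∈ T.tris, ∀ k l, oe t k = oe s l → t ≠ s → Z t → Z s)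
    {t0 : Tri} (ht0 : t0 ∈ T.tris) (hZ0 : Z t0) : ∀ t ∈ T.tris, Z t := by
  intro t1 ht1
  by_contra hZ1
  have hne : t0 ≠ t1 := by rintro rfl; exact hZ1 hZ0
  obtain ⟨x, hx, y, hy, hd⟩ := good_pt T ht0 ht1 hne
  have hx' : x ∈ hull t0 := (mem_hull _ (uni T ht0) _).2 fun i => (hx i).le
  have hy' : y ∈ hull t1 := (mem_hull _ (uni T ht1) _).2 fun i => (hy i).le
  have cl : ∀ Q : Tri → Prop, IsClosed (⋃ t ∈ {t | t ∈ T.tris ∧ Q t}, hull t) := by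
    intro Q
    refine Set.Finite.isClosed_biUnion (T.tris.finite_toSet.subset fun t ht => ht.1) ?_
    intro t ht; exact hull_closed t (uni T ht.1)
  have pc : IsPreconnected (segment ℝ x y) := (convex_segment x y).isPreconnected
  obtain ⟨z, hz, hz1, hz2⟩ := isPreconnected_closed_iff.1 pc _ _ (cl Z) (cl (fun t => ¬ Z t)) (by
      intro z hz
      have hzD := poly_convex.segment_subset (hull_sub T ht0 hx') (hull_sub T ht1 hy') hz
      obtain ⟨t, ht, hzt⟩ := cov T hzD
      by_cases h : Z t
      · left; exact mem_biUnion (x := t) ⟨ht, h⟩ hzt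
      · right; exact mem_biUnion (x := t) ⟨ht, h⟩ hzt)
    ⟨x, left_mem_segment _ _ _, mem_biUnion (x := t0) ⟨ht0, hZ0⟩ hx'⟩
    ⟨y, right_mem_segment _ _ _, mem_biUnion (x := t1) ⟨ht1, hZ1⟩ hy'⟩
  simp only [mem_iUnion, exists_prop] at hz1 hz2
  obtain ⟨t, ⟨ht, hZt⟩, hzt⟩ := hz1
  obtain ⟨s, ⟨hs, hZs⟩, hzs⟩ := hz2
  have hts : t ≠ s := by rintro rfl; exact hZs hZt
  obtain ⟨k, l, hkl⟩ := face T ht hs hts hzt hzs (by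
    rintro u rfl
    apply hd u
    obtain ⟨a, b, _, _, hab, he⟩ := hz
    rw [← he]
    have : a = 1 - b := by linarith
    subst this
    simp [dd]; ring)
  exact hZs (step t ht s hs k l hkl hts hZt)

def KerLike (h : ℤ × ℤ → ℝ) : Prop := ∀ e ∈ intEdges T, ∃ P1 P2 P3 P4 : ℤ × ℤ,
  e = {P2, P3} ∧ memTri T P1 P2 P3 ∧ memTri T P4 P2 P3 ∧ P1 ≠ P4 ∧
  heightDet P1 P2 P3 P4 (h P1) (h P2) (h P3) (h P4) = 0

lemma dt_ne {t : Tri} (ht : t ∈ T.tris) {k : Fin 3} {b c : ℤ × ℤ} (h : oe t k = {b, c}) :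
    (dt b c (vt t k) : ℝ) ≠ 0 := by
  have ut := uni T ht
  have hs : sg t ≠ 0 := by intro h0; rw [h0] at ut; simp at ut
  rw [oe] at h
  rcases pair_cases h.symm (fun h => n12 k (vt_inj ut h)) with ⟨rfl, rfl⟩ | ⟨rfl, rfl⟩
  · rw [dt_vt]; exact_mod_cast hs
  · rw [dt_swap, dt_vt]; push_cast; rw [neg_ne_zero]; exact_mod_cast hs

lemma ker_zero {h : ℤ × ℤ → ℝ} (hk : KerLike T h) {t0 : Tri} (ht0 : t0 ∈ T.tris)
    (h0 : ∀ i, h (vt t0 i) = 0) : ∀ u ∈ latPts V, h u = 0 := by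
  have main := connect T (fun t => ∀ i, h (vt t i) = 0) (by
    intro t ht s hs k l hkl hts hZ
    have ut := uni T ht
    have he : oe t k ∈ intEdges T := by
      refine ⟨(edge_iff T).2 ⟨t, ht, k, rfl⟩, fun hf => ?_⟩
      have := two_int T ht hs hkl hts
      rw [mid_oe ut] at this
      exact (hf mid_seg).2 this
    obtain ⟨P1, P2, P3, P4, e, m1, m4, h14, hdet⟩ := hk _ he
    obtain ⟨t', ht', k', hk', hte⟩ := memTri_oe T m1
    obtain ⟨s', hs', l', hl', hse⟩ := memTri_oe T m4
    have hts' : t' ≠ s' := by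
      rintro rfl
      have := oe_inj (uni T ht') (hte.trans hse.symm)
      subst this
      exact h14 (hk'.symm.trans hl')
    have hz : ∀ u ∈ oe t k, h u = 0 := by
      intro u hu
      rw [mem_oe] at hu
      rcases hu with rfl | rfl <;> exact hZ _
    have z2 : h P2 = 0 := hz _ (by rw [e]; simp)
    have z3 : h P3 = 0 := hz _ (by rw [e]; simp)
    have d1 := dt_ne T ht' hte
    have d4 := dt_ne T hs' hse
    rw [hk'] at d1
    rw [hl'] at d4
    rw [hD, z2, z3] at hdet
    have d1' : (dt P1 P2 P3 : ℝ) ≠ 0 := by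
      have : dt P1 P2 P3 = dt P2 P3 P1 := by simp only [dt]; ring
      rwa [this]
    have hl : h (vt s l) = 0 := by
      rcases three T ht ht' hs' (e.trans hte.symm) (e.trans hse.symm) with a | a | a
      · subst a
        have hst : s = s' := by
          rcases three T hs ht hs' hkl.symm ((hkl.symm.trans e).trans hse.symm) with b | b | b
          · exact absurd b.symm hts
          · exact b
          · exact absurd b hts'
        subst hst
        have := oe_inj (uni T hs) ((hkl.symm.trans e).trans hse.symm)
        subst this
        have z1 : h P1 = 0 := by rw [← hk']; exact hZ _
        rw [z1] at hdet
        simp at hdet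
        rw [hl']
        rcases hdet with h | h
        · exact h
        · exact absurd (by exact_mod_cast h) d1'
      · subst a
        have hst : s = t' := by
          rcases three T hs ht ht' hkl.symm ((hkl.symm.trans e).trans hte.symm) with b | b | b
          · exact absurd b.symm hts
          · exact b
          · exact absurd b.symm hts'
        subst hst
        have := oe_inj (uni T hs) ((hkl.symm.trans e).trans hte.symm)
        subst this
        have z1 : h P4 = 0 := by rw [← hl']; exact hZ _
        rw [z1] at hdet
        simp at hdet
        rw [hk']
        rcases hdet with h | h
        · exact h
        · exact absurd (by exact_mod_cast h) d4
      · exact absurd a hts'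
    intro i
    by_cases hil : i = l
    · rw [hil]; exact hl
    · exact hz _ (by rw [hkl]; exact (vt_mem_oe (uni T hs)).2 hil)) ht0 h0
  intro u hu
  obtain ⟨t, ht, hut⟩ := cov T hu
  obtain ⟨i, rfl⟩ := lat_vt (uni T ht) hut
  exact main t ht i

/-- affine interpolation on a triangle -/
lemma aff_interp {t : Tri} (ht : |sg t| = 1) (f : Fin 3 → ℝ) :
    ∃ a b c : ℝ, ∀ i, f i = a + b * (vt t i).1 + c * (vt t i).2 := by
  refine ⟨∑ j, f j * al t j, ∑ j, f j * be t j, ∑ j, f j * ga t j, fun i => ?_⟩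
  have : ∀ j, f j * (if j = i then (1:ℝ) else 0) = f j * al t j + f j * be t j * (vt t i).1
      + f j * ga t j * (vt t i).2 := by
    intro j
    have h := B_vt t ht j i
    have h' : ((Bz t j (vt t i) : ℤ) : ℝ) = if j = i then (1:ℝ) else 0 := by
      rw [h]; split_ifs <;> simp
    rw [← h', Bz]; push_cast; ring
  rw [Finset.sum_mul, Finset.sum_mul, ← Finset.sum_add_distrib, ← Finset.sum_add_distrib]
  rw [← Finset.sum_congr rfl (fun j _ => this j)]
  simp

end
end KR

/-- Let `𝒯` be a regular unimodular triangulation of a lattice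
polygon of genus `g ≥ 2`, let `A = Δ ∩ ℤ²` and let `E` be the interior edges.
The linear map `λ : ℝ^A → ℝ^E` sending a height function to the bounded edge
lengths of the dual tropical curve (for a unimodular triangulation, the length
of the edge dual to an interior edge with adjacent triangles `P₁P₂P₃`, `P₂P₃P₄`
is the determinant of equation (1)) has kernel the 3-dimensional span of the
all-ones vector and the two coordinate vectors; consequently
`rank λ = |A| - 3 = |E| - 2g`. -/
theorem kernel_and_rank_of_lengthMap (V : Finset (ℤ × ℤ)) (hV : IsLatticePolygon V)
    (T : UT V) (g : ℕ) (hg2 : 2 ≤ g) (hg : (intPts V).ncard = g)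
    [Fintype ↥(latPts V)] [Fintype ↥(intEdges T)]
    (P1 P2 P3 P4 : ↥(intEdges T) → ↥(latPts V))
    (hP : ∀ e : ↥(intEdges T),
      (e.1 : Finset (ℤ × ℤ)) = {(P2 e).1, (P3 e).1} ∧
      memTri T (P1 e).1 (P2 e).1 (P3 e).1 ∧
      memTri T (P4 e).1 (P2 e).1 (P3 e).1 ∧ (P1 e).1 ≠ (P4 e).1)
    (lam : (↥(latPts V) → ℝ) →ₗ[ℝ] (↥(intEdges T) → ℝ))
    (hlam : ∀ (ω : ↥(latPts V) → ℝ) (e : ↥(intEdges T)),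
      lam ω e = heightDet (P1 e).1 (P2 e).1 (P3 e).1 (P4 e).1
        (ω (P1 e)) (ω (P2 e)) (ω (P3 e)) (ω (P4 e)))
    (hreg : ∃ ω : ↥(latPts V) → ℝ, ∀ e : ↥(intEdges T),
      0 < heightDet (P1 e).1 (P2 e).1 (P3 e).1 (P4 e).1
        (ω (P1 e)) (ω (P2 e)) (ω (P3 e)) (ω (P4 e))) :
    LinearMap.ker lam = Submodule.span ℝ
        ({fun _ => 1, fun p => ((p.1.1 : ℝ)), fun p => ((p.1.2 : ℝ))} :
          Set (↥(latPts V) → ℝ)) ∧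
      Module.finrank ℝ (LinearMap.range lam) = Fintype.card ↥(latPts V) - 3 ∧
      Fintype.card ↥(latPts V) - 3 = Fintype.card ↥(intEdges T) - 2 * g := by
  classical
  obtain ⟨t0, ht0⟩ := KR.tris_ne T hV
  have ut0 := KR.uni T ht0
  have hker : LinearMap.ker lam = Submodule.span ℝ
        ({fun _ => 1, fun p => ((p.1.1 : ℝ)), fun p => ((p.1.2 : ℝ))} :
          Set (↥(latPts V) → ℝ)) := by
    have aff : ∀ a b c : ℝ, lam (fun p => a + b * (p.1.1 : ℝ) + c * (p.1.2 : ℝ)) = 0 := by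
      intro a b c
      funext e
      rw [hlam]
      exact KR.hD_aff _ _ _ _ a b c
    apply le_antisymm
    · intro ω hω
      rw [LinearMap.mem_ker] at hω
      obtain ⟨a, b, c, habc⟩ := KR.aff_interp ut0 (fun i => ω ⟨KR.vt t0 i, KR.vt_lat T ht0 i⟩)
      set η : ↥(latPts V) → ℝ := ω - (fun p => a + b * (p.1.1 : ℝ) + c * (p.1.2 : ℝ)) with hη
      have hη0 : lam η = 0 := by rw [hη, map_sub, hω, aff, sub_zero]
      set h : ℤ × ℤ → ℝ := fun u => if hu : u ∈ latPts V then η ⟨u, hu⟩ else 0 with hh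
      have hhe : ∀ p : ↥(latPts V), h p.1 = η p := by
        intro p; simp only [hh]; rw [dif_pos p.2]
      have hk : KR.KerLike T h := by
        intro e he
        obtain ⟨h1, h2, h3, h4⟩ := hP ⟨e, he⟩
        refine ⟨_, _, _, _, h1, h2, h3, h4, ?_⟩
        rw [hhe, hhe, hhe, hhe, ← hlam, hη0]; rfl
      have hz := KR.ker_zero T hk ht0 (by
        intro i
        rw [hhe ⟨KR.vt t0 i, KR.vt_lat T ht0 i⟩, hη, Pi.sub_apply, habc i, sub_self])
      have hω' : ω = a • (fun _ => (1:ℝ)) + b • (fun p : ↥(latPts V) => ((p.1.1 : ℝ)))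
          + c • (fun p : ↥(latPts V) => ((p.1.2 : ℝ))) := by
        funext p
        have := hz p.1 p.2
        rw [hhe, hη, Pi.sub_apply, sub_eq_zero] at this
        rw [this]; simp
      rw [hω']
      refine Submodule.add_mem _ (Submodule.add_mem _ ?_ ?_) ?_ <;>
        exact Submodule.smul_mem _ _ (Submodule.subset_span (by simp))
    · rw [Submodule.span_le]
      rintro ω hω
      simp only [Set.mem_insert_iff, Set.mem_singleton_iff] at hω
      rw [SetLike.mem_coe, LinearMap.mem_ker]
      rcases hω with rfl | rfl | rfl
      · simpa using aff 1 0 0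
      · simpa using aff 0 1 0
      · simpa using aff 0 0 1
  have hli : LinearIndependent ℝ (![fun _ => 1, fun p => ((p.1.1 : ℝ)), fun p => ((p.1.2 : ℝ))] :
      Fin 3 → (↥(latPts V) → ℝ)) := by
    rw [Fintype.linearIndependent_iff]
    intro g hg
    rw [Fin.sum_univ_three] at hg
    have hv : ∀ u ∈ latPts V, g 0 + g 1 * (u.1 : ℝ) + g 2 * (u.2 : ℝ) = 0 := by
      intro u hu
      have := congrFun hg ⟨u, hu⟩
      simpa using this
    have hall : ∀ x : ℝ × ℝ, g 0 + g 1 * x.1 + g 2 * x.2 = 0 := by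
      intro x
      rw [KR.interp t0 ut0]
      exact Finset.sum_eq_zero fun i _ => by rw [hv _ (KR.vt_lat T ht0 i), mul_zero]
    have a0 := hall (0, 0)
    have a1 := hall (1, 0)
    have a2 := hall (0, 1)
    simp at a0 a1 a2
    have b1 : g 1 = 0 := by linarith
    have b2 : g 2 = 0 := by linarith
    intro i
    rcases KR.fin3 0 i with rfl | rfl | rfl
    · exact a0
    · exact b1
    · exact b2
  have hker3 : Module.finrank ℝ (LinearMap.ker lam) = 3 := by
    rw [hker]
    have := finrank_span_eq_card hli
    rw [Fintype.card_fin] at this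
    have hr : Set.range (![fun _ => 1, fun p => ((p.1.1 : ℝ)), fun p => ((p.1.2 : ℝ))] :
        Fin 3 → (↥(latPts V) → ℝ)) = {fun _ => 1, fun p => ((p.1.1 : ℝ)), fun p => ((p.1.2 : ℝ))} := by
      rw [Matrix.range_cons, Matrix.range_cons, Matrix.range_cons, Matrix.range_empty]
      ext x; simp; tauto
    rw [hr] at this
    exact this
  have hrn := LinearMap.finrank_range_add_finrank_ker lam
  rw [hker3, Module.finrank_fintype_fun_eq_card] at hrn
  refine ⟨hker, by omega, ?_⟩
  have h2 : KR.Two T := by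
    intro e he
    obtain ⟨h1, m1, m4, h14⟩ := hP ⟨e, he⟩
    obtain ⟨t, ht, k, hk, hte⟩ := KR.memTri_oe T m1
    obtain ⟨s, hs, l, hl, hse⟩ := KR.memTri_oe T m4
    refine ⟨t, ht, s, hs, ?_, k, l, hte.trans h1.symm, hse.trans h1.symm⟩
    rintro rfl
    have := KR.oe_inj (KR.uni T ht) (hte.trans hse.symm)
    subst this
    exact h14 (hk.symm.trans hl)
  have hc := KR.edge_count T hV h2
  have e1 : Fintype.card ↥(latPts V) = (latPts V).toFinset.card := (Set.toFinset_card _).symm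
  have e2 : Fintype.card ↥(intEdges T) =
      ((edgeSet T).filter (fun e => ¬ segOf e ⊆ frontier (polyHull V))).card := by
    rw [← Set.toFinset_card]
    congr 1
    ext e
    simp only [Set.mem_toFinset, Finset.mem_filter]
    rfl
  have e3 : ((latPts V).toFinset.filter (fun v => v ∈ intPts V)).card = g := by
    rw [← hg, ← Set.ncard_coe_finset]
    congr 1
    ext v
    simp only [Finset.coe_filter, Set.mem_toFinset, Set.mem_ofPred_eq]
    exact ⟨fun h => h.2, fun h => ⟨interior_subset (s := polyHull V) h, h⟩⟩
  omega
end
end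

section
/- Let g ≥ 2 and consider the moduli space 𝕄_𝒯 ⊆ ℝ^{3g-3} of metric skeletons (bridgeless chains of g loops) arising from the standard staircase triangulation 𝒯 of H_g = conv((0,0),(0,2),(g+1,0),(g+1,1)). With coordinates ℓ_s, ℓ_e (first and last loop lengths), h₁,…,h_{g-1} (shared edges between consecutive loops) and u_j, w_j (parallel upper/lower edges of the j-th loop, 2 ≤ j ≤ g-1), the set defined by u_j = w_j for all j, h₁ ≤ ℓ_s ≤ 2h₁, h_{g-1} ≤ ℓ_e, and h_j + j·u_j ≤ h_{j+1} ≤ h_j + (j+1)·u_j (together with nonnegativity) is a polyhedral cone of dimension 2g - 1. -/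
open Set

/-- If `S` lies in the image of an injective linear map `L` and its preimage contains a nonempty
open set, then the affine span of `S` has the dimension of the source. -/
lemma finrank_direction_of_open {V E : Type*} [NormedAddCommGroup V] [NormedSpace ℝ V]
    [AddCommGroup E] [Module ℝ E] (L : V →ₗ[ℝ] E) (hL : Function.Injective L) (S : Set E)
    (hS : ∀ x ∈ S, ∃ v, L v = x) (U : Set V) (hU : IsOpen U) (hne : U.Nonempty)
    (hUS : ∀ v ∈ U, L v ∈ S) :
    Module.finrank ℝ (affineSpan ℝ S).direction = Module.finrank ℝ V := by
  have h1 : L '' (L ⁻¹' S) = S := Set.image_preimage_eq_of_subset (fun x hx => hS x hx)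
  have h2 : affineSpan ℝ (L ⁻¹' S) = ⊤ := by
    rw [eq_top_iff, ← hU.affineSpan_eq_top hne]
    exact affineSpan_mono ℝ hUS
  have h3 : affineSpan ℝ S = (⊤ : AffineSubspace ℝ V).map L.toAffineMap := by
    rw [← h2, AffineSubspace.map_span, LinearMap.coe_toAffineMap, h1]
  rw [h3, AffineSubspace.map_direction, AffineSubspace.direction_top,
    LinearMap.toAffineMap_linear]
  rw [Submodule.map_top, LinearMap.finrank_range_of_inj hL]

/-- The parametrization of the subspace `u = w`. -/
def diagMap (m n : ℕ) : (ℝ × ℝ × (Fin m → ℝ) × (Fin n → ℝ)) →ₗ[ℝ]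
    (ℝ × ℝ × (Fin m → ℝ) × (Fin n → ℝ) × (Fin n → ℝ)) where
  toFun x := (x.1, x.2.1, x.2.2.1, x.2.2.2, x.2.2.2)
  map_add' _ _ := rfl
  map_smul' _ _ := rfl

/-- For `g ≥ 2`, the polyhedral cone of metric bridgeless
chains of `g` loops coming from the staircase triangulation of `H_g`, living in
a `(3g-3)`-dimensional space with coordinates
`(ℓ_s, ℓ_e, h₁,…,h_{g-1}, u₂,…,u_{g-1}, w₂,…,w_{g-1})` and cut out by
nonnegativity, the equations `u_j = w_j`, the inequalities
`h₁ ≤ ℓ_s ≤ 2h₁`, `h_{g-1} ≤ ℓ_e`, and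
`h_j + j·u_j ≤ h_{j+1} ≤ h_j + (j+1)·u_j`, has dimension `2g - 1`. -/
theorem staircase_cone_dim (g : ℕ) (hg : 2 ≤ g) :
    Module.finrank ℝ
      (affineSpan ℝ
        ({x : ℝ × ℝ × (Fin (g - 1) → ℝ) × (Fin (g - 2) → ℝ) × (Fin (g - 2) → ℝ) |
          0 ≤ x.1 ∧ 0 ≤ x.2.1 ∧ (∀ i, 0 ≤ x.2.2.1 i) ∧
          (∀ i, 0 ≤ x.2.2.2.1 i) ∧ (∀ i, 0 ≤ x.2.2.2.2 i) ∧
          (∀ i, x.2.2.2.1 i = x.2.2.2.2 i) ∧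
          x.2.2.1 ⟨0, by omega⟩ ≤ x.1 ∧ x.1 ≤ 2 * x.2.2.1 ⟨0, by omega⟩ ∧
          x.2.2.1 ⟨g - 2, by omega⟩ ≤ x.2.1 ∧
          ∀ i : Fin (g - 2),
            x.2.2.1 ⟨i.1, by have := i.2; omega⟩ +
                ((i.1 + 1 : ℕ) : ℝ) * x.2.2.2.1 i ≤
              x.2.2.1 ⟨i.1 + 1, by have := i.2; omega⟩ ∧
            x.2.2.1 ⟨i.1 + 1, by have := i.2; omega⟩ ≤
              x.2.2.1 ⟨i.1, by have := i.2; omega⟩ +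
                ((i.1 + 2 : ℕ) : ℝ) * x.2.2.2.1 i})).direction
      = 2 * g - 1 := by
  rw [finrank_direction_of_open (diagMap (g - 1) (g - 2)) ?_ _ ?_
    {x | 0 < x.1 ∧ 0 < x.2.1 ∧ (∀ i, 0 < x.2.2.1 i) ∧
          (∀ i, 0 < x.2.2.2 i) ∧
          x.2.2.1 ⟨0, by omega⟩ < x.1 ∧ x.1 < 2 * x.2.2.1 ⟨0, by omega⟩ ∧
          x.2.2.1 ⟨g - 2, by omega⟩ < x.2.1 ∧
          ∀ i : Fin (g - 2),
            x.2.2.1 ⟨i.1, by have := i.2; omega⟩ +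
                ((i.1 + 1 : ℕ) : ℝ) * x.2.2.2 i <
              x.2.2.1 ⟨i.1 + 1, by have := i.2; omega⟩ ∧
            x.2.2.1 ⟨i.1 + 1, by have := i.2; omega⟩ <
              x.2.2.1 ⟨i.1, by have := i.2; omega⟩ +
                ((i.1 + 2 : ℕ) : ℝ) * x.2.2.2 i} ?_ ?_ ?_]
  · simp only [Module.finrank_prod, Module.finrank_self, Module.finrank_fin_fun]
    omega
  · intro x y hxy
    simp only [diagMap, LinearMap.coe_mk, AddHom.coe_mk, Prod.mk.injEq] at hxy
    obtain ⟨h1, h2, h3, h4, -⟩ := hxy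
    exact Prod.ext h1 (Prod.ext h2 (Prod.ext h3 h4))
  · rintro ⟨a, b, h, u, w⟩ ⟨-, -, -, -, -, huw, -⟩
    have : u = w := funext huw
    subst this
    exact ⟨(a, b, h, u), rfl⟩
  · simp only [Set.setOf_and, Set.setOf_forall]
    repeat' apply IsOpen.inter
    all_goals
      first
      | exact isOpen_lt (by fun_prop) (by fun_prop)
      | exact isOpen_iInter_of_finite fun i => isOpen_lt (by fun_prop) (by fun_prop)
      | exact isOpen_iInter_of_finite fun i =>
          (isOpen_lt (by fun_prop) (by fun_prop)).inter (isOpen_lt (by fun_prop) (by fun_prop))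
  · refine ⟨(3 / 2, (((g - 2 : ℕ) : ℝ) + 1) ^ 2 + 1, fun i => ((i.1 : ℝ) + 1) ^ 2, fun _ => 2),
      by norm_num, by positivity, fun i => by positivity, fun i => by norm_num, by norm_num,
      by norm_num, by simp, fun i => ⟨?_, ?_⟩⟩
    · push_cast; nlinarith
    · push_cast; nlinarith
  · rintro ⟨a, b, h, u⟩ ⟨h1, h2, h3, h4, h5, h6, h7, h8⟩
    exact ⟨h1.le, h2.le, fun i => (h3 i).le, fun i => (h4 i).le, fun i => (h4 i).le,
      fun i => rfl, h5.le, h6.le, h7.le, fun i => ⟨(h8 i).1.le, (h8 i).2.le⟩⟩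
end
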